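/- arXiv:1712.08346 — 13 statements merged into one kernel-verified Lean document; each statement's English description precedes it below -/
import Mathlib

section
/- Let n = n_1 + ... + n_r with each n_i ≥ 1, let W ∈ GL_n(ℝ), and let t, t' ∈ (ℝ_{>0})^r satisfy ∏_{i=1}^r t_i^{n_i} = ∏_{i=1}^r (t'_i)^{n_i} = 1. If there exist a nonzero real number λ and a matrix R in the orthogonal group O(n) such that W·I(t) = λ·W·I(t')·R, then t = t'. (This is the injectivity of the archimedean part of the Heegner object.) -/
open Matrix

/-- **Injectivity of the archimedean part of the Heegner object.**
If `W ∈ GL_n(ℝ)` and `t, t'` are positive tuples with `∏ tᵢ^{nᵢ} = ∏ t'ᵢ^{nᵢ} = 1`, and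
`W · I(t) = λ · W · I(t') · R` for some `λ ≠ 0` and orthogonal `R`, then `t = t'`. -/
theorem stmt_0 {r : ℕ} (n : Fin r → ℕ) (hn : ∀ i, 1 ≤ n i)
    (W : Matrix ((i : Fin r) × Fin (n i)) ((i : Fin r) × Fin (n i)) ℝ)
    (hW : IsUnit W)
    (t t' : Fin r → ℝ)
    (ht : ∀ i, 0 < t i) (ht' : ∀ i, 0 < t' i)
    (htprod : ∏ i, t i ^ n i = 1) (ht'prod : ∏ i, t' i ^ n i = 1)
    (lam : ℝ) (hlam : lam ≠ 0)
    (R : Matrix ((i : Fin r) × Fin (n i)) ((i : Fin r) × Fin (n i)) ℝ)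
    (hR : R * Rᵀ = 1)
    (heq : W * Matrix.diagonal (fun k => t k.1) =
      lam • (W * Matrix.diagonal (fun k => t' k.1) * R)) :
    t = t' := by
  have h1 : Matrix.diagonal (fun k : (i : Fin r) × Fin (n i) => t k.1) =
      lam • (Matrix.diagonal (fun k : (i : Fin r) × Fin (n i) => t' k.1) * R) := by
    apply hW.mul_left_cancel
    rw [heq, Matrix.mul_smul, Matrix.mul_assoc]
  have h2 := congrArg (fun M => M * Mᵀ) h1
  have h3 : (lam • (Matrix.diagonal (fun k : (i : Fin r) × Fin (n i) => t' k.1) * R)) *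
      (lam • (Matrix.diagonal (fun k : (i : Fin r) × Fin (n i) => t' k.1) * R))ᵀ =
      (lam * lam) • Matrix.diagonal (fun k : (i : Fin r) × Fin (n i) => t' k.1 * t' k.1) := by
    rw [Matrix.transpose_smul, Matrix.transpose_mul, Matrix.smul_mul, Matrix.mul_smul,
      smul_smul, Matrix.mul_assoc, ← Matrix.mul_assoc R, hR, Matrix.one_mul,
      Matrix.diagonal_transpose, Matrix.diagonal_mul_diagonal]
  simp only [h3] at h2
  rw [Matrix.diagonal_transpose, Matrix.diagonal_mul_diagonal] at h2
  have key : ∀ i, t i = |lam| * t' i := by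
    intro i
    have h := congrFun (congrFun h2 ⟨i, ⟨0, hn i⟩⟩) ⟨i, ⟨0, hn i⟩⟩
    simp only [Matrix.smul_apply, Matrix.diagonal_apply_eq, smul_eq_mul] at h
    have hp : 0 ≤ |lam| * t' i := mul_nonneg (abs_nonneg _) (ht' i).le
    rw [← sq_eq_sq₀ (ht i).le hp, mul_pow, sq_abs]
    linarith
  have hpow : |lam| ^ (∑ i, n i) = 1 := by
    rw [← htprod]
    simp only [key, mul_pow, Finset.prod_mul_distrib, ht'prod, mul_one,
      Finset.prod_pow_eq_pow_sum]
  funext i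
  have hs : ∑ i, n i ≠ 0 := by
    have := Finset.single_le_sum (f := n) (fun j _ => Nat.zero_le _) (Finset.mem_univ i)
    have := hn i
    omega
  rw [key i, (pow_eq_one_iff_of_nonneg (abs_nonneg lam) hs).1 hpow, one_mul]
end

section
/- The map φ restricts to an isomorphism of groups from Γ_{w,N} = {A ∈ 𝒜_{w,N} : det(A) = 1} onto 𝒪_{w,N}^1 = {x ∈ 𝒪_{w,N}ˣ : N_{F/ℚ}(x) = 1}. That is: Γ_{w,N} is a group under matrix multiplication, for every A ∈ Γ_{w,N} the element φ(A) is a unit of the ring 𝒪_{w,N} with norm 1, every unit of 𝒪_{w,N} of norm 1 arises as φ(A) for a unique A ∈ Γ_{w,N}, and φ is multiplicative on Γ_{w,N}. -/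
/-- `ℤ[1/N]`, the subring of `ℚ` of rationals whose denominator divides a power of `N`,
realized as the subring of `ℚ` generated by `1/N`. -/
def zInv (N : ℕ) : Subring ℚ := Subring.closure {(N : ℚ)⁻¹}

theorem zInv_adjugate_mem (N n : ℕ) (A : Matrix (Fin n) (Fin n) ℚ)
    (hA : ∀ i j, A i j ∈ zInv N) (i j : Fin n) : A.adjugate i j ∈ zInv N := by
  let B : Matrix (Fin n) (Fin n) (zInv N) := Matrix.of fun i j => ⟨A i j, hA i j⟩
  have hB : (zInv N).subtype.mapMatrix B = A := by
    ext i j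
    rfl
  have h := RingHom.map_adjugate (zInv N).subtype B
  rw [hB] at h
  rw [← h]
  exact (B.adjugate i j).2

/-- **Proposition (order and unit group associated to `w`), part (iii).**
`φ` restricts to a group isomorphism `Γ_{w,N} ≃ 𝒪_{w,N}^1`: `Γ_{w,N}` is a group under matrix
multiplication, `φ(A)` is a norm-one unit of `𝒪_{w,N}` for every `A ∈ Γ_{w,N}`, every norm-one
unit of `𝒪_{w,N}` arises as `φ(A)` for a unique `A ∈ Γ_{w,N}`, and `φ` is multiplicative. -/
theorem stmt_3 (N : ℕ) (hN : 0 < N)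
    (F : Type*) [Field F] [Algebra ℚ F] [FiniteDimensional ℚ F]
    (n : ℕ) (w : Fin n → F)
    (hw : LinearIndependent ℚ w) (hspan : Submodule.span ℚ (Set.range w) = ⊤)
    (Aw : Set (Matrix (Fin n) (Fin n) ℚ))
    (hAw : Aw = {A | (∀ i j, A i j ∈ zInv N) ∧
      ∃ lam : F, ∀ i, (∑ j, algebraMap ℚ F (A i j) * w j) = lam * w i})
    (φ : Matrix (Fin n) (Fin n) ℚ → F)
    (hφ : ∀ A ∈ Aw, ∀ i, (∑ j, algebraMap ℚ F (A i j) * w j) = φ A * w i)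
    (Γ : Set (Matrix (Fin n) (Fin n) ℚ)) (hΓ : Γ = {A ∈ Aw | A.det = 1})
    (O : Set F) (hO : O = φ '' Aw) :
    -- Γ_{w,N} is a group under matrix multiplication
    ((1 : Matrix (Fin n) (Fin n) ℚ) ∈ Γ ∧
      (∀ A ∈ Γ, ∀ B ∈ Γ, A * B ∈ Γ) ∧
      (∀ A ∈ Γ, ∃ B ∈ Γ, A * B = 1 ∧ B * A = 1)) ∧
    -- φ(A) is a unit of 𝒪_{w,N} of norm one, for A ∈ Γ_{w,N}
    (∀ A ∈ Γ, φ A ∈ O ∧ (∃ y ∈ O, φ A * y = 1 ∧ y * φ A = 1) ∧ Algebra.norm ℚ (φ A) = 1) ∧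
    -- every norm-one unit of 𝒪_{w,N} is φ(A) for a unique A ∈ Γ_{w,N}
    (∀ x ∈ O, (∃ y ∈ O, x * y = 1) → Algebra.norm ℚ x = 1 → ∃! A, A ∈ Γ ∧ φ A = x) ∧
    -- φ is multiplicative on Γ_{w,N}
    (∀ A ∈ Γ, ∀ B ∈ Γ, φ (A * B) = φ A * φ B) := by
  classical
  let b : Module.Basis (Fin n) ℚ F := Module.Basis.mk hw hspan.ge
  have hb : ∀ i, b i = w i := fun i => Module.Basis.mk_apply hw hspan.ge i
  let T : F → Matrix (Fin n) (Fin n) ℚ := fun x => (Algebra.leftMulMatrix b x).transpose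
  have hT : ∀ x i j, T x i j = b.repr (x * w i) j := by
    intro x i j
    simp only [T, Matrix.transpose_apply, Algebra.leftMulMatrix_eq_repr_mul, hb]
  have hTmul : ∀ x y, T (x * y) = T x * T y := by
    intro x y
    simp only [T]
    rw [mul_comm x y, map_mul, Matrix.transpose_mul]
  have hT1 : T 1 = 1 := by simp [T]
  have hTdet : ∀ x, (T x).det = Algebra.norm ℚ x := by
    intro x
    simp only [T]
    rw [Matrix.det_transpose, Algebra.norm_eq_matrix_det b]
  have hTinj : ∀ x y, T x = T y → x = y := by
    intro x y h
    exact Algebra.leftMulMatrix_injective b (Matrix.transpose_injective h)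
  have key : ∀ (A : Matrix (Fin n) (Fin n) ℚ) (x : F),
      (∀ i, (∑ j, algebraMap ℚ F (A i j) * w j) = x * w i) ↔ A = T x := by
    intro A x
    constructor
    · intro h
      ext i j
      rw [hT, ← h i]
      have : (∑ j, algebraMap ℚ F (A i j) * w j) = ∑ j, A i j • b j := by
        simp [hb, Algebra.smul_def]
      rw [this, b.repr_sum_self]
    · rintro rfl i
      conv_rhs => rw [← b.sum_repr (x * w i)]
      simp [hb, Algebra.smul_def, hT]
  have hmem : ∀ A, A ∈ Aw ↔ (∀ i j, A i j ∈ zInv N) ∧ ∃ x, A = T x := by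
    intro A
    rw [hAw]
    simp only [Set.mem_setOf_eq, key]
  have hφT : ∀ A ∈ Aw, A = T (φ A) := fun A hA => (key A _).1 (hφ A hA)
  have hφx : ∀ x, T x ∈ Aw → φ (T x) = x := fun x hx => (hTinj _ _ (hφT _ hx)).symm
  have hmul : ∀ A ∈ Aw, ∀ B ∈ Aw, A * B ∈ Aw := by
    intro A hA B hB
    refine (hmem _).2 ⟨fun i j => ?_, φ A * φ B, ?_⟩
    · rw [Matrix.mul_apply]
      exact Subring.sum_mem _ fun k _ =>
        Subring.mul_mem _ (((hmem A).1 hA).1 i k) (((hmem B).1 hB).1 k j)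
    · rw [hTmul, ← hφT A hA, ← hφT B hB]
  have hφmul : ∀ A ∈ Aw, ∀ B ∈ Aw, φ (A * B) = φ A * φ B := by
    intro A hA B hB
    apply hTinj
    rw [← hφT _ (hmul A hA B hB), hTmul, ← hφT A hA, ← hφT B hB]
  have h1 : (1 : Matrix (Fin n) (Fin n) ℚ) ∈ Aw := by
    refine (hmem _).2 ⟨fun i j => ?_, 1, hT1.symm⟩
    rw [Matrix.one_apply]
    split_ifs
    · exact Subring.one_mem _
    · exact Subring.zero_mem _
  have hφ1 : φ 1 = 1 := hTinj _ _ (by rw [← hφT 1 h1, hT1])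
  have hΓm : ∀ A, A ∈ Γ ↔ A ∈ Aw ∧ A.det = 1 := by
    intro A
    rw [hΓ]
    rfl
  have hinv : ∀ A ∈ Γ, ∃ B ∈ Γ, A * B = 1 ∧ B * A = 1 := by
    intro A hA
    obtain ⟨hA, hd⟩ := (hΓm A).1 hA
    have e1 : A * A.adjugate = 1 := by rw [Matrix.mul_adjugate, hd, one_smul]
    have e2 : A.adjugate * A = 1 := by rw [Matrix.adjugate_mul, hd, one_smul]
    refine ⟨A.adjugate, (hΓm _).2 ⟨(hmem _).2
      ⟨zInv_adjugate_mem N n A ((hmem A).1 hA).1, (φ A)⁻¹, ?_⟩, ?_⟩, e1, e2⟩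
    · have hne : φ A ≠ 0 := by
        intro h0
        have : Algebra.norm ℚ (φ A) = 1 := by rw [← hTdet, ← hφT A hA, hd]
        rw [h0, Algebra.norm_zero] at this
        exact zero_ne_one this
      have e3 : A * T (φ A)⁻¹ = 1 := by
        have e4 : T (φ A) * T (φ A)⁻¹ = 1 := by rw [← hTmul, mul_inv_cancel₀ hne, hT1]
        rwa [← hφT A hA] at e4
      calc A.adjugate = A.adjugate * (A * T (φ A)⁻¹) := by rw [e3, mul_one]
        _ = T (φ A)⁻¹ := by rw [← mul_assoc, e2, one_mul]
    · have := congrArg Matrix.det e1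
      rwa [Matrix.det_mul, hd, one_mul, Matrix.det_one] at this
  refine ⟨⟨(hΓm 1).2 ⟨h1, Matrix.det_one⟩, ?_, hinv⟩, ?_, ?_, ?_⟩
  · intro A hA B hB
    obtain ⟨hA, hdA⟩ := (hΓm A).1 hA
    obtain ⟨hB, hdB⟩ := (hΓm B).1 hB
    exact (hΓm _).2 ⟨hmul A hA B hB, by rw [Matrix.det_mul, hdA, hdB, one_mul]⟩
  · intro A hAΓ
    obtain ⟨hA, hdA⟩ := (hΓm A).1 hAΓ
    obtain ⟨B, hBΓ, hAB, hBA⟩ := hinv A hAΓ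
    have hB := ((hΓm B).1 hBΓ).1
    rw [hO]
    refine ⟨⟨A, hA, rfl⟩, ⟨φ B, ⟨B, hB, rfl⟩, ?_, ?_⟩, ?_⟩
    · rw [← hφmul A hA B hB, hAB, hφ1]
    · rw [← hφmul B hB A hA, hBA, hφ1]
    · rw [← hTdet, ← hφT A hA, hdA]
  · intro x hx _ hnorm
    rw [hO] at hx
    obtain ⟨A, hA, rfl⟩ := hx
    refine ⟨A, ⟨(hΓm A).2 ⟨hA, ?_⟩, rfl⟩, ?_⟩
    · rw [hφT A hA, hTdet, hnorm]
    · rintro B ⟨hB, hBA⟩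
      rw [hφT B ((hΓm B).1 hB).1, hBA, ← hφT A hA]
  · intro A hA B hB
    exact hφmul A ((hΓm A).1 hA).1 B ((hΓm B).1 hB).1
end

section
/- The abelian group 𝒪_{w,N}^1 = {x ∈ 𝒪_{w,N}ˣ : N_{F/ℚ}(x) = 1} is finitely generated of rank M = (g_∞ − 1) + Σ_{p | N} (g_p − 1); that is, it contains a free abelian subgroup of finite index isomorphic to ℤ^M, where g_∞ is the number of archimedean places of F and, for each prime p dividing N, g_p is the number of prime ideals of the ring of integers of F lying above p. -/
namespace Stmt4
open Module

/-- A submodule with torsion relative quotient has the same rank. -/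
lemma finrank_eq_of_torsion {A : Type*} [AddCommGroup A] (H K : Submodule ℤ A) (hK : K.FG)
    (hle : H ≤ K) (h : ∀ x ∈ K, ∃ m : ℕ, m ≠ 0 ∧ m • x ∈ H) :
    finrank ℤ H = finrank ℤ K := by
  have : Module.Finite ℤ K := Module.Finite.iff_fg.mpr hK
  have h1 := (H.submoduleOf K).finrank_quotient_add_finrank
  have h2 : finrank ℤ (K ⧸ H.submoduleOf K) = 0 := by
    rw [Module.finrank_eq_zero_iff_isTorsion]
    intro x
    obtain ⟨y, rfl⟩ := Submodule.mkQ_surjective _ x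
    obtain ⟨m, hm, hy⟩ := h y y.2
    refine ⟨⟨(m : ℤ), mem_nonZeroDivisors_of_ne_zero (by exact_mod_cast hm)⟩, ?_⟩
    change (m : ℤ) • (H.submoduleOf K).mkQ y = 0
    rw [← map_smul, Submodule.mkQ_apply, Submodule.Quotient.mk_eq_zero]
    change ((m : ℤ) • y : A) ∈ H
    simpa using hy
  have h3 : finrank ℤ (H.submoduleOf K) = finrank ℤ H :=
    (Submodule.submoduleOfEquivOfLe hle).finrank_eq
  omega

lemma finrank_map_add {A B : Type*} [AddCommGroup A] [AddCommGroup B] (V : Submodule ℤ A)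
    (hV : V.FG) (f : A →ₗ[ℤ] B) :
    finrank ℤ (V.map f) + finrank ℤ (V ⊓ LinearMap.ker f : Submodule ℤ A) = finrank ℤ V := by
  have : Module.Finite ℤ V := Module.Finite.iff_fg.mpr hV
  have h1 := (LinearMap.ker (f.domRestrict V)).finrank_quotient_add_finrank
  rw [(f.domRestrict V).quotKerEquivRange.finrank_eq, LinearMap.range_domRestrict] at h1
  have e : (LinearMap.ker (f.domRestrict V)).map V.subtype = V ⊓ LinearMap.ker f := by
    rw [LinearMap.ker_domRestrict]
    exact Submodule.map_comap_subtype _ _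
  have h2 := (Submodule.equivMapOfInjective V.subtype V.injective_subtype
    (LinearMap.ker (f.domRestrict V))).finrank_eq
  rw [e] at h2
  omega

lemma finrank_of_pi {ι : Type*} [Fintype ι] [DecidableEq ι] (H : Submodule ℤ (ι → ℤ)) 
    (h : ∀ i, ∃ m : ℕ, m ≠ 0 ∧ m • (Pi.single i 1 : ι → ℤ) ∈ H) :
    finrank ℤ H = Fintype.card ι := by
  choose m hm hH using h
  rw [finrank_eq_of_torsion H ⊤ Module.Finite.fg_top le_top, finrank_top, finrank_fintype_fun_eq_card]
  intro x _
  refine ⟨∏ i, m i, Finset.prod_ne_zero_iff.mpr fun i _ => hm i, ?_⟩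
  rw [pi_eq_sum_univ' x, Finset.smul_sum]
  refine H.sum_mem fun i _ => ?_
  obtain ⟨c, hc⟩ := Finset.dvd_prod_of_mem m (Finset.mem_univ i)
  rw [hc]
  have := H.smul_mem ((c : ℤ) * x i) (hH i)
  convert this using 1
  ext j
  by_cases hj : i = j
  · subst hj; simp; ring
  · simp [Ne.symm hj]

/-- Structure of a finitely generated abelian group. -/
lemma exists_free {A : Type*} [AddCommGroup A] [Module.Finite ℤ A] :
    ∃ f : (Fin (finrank ℤ A) → ℤ) →ₗ[ℤ] A, Function.Injective f ∧
      ∃ (m : ℕ) (reps : Fin m → A), ∀ x, ∃ i v, x = reps i + f v := by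
  obtain ⟨s, hs⟩ := Module.projective_lifting_property _ LinearMap.id
    (Submodule.torsion ℤ A).mkQ_surjective
  have hr : finrank ℤ (A ⧸ Submodule.torsion ℤ A) = finrank ℤ A :=
    finrank_quotient_eq_of_le_torsion le_rfl
  let b := Module.finBasisOfFinrankEq ℤ (A ⧸ Submodule.torsion ℤ A) hr
  have hfin : Finite (Submodule.torsion ℤ A) := by
    apply Module.finite_of_fg_torsion
    exact Submodule.torsion_isTorsion
  obtain ⟨m, ⟨e⟩⟩ := Finite.exists_equiv_fin (Submodule.torsion ℤ A)
  refine ⟨s ∘ₗ b.equivFun.symm.toLinearMap, ?_, m, fun i => (e.symm i : A), ?_⟩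
  · have hsinj : Function.Injective s := by
      intro x y hxy
      have := congrArg (Submodule.torsion ℤ A).mkQ hxy
      simpa only [← LinearMap.comp_apply, hs, LinearMap.id_apply] using this
    exact hsinj.comp b.equivFun.symm.injective
  · intro x
    have hx : x - s ((Submodule.torsion ℤ A).mkQ x) ∈ Submodule.torsion ℤ A := by
      rw [← Submodule.Quotient.mk_eq_zero, ← Submodule.mkQ_apply, map_sub,
        ← LinearMap.comp_apply, hs]
      simp
    refine ⟨e ⟨_, hx⟩, b.equivFun ((Submodule.torsion ℤ A).mkQ x), ?_⟩
    simp


section Loc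
variable {F : Type*} [Field F]

/-- The localization `T[1/N]` inside `F`. -/
def loc (N : ℕ) (T : Subring F) : Subring F where
  carrier := {x | ∃ k : ℕ, (N : F) ^ k * x ∈ T}
  mul_mem' := by
    rintro a b ⟨k, hk⟩ ⟨l, hl⟩
    refine ⟨k + l, ?_⟩
    have := T.mul_mem hk hl
    convert this using 1
    ring
  one_mem' := ⟨0, by simp⟩
  add_mem' := by
    rintro a b ⟨k, hk⟩ ⟨l, hl⟩
    refine ⟨k + l, ?_⟩
    have h1 := T.mul_mem (pow_mem (natCast_mem T N) l) hk
    have h2 := T.mul_mem (pow_mem (natCast_mem T N) k) hl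
    have := T.add_mem h1 h2
    convert this using 1
    ring
  zero_mem' := ⟨0, by simp⟩
  neg_mem' := by
    rintro a ⟨k, hk⟩
    exact ⟨k, by simpa using hk⟩

lemma mem_loc {N : ℕ} {T : Subring F} {x : F} :
    x ∈ loc N T ↔ ∃ k : ℕ, (N : F) ^ k * x ∈ T := Iff.rfl

lemma le_loc (N : ℕ) (T : Subring F) : T ≤ loc N T := fun x hx => ⟨0, by simpa using hx⟩

lemma loc_of_pow_mul {N : ℕ} {T : Subring F} {x : F} (k : ℕ) (h : (N : F) ^ k * x ∈ loc N T) :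
    x ∈ loc N T := by
  obtain ⟨l, hl⟩ := h
  exact ⟨l + k, by rwa [pow_add, mul_assoc]⟩

/-- Units of `F` lying in `B` together with their inverse. -/
def unitsIn (B : Subring F) : Submodule ℤ (Additive Fˣ) :=
  AddSubgroup.toIntSubmodule (Subgroup.toAddSubgroup
    { carrier := {x : Fˣ | (x : F) ∈ B ∧ ((x⁻¹ : Fˣ) : F) ∈ B}
      mul_mem' := by
        rintro a b ⟨h1, h2⟩ ⟨h3, h4⟩
        refine ⟨by simpa using B.mul_mem h1 h3, ?_⟩
        rw [mul_inv]
        simpa using B.mul_mem h2 h4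
      one_mem' := by simp
      inv_mem' := by
        rintro a ⟨h1, h2⟩
        exact ⟨h2, by simpa using h1⟩ })

lemma mem_unitsIn {B : Subring F} {x : Additive Fˣ} :
    x ∈ unitsIn B ↔ ((x.toMul : Fˣ) : F) ∈ B ∧ ((x.toMul⁻¹ : Fˣ) : F) ∈ B := Iff.rfl

/-- Units of `F` with norm one. -/
noncomputable def normOne (F : Type*) [Field F] [Algebra ℚ F] : Submodule ℤ (Additive Fˣ) :=
  AddSubgroup.toIntSubmodule (Subgroup.toAddSubgroup
    (MonoidHom.ker (Units.map (Algebra.norm ℚ : F →* ℚ))))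

lemma mem_normOne [Algebra ℚ F] {x : Additive Fˣ} :
    x ∈ normOne F ↔ Algebra.norm ℚ ((x.toMul : Fˣ) : F) = 1 := by
  change Units.map (Algebra.norm ℚ : F →* ℚ) x.toMul = 1 ↔ _
  rw [Units.ext_iff]
  rfl

end Loc

section NF
variable (F : Type*) [Field F] [NumberField F]
open NumberField IsDedekindDomain nonZeroDivisors

/-- The ring of integers as a subring. -/
abbrev OF : Subring F := (integralClosure ℤ F).toSubring

lemma mem_OF {x : F} : x ∈ OF F ↔ ∃ y : 𝓞 F, algebraMap (𝓞 F) F y = x :=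
  ⟨fun h => ⟨⟨x, h⟩, rfl⟩, by rintro ⟨y, rfl⟩; exact y.2⟩

/-- Valuation vector. -/
noncomputable def valMap (S : Type*) (P : S → HeightOneSpectrum (𝓞 F)) :
    Additive Fˣ →ₗ[ℤ] (S → ℤ) :=
  AddMonoidHom.toIntLinearMap
    { toFun := fun x s => FractionalIdeal.count F (P s)
        (FractionalIdeal.spanSingleton (𝓞 F)⁰ ((x.toMul : Fˣ) : F))
      map_zero' := by
        ext s
        simp [FractionalIdeal.count_one]
      map_add' := by
        intro x y
        ext s
        simp only [toMul_add, Units.val_mul, Pi.add_apply]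
        rw [← FractionalIdeal.spanSingleton_mul_spanSingleton, FractionalIdeal.count_mul]
        · exact FractionalIdeal.spanSingleton_ne_zero_iff.mpr x.toMul.ne_zero
        · exact FractionalIdeal.spanSingleton_ne_zero_iff.mpr y.toMul.ne_zero }

lemma valMap_apply (S : Type*) (P : S → HeightOneSpectrum (𝓞 F)) (x : Additive Fˣ) (s : S) :
    valMap F S P x s = FractionalIdeal.count F (P s)
        (FractionalIdeal.spanSingleton (𝓞 F)⁰ ((x.toMul : Fˣ) : F)) := rfl

/-- p-adic valuations of the norm. -/
noncomputable def nrmMap (N : ℕ) : Additive Fˣ →ₗ[ℤ] (N.primeFactors → ℤ) :=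
  AddMonoidHom.toIntLinearMap
    { toFun := fun x p => padicValRat p (Algebra.norm ℚ ((x.toMul : Fˣ) : F))
      map_zero' := by
        ext p
        simp
      map_add' := by
        intro x y
        ext p
        have : Fact (p : ℕ).Prime := ⟨Nat.prime_of_mem_primeFactors p.2⟩
        simp only [toMul_add, Units.val_mul, Pi.add_apply, map_mul]
        rw [padicValRat.mul]
        · simp
        · simp }

lemma nrmMap_apply (N : ℕ) (x : Additive Fˣ) (p : N.primeFactors) :
    nrmMap F N x p = padicValRat p (Algebra.norm ℚ ((x.toMul : Fˣ) : F)) := rfl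

lemma count_nonneg_of_integral (v : HeightOneSpectrum (𝓞 F)) (y : 𝓞 F) :
    0 ≤ FractionalIdeal.count F v
      (FractionalIdeal.spanSingleton (𝓞 F)⁰ (algebraMap (𝓞 F) F y)) := by
  rw [← FractionalIdeal.coeIdeal_span_singleton]
  exact FractionalIdeal.count_coe_nonneg F v _

lemma count_eq_zero_of_notMem (v : HeightOneSpectrum (𝓞 F)) (y : 𝓞 F) (hy : y ∉ v.asIdeal) :
    FractionalIdeal.count F v
      (FractionalIdeal.spanSingleton (𝓞 F)⁰ (algebraMap (𝓞 F) F y)) = 0 := by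
  rw [← FractionalIdeal.coeIdeal_span_singleton]
  have hy0 : y ≠ 0 := by rintro rfl; simp at hy
  classical
  have hs0 : Ideal.span {y} ≠ 0 := by simpa using hy0
  rw [FractionalIdeal.count_coe F v hs0]
  by_contra h
  apply hy
  have := (Associates.count_ne_zero_iff_dvd hs0 v.irreducible).mp (by exact_mod_cast h)
  rw [Ideal.dvd_span_singleton] at this
  exact this

/-- An element with zero valuations at all primes is a unit. -/
lemma isUnit_of_count (x : Fˣ)
    (h : ∀ v : HeightOneSpectrum (𝓞 F), FractionalIdeal.count F v
      (FractionalIdeal.spanSingleton (𝓞 F)⁰ (x : F)) = 0) :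
    ∃ u : (𝓞 F)ˣ, Units.map (algebraMap (𝓞 F) F : 𝓞 F →* F) u = x := by
  have key : ∀ x : Fˣ, (∀ v : HeightOneSpectrum (𝓞 F), FractionalIdeal.count F v
      (FractionalIdeal.spanSingleton (𝓞 F)⁰ (x : F)) = 0) →
      ∃ y : 𝓞 F, algebraMap (𝓞 F) F y = x := by
    intro x h
    have h0 : FractionalIdeal.spanSingleton (𝓞 F)⁰ (x : F) ≠ 0 :=
      FractionalIdeal.spanSingleton_ne_zero_iff.mpr x.ne_zero
    have h1 := FractionalIdeal.finprod_heightOneSpectrum_factorization' F h0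
    simp only [h, zpow_zero, finprod_one] at h1
    have h2 := FractionalIdeal.mem_spanSingleton_self (𝓞 F)⁰ (x : F)
    rw [← h1, FractionalIdeal.mem_one_iff] at h2
    exact h2
  obtain ⟨y, hy⟩ := key x h
  obtain ⟨z, hz⟩ := key x⁻¹ (by
    intro v
    have := h v
    rw [Units.val_inv_eq_inv_val, ← FractionalIdeal.spanSingleton_inv, FractionalIdeal.count_inv, this,
      neg_zero])
  have hinj : Function.Injective (algebraMap (𝓞 F) F) := RingOfIntegers.coe_injective
  have hyz : y * z = 1 := hinj (by rw [map_mul, hy, hz]; simp)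
  refine ⟨⟨y, z, hyz, by rw [mul_comm, hyz]⟩, ?_⟩
  ext
  exact hy

/-- The inclusion of units. -/
noncomputable def iota : Additive (𝓞 F)ˣ →ₗ[ℤ] Additive Fˣ :=
  (MonoidHom.toAdditive (Units.map (algebraMap (𝓞 F) F : 𝓞 F →* F))).toIntLinearMap

lemma iota_inj : Function.Injective (iota F) := by
  intro x y h
  have h1 : Units.map (algebraMap (𝓞 F) F : 𝓞 F →* F) x.toMul =
      Units.map (algebraMap (𝓞 F) F : 𝓞 F →* F) y.toMul := h
  have h2 : algebraMap (𝓞 F) F x.toMul = algebraMap (𝓞 F) F y.toMul := congrArg Units.val h1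
  exact Additive.toMul.injective (Units.ext (RingOfIntegers.coe_injective h2))

/-- The primes above `N`. -/
abbrev SN (N : ℕ) : Type _ := {v : HeightOneSpectrum (𝓞 F) // (N : 𝓞 F) ∈ v.asIdeal}

lemma finite_SN (N : ℕ) (hN : 0 < N) : Finite (SN F N) := by
  have h : Ideal.span {(N : 𝓞 F)} ≠ 0 := by
    simpa using hN.ne'
  have := Ideal.finite_factors h
  refine (this.subset ?_).to_subtype
  intro v hv
  exact Ideal.dvd_span_singleton.mpr hv

/-- The S-units. -/
noncomputable abbrev VN (N : ℕ) : Submodule ℤ (Additive Fˣ) := unitsIn (loc N (OF F))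

lemma count_of_mem (N : ℕ) (hN : 0 < N) (x : F) (hx0 : x ≠ 0) (hx : x ∈ loc N (OF F))
    (v : HeightOneSpectrum (𝓞 F)) (hv : (N : 𝓞 F) ∉ v.asIdeal) :
    0 ≤ FractionalIdeal.count F v (FractionalIdeal.spanSingleton (𝓞 F)⁰ x) := by
  obtain ⟨k, hk⟩ := hx
  obtain ⟨y, hy⟩ := (mem_OF F).mp hk
  have h1 := count_nonneg_of_integral F v y
  have h2 := count_eq_zero_of_notMem F v ((N : 𝓞 F) ^ k)
    (fun h => hv (v.isPrime.mem_of_pow_mem k h))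
  have hN0 : (N : F) ≠ 0 := by exact_mod_cast hN.ne'
  rw [hy, ← FractionalIdeal.spanSingleton_mul_spanSingleton, FractionalIdeal.count_mul] at h1
  · rw [map_pow, map_natCast] at h2
    omega
  · exact FractionalIdeal.spanSingleton_ne_zero_iff.mpr (pow_ne_zero _ hN0)
  · exact FractionalIdeal.spanSingleton_ne_zero_iff.mpr hx0

lemma VN_inf_ker (N : ℕ) (hN : 0 < N) :
    VN F N ⊓ LinearMap.ker (valMap F (SN F N) Subtype.val) = LinearMap.range (iota F) := by
  apply le_antisymm
  · rintro x ⟨hx, hk⟩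
    obtain ⟨u, hu⟩ := isUnit_of_count F x.toMul (by
      intro v
      by_cases hv : (N : 𝓞 F) ∈ v.asIdeal
      · exact congrFun (LinearMap.mem_ker.mp hk) ⟨v, hv⟩
      · have h1 := count_of_mem F N hN _ x.toMul.ne_zero hx.1 v hv
        have h2 := count_of_mem F N hN _ (x.toMul⁻¹).ne_zero hx.2 v hv
        rw [Units.val_inv_eq_inv_val, ← FractionalIdeal.spanSingleton_inv,
          FractionalIdeal.count_inv] at h2
        omega)
    exact ⟨Additive.ofMul u, Additive.toMul.injective hu⟩
  · rintro _ ⟨u, rfl⟩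
    refine ⟨⟨le_loc _ _ ((mem_OF F).mpr ⟨u.toMul, rfl⟩),
      le_loc _ _ ((mem_OF F).mpr ⟨(u.toMul⁻¹ : (𝓞 F)ˣ), rfl⟩)⟩, ?_⟩
    rw [SetLike.mem_coe, LinearMap.mem_ker]
    ext s
    rw [valMap_apply]
    have : ((u.toMul : (𝓞 F)ˣ) : 𝓞 F) ∉ s.1.asIdeal := fun h =>
      s.1.isPrime.ne_top (Ideal.eq_top_of_isUnit_mem _ h u.toMul.isUnit)
    exact count_eq_zero_of_notMem F s.1 _ this

lemma fg_range_iota : (LinearMap.range (iota F)).FG := by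
  rw [LinearMap.range_eq_map]
  exact Module.Finite.fg_top.map _

lemma fg_VN (N : ℕ) (hN : 0 < N) : (VN F N).FG := by
  have := finite_SN F N hN
  refine Submodule.fg_of_fg_map_of_fg_inf_ker (valMap F (SN F N) Subtype.val) ?_ ?_
  · exact IsNoetherian.noetherian _
  · rw [VN_inf_ker F N hN]
    exact fg_range_iota F

lemma exists_val (N : ℕ) (hN : 0 < N) [DecidableEq (SN F N)] (s : SN F N) :
    ∃ m : ℕ, m ≠ 0 ∧ m • (Pi.single s 1 : SN F N → ℤ) ∈
      (VN F N).map (valMap F (SN F N) Subtype.val) := by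
  have hmem : s.1.asIdeal ∈ (Ideal (𝓞 F))⁰ := mem_nonZeroDivisors_of_ne_zero s.1.ne_bot
  let h := Fintype.card (ClassGroup (𝓞 F))
  have h1 : ClassGroup.mk0 (⟨s.1.asIdeal, hmem⟩ : (Ideal (𝓞 F))⁰) ^ h = 1 := pow_card_eq_one
  rw [← map_pow] at h1
  replace h1 := (ClassGroup.mk0_eq_one_iff (pow_mem hmem h)).mp h1
  obtain ⟨a, ha⟩ := h1
  have ha' : s.1.asIdeal ^ h = Ideal.span {a} := ha
  have ha0 : a ≠ 0 := by
    rintro rfl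
    have : s.1.asIdeal ^ h ≠ 0 := pow_ne_zero _ s.1.ne_bot
    apply this
    rw [ha']; simp
  have hNa : (N : 𝓞 F) ^ h ∈ Ideal.span {a} := by
    rw [← ha']; exact Ideal.pow_mem_pow s.2 h
  obtain ⟨b, hb⟩ := Ideal.mem_span_singleton'.mp hNa
  have haF : algebraMap (𝓞 F) F a ≠ 0 := by simpa using ha0
  refine ⟨h, Fintype.card_ne_zero, Additive.ofMul (Units.mk0 _ haF), ⟨?_, ?_⟩, ?_⟩
  · exact le_loc _ _ ((mem_OF F).mpr ⟨a, rfl⟩)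
  · refine ⟨h, (mem_OF F).mpr ⟨b, ?_⟩⟩
    have : algebraMap (𝓞 F) F b * algebraMap (𝓞 F) F a = (N : F) ^ h := by
      rw [← map_mul, hb]; simp
    rw [← this]
    simp [haF]
  · ext t
    rw [valMap_apply]
    simp only [toMul_ofMul, Units.val_mk0]
    rw [← FractionalIdeal.coeIdeal_span_singleton, ← ha', FractionalIdeal.coeIdeal_pow,
      FractionalIdeal.count_pow]
    classical
    rw [FractionalIdeal.count_maximal]
    by_cases hst : s = t
    · subst hst; simp
    · have : s.1 ≠ t.1 := fun h => hst (Subtype.ext h)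
      simp [this, Ne.symm hst]

lemma finrank_VN (N : ℕ) (hN : 0 < N) [Fintype (SN F N)] :
    finrank ℤ (VN F N) = Fintype.card (SN F N) + (Fintype.card (InfinitePlace F) - 1) := by
  classical
  rw [← finrank_map_add (VN F N) (fg_VN F N hN) (valMap F (SN F N) Subtype.val),
    VN_inf_ker F N hN, finrank_of_pi _ (exists_val F N hN),
    LinearMap.finrank_range_of_inj (iota_inj F), NumberField.Units.finrank_eq]
  rfl

lemma exists_nrm (N : ℕ) (p : N.primeFactors) :
    ∃ m : ℕ, m ≠ 0 ∧ m • (Pi.single p 1 : N.primeFactors → ℤ) ∈ (VN F N).map (nrmMap F N) := by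
  have hp := Nat.prime_of_mem_primeFactors p.2
  obtain ⟨c, hc⟩ := Nat.dvd_of_mem_primeFactors p.2
  have hpF : ((p : ℕ) : F) ≠ 0 := by exact_mod_cast hp.ne_zero
  refine ⟨finrank ℚ F, finrank_pos.ne', Additive.ofMul (Units.mk0 _ hpF), ⟨?_, ?_⟩, ?_⟩
  · exact natCast_mem _ _
  · refine ⟨1, ?_⟩
    have : (N : F) ^ 1 * (((Units.mk0 _ hpF)⁻¹ : Fˣ) : F) = (c : F) := by
      have hc' : (N : F) = (p : ℕ) * (c : F) := by exact_mod_cast congrArg (Nat.cast : ℕ → F) hc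
      rw [pow_one, hc', mul_comm]
      simp [hpF]
    rw [toMul_ofMul, this]
    exact natCast_mem _ _
  · ext q
    have : Fact (q : ℕ).Prime := ⟨Nat.prime_of_mem_primeFactors q.2⟩
    have : Fact (p : ℕ).Prime := ⟨hp⟩
    rw [nrmMap_apply]
    simp only [toMul_ofMul, Units.val_mk0]
    have h1 : Algebra.norm ℚ ((p : ℕ) : F) = ((p : ℕ) : ℚ) ^ finrank ℚ F := by
      have := Algebra.norm_algebraMap (S := F) ((p : ℕ) : ℚ)
      rwa [map_natCast] at this
    rw [h1, padicValRat.pow]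
    by_cases hpq : p = q
    · subst hpq
      simp
    · have hne : (p : ℕ) ≠ q := fun h => hpq (Subtype.ext h)
      have : padicValNat q p = 0 := padicValNat_primes (Ne.symm hne)
      simp [Ne.symm hpq, this]

lemma finrank_VN_inf_ker (N : ℕ) (hN : 0 < N) [Fintype (SN F N)] :
    finrank ℤ (VN F N ⊓ LinearMap.ker (nrmMap F N) : Submodule ℤ (Additive Fˣ))
      + N.primeFactors.card = Fintype.card (SN F N) + (Fintype.card (InfinitePlace F) - 1) := by
  classical
  rw [← finrank_VN F N hN, ← finrank_map_add (VN F N) (fg_VN F N hN) (nrmMap F N),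
    finrank_of_pi _ (exists_nrm F N), Fintype.card_coe, add_comm]

lemma norm_loc (N : ℕ) (x : F) (hx : x ∈ loc N (OF F)) :
    ∃ (k : ℕ) (z : ℤ), (N : ℚ) ^ k * Algebra.norm ℚ x = z := by
  obtain ⟨k, hk⟩ := hx
  have h1 : IsIntegral ℤ (Algebra.norm ℚ ((N : F) ^ k * x)) := Algebra.isIntegral_norm ℚ hk
  obtain ⟨z, hz⟩ := IsIntegrallyClosed.isIntegral_iff.mp h1
  refine ⟨k * finrank ℚ F, z, ?_⟩
  have h2 := Algebra.norm_algebraMap (S := F) (N : ℚ)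
  rw [map_natCast] at h2
  rw [map_mul, map_pow, h2] at hz
  rw [mul_comm k, pow_mul, ← hz]
  simp

lemma num_natAbs (N : ℕ) (r : ℚ) (hr : r ≠ 0)
    (h : ∀ p ∈ N.primeFactors, padicValRat p r = 0) (hN : 0 < N)
    (l : ℕ) (b : ℤ) (hb : (N : ℚ) ^ l * r⁻¹ = b) : r.num.natAbs = 1 := by
  rw [Nat.eq_one_iff_not_exists_prime_dvd]
  intro q hq hqr
  have : Fact q.Prime := ⟨hq⟩
  have hden : ¬ q ∣ r.den := fun hd => by
    have := Nat.dvd_gcd hqr hd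
    rw [r.reduced] at this
    exact hq.one_lt.ne' (Nat.dvd_one.mp this)
  by_cases hqN : q ∣ N
  · have h1 := h q (Nat.mem_primeFactors.mpr ⟨hq, hqN, hN.ne'⟩)
    rw [padicValRat_def, padicValNat.eq_zero_of_not_dvd hden] at h1
    have h2 : padicValInt q r.num ≠ 0 := by
      unfold padicValInt
      exact (dvd_iff_padicValNat_ne_zero (Int.natAbs_ne_zero.mpr (Rat.num_ne_zero.mpr hr))).mp hqr
    omega
  · have h1 : (N : ℚ) ^ l * r.den = b * r.num := by
      have := Rat.num_div_den r
      have hd : (r.den : ℚ) ≠ 0 := by exact_mod_cast r.den_ne_zero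
      rw [← hb]
      field_simp
      rw [mul_comm, Rat.mul_den_eq_num]
    have h2 : (N : ℤ) ^ l * r.den = b * r.num := by exact_mod_cast h1
    have h3 : (q : ℤ) ∣ (N : ℤ) ^ l * r.den := h2 ▸ (Int.natCast_dvd.mpr hqr).mul_left b
    have h4 : q ∣ N ^ l * r.den := by exact_mod_cast h3
    rcases hq.dvd_mul.mp h4 with h5 | h5
    · exact hqN (hq.dvd_of_dvd_pow h5)
    · exact hden h5

lemma norm_sq (N : ℕ) (hN : 0 < N) (x : Additive Fˣ)
    (hx : x ∈ VN F N ⊓ LinearMap.ker (nrmMap F N)) :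
    Algebra.norm ℚ ((x.toMul : Fˣ) : F) ^ 2 = 1 := by
  obtain ⟨⟨h1, h2⟩, h3⟩ := hx
  set r := Algebra.norm ℚ ((x.toMul : Fˣ) : F) with hr
  have hr0 : r ≠ 0 := by simp [hr]
  obtain ⟨k, a, ha⟩ := norm_loc F N _ h1
  obtain ⟨l, b, hb⟩ := norm_loc F N _ h2
  have hinv : Algebra.norm ℚ ((x.toMul⁻¹ : Fˣ) : F) = r⁻¹ := by
    apply eq_inv_of_mul_eq_one_left
    rw [hr, ← map_mul]
    simp
  rw [hinv] at hb
  have hp : ∀ p ∈ N.primeFactors, padicValRat p r = 0 := fun p hp =>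
    congrFun (LinearMap.mem_ker.mp h3) ⟨p, hp⟩
  have e1 := num_natAbs N r hr0 hp hN l b hb
  have e2 := num_natAbs N r⁻¹ (inv_ne_zero hr0) (by
    intro p hpp
    have : Fact p.Prime := ⟨Nat.prime_of_mem_primeFactors hpp⟩
    rw [padicValRat.inv, hp p hpp, neg_zero]) hN k a (by rw [inv_inv]; exact ha)
  have h4 : |r| = 1 := by
    have h5 : r.den = 1 := by
      rw [Rat.inv_def] at e2
      have hn : r.num.natAbs = 1 := e1
      rcases Int.natAbs_eq r.num with h | h <;> rw [hn] at h <;> rw [h] at e2 <;> simpa using e2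
    rw [← Rat.num_div_den r, h5]
    rcases Int.natAbs_eq r.num with h | h <;> rw [e1] at h <;> rw [h] <;> simp
  rw [← sq_abs, h4, one_pow]

/-- The multiplier ring of the lattice spanned by `w`. -/
def mulRing {n : ℕ} (w : Fin n → F) : Subring F where
  carrier := {μ | ∀ v ∈ Submodule.span ℤ (Set.range w), μ * v ∈ Submodule.span ℤ (Set.range w)}
  mul_mem' := by
    intro a b ha hb v hv
    rw [mul_assoc]
    exact ha _ (hb _ hv)
  one_mem' := by
    intro v hv
    rwa [one_mul]
  add_mem' := by
    intro a b ha hb v hv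
    rw [add_mul]
    exact add_mem (ha _ hv) (hb _ hv)
  zero_mem' := by
    intro v hv
    rw [zero_mul]
    exact zero_mem _
  neg_mem' := by
    intro a ha v hv
    rw [neg_mul]
    exact neg_mem (ha _ hv)

variable {n : ℕ} (w : Fin n → F)

lemma mem_mulRing_of (x : F) (h : ∀ i, x * w i ∈ Submodule.span ℤ (Set.range w)) :
    x ∈ mulRing F w := by
  intro v hv
  induction hv using Submodule.span_induction with
  | mem v hv => obtain ⟨i, rfl⟩ := hv; exact h i
  | zero => simp
  | add a b _ _ ha hb => rw [mul_add]; exact add_mem ha hb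
  | smul c a _ ha => rw [mul_smul_comm]; exact Submodule.smul_mem _ _ ha

lemma mulRing_le (hn : 0 < n) (hw : ∀ i, w i ≠ 0) : mulRing F w ≤ OF F := by
  intro x hx
  refine isIntegral_of_smul_mem_submodule (M := F) (Submodule.span ℤ (Set.range w)) ?_ ?_ x ?_
  · intro h
    have h1 : w ⟨0, hn⟩ ∈ Submodule.span ℤ (Set.range w) := Submodule.subset_span ⟨_, rfl⟩
    rw [h, Submodule.mem_bot] at h1
    exact hw _ h1
  · exact Submodule.fg_span (Set.finite_range w)
  · exact fun v hv => hx v hv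

lemma exists_den (hspan : Submodule.span ℚ (Set.range w) = ⊤) (u : F) :
    ∃ d : ℕ, d ≠ 0 ∧ (d : F) * u ∈ Submodule.span ℤ (Set.range w) := by
  have hu : u ∈ Submodule.span ℚ (Set.range w) := by rw [hspan]; trivial
  obtain ⟨c, rfl⟩ := (Submodule.mem_span_range_iff_exists_fun ℚ).mp hu
  refine ⟨∏ i, (c i).den, Finset.prod_ne_zero_iff.mpr fun i _ => (c i).den_ne_zero, ?_⟩
  rw [Finset.mul_sum]
  refine Submodule.sum_mem _ fun i _ => ?_
  obtain ⟨e, he⟩ := Finset.dvd_prod_of_mem (fun i => (c i).den) (Finset.mem_univ i)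
  have h1 : w i ∈ Submodule.span ℤ (Set.range w) := Submodule.subset_span ⟨_, rfl⟩
  have h2 := Submodule.smul_mem _ ((e : ℤ) * (c i).num) h1
  convert h2 using 1
  rw [he, Algebra.smul_def, zsmul_eq_mul]
  have h3 : ((c i).den : F) * algebraMap ℚ F (c i) = ((c i).num : F) := by
    have := congrArg (algebraMap ℚ F) (Rat.den_mul_eq_num (c i))
    rwa [map_mul, map_natCast, map_intCast] at this
  push_cast
  rw [← h3]
  ring

lemma exists_den_family (hspan : Submodule.span ℚ (Set.range w) = ⊤) {ι : Type*} [Fintype ι]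
    (u : ι → F) :
    ∃ d : ℕ, d ≠ 0 ∧ ∀ i, (d : F) * u i ∈ Submodule.span ℤ (Set.range w) := by
  choose d hd h using fun i => exists_den F w hspan (u i)
  refine ⟨∏ i, d i, Finset.prod_ne_zero_iff.mpr fun i _ => hd i, fun i => ?_⟩
  obtain ⟨e, he⟩ := Finset.dvd_prod_of_mem d (Finset.mem_univ i)
  rw [he]
  have := Submodule.smul_mem _ (e : ℤ) (h i)
  convert this using 1
  rw [zsmul_eq_mul]
  push_cast
  ring

lemma exists_conductor (hspan : Submodule.span ℚ (Set.range w) = ⊤) :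
    ∃ d : ℕ, d ≠ 0 ∧ ∀ y : 𝓞 F, (d : F) * algebraMap (𝓞 F) F y ∈ mulRing F w := by
  let b := RingOfIntegers.basis F
  obtain ⟨d, hd, h⟩ := exists_den_family F w hspan
    (fun q : (Free.ChooseBasisIndex ℤ (𝓞 F)) × Fin n => algebraMap (𝓞 F) F (b q.1) * w q.2)
  refine ⟨d, hd, fun y => ?_⟩
  rw [← b.sum_repr y, map_sum, Finset.mul_sum]
  refine sum_mem fun k _ => ?_
  have h1 : (d : F) * algebraMap (𝓞 F) F (b k) ∈ mulRing F w := by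
    refine mem_mulRing_of F w _ fun i => ?_
    rw [mul_assoc]
    exact h (k, i)
  have h2 := (mulRing F w).zsmul_mem h1 (b.repr y k)
  convert h2 using 1
  simp only [zsmul_eq_mul, map_mul, map_intCast]
  ring

lemma exists_pow_mem (N : ℕ) (hspan : Submodule.span ℚ (Set.range w) = ⊤)
    (x : F) (hx0 : x ≠ 0) (hx : x ∈ loc N (OF F)) (hx' : x⁻¹ ∈ loc N (OF F)) :
    ∃ m : ℕ, m ≠ 0 ∧ x ^ m ∈ loc N (mulRing F w) := by
  obtain ⟨d, hd, hdT⟩ := exists_conductor F w hspan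
  obtain ⟨k, hk⟩ := hx
  obtain ⟨l, hl⟩ := hx'
  obtain ⟨z, hz⟩ := (mem_OF F).mp hk
  obtain ⟨z', hz'⟩ := (mem_OF F).mp hl
  have hfin : Finite (𝓞 F ⧸ Ideal.span {(d : 𝓞 F)}) := by
    apply Ideal.finiteQuotientOfFreeOfNeBot
    simpa using hd
  obtain ⟨i, j, hne, hij⟩ := Finite.exists_ne_map_eq_of_infinite
    (fun i : ℕ => (Ideal.Quotient.mk (Ideal.span {(d : 𝓞 F)}) z) ^ i)
  wlog hlt : i < j generalizing i j
  · exact this j i hne.symm hij.symm (by omega)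
  obtain ⟨m, rfl⟩ := Nat.exists_eq_add_of_lt hlt
  refine ⟨m + 1, by omega, ?_⟩
  simp only [← map_pow] at hij
  have h1 := Ideal.Quotient.eq.mp hij.symm
  obtain ⟨t, ht⟩ := Ideal.mem_span_singleton'.mp h1
  have h2 := le_loc N _ (hdT (t * z' ^ i))
  have h3 : (d : F) * algebraMap (𝓞 F) F (t * z' ^ i) =
      (N : F) ^ ((k + l) * i) * ((N : F) ^ (k * (m + 1)) * x ^ (m + 1) - 1) := by
    have e1 : algebraMap (𝓞 F) F t * (d : F) =
        ((N : F) ^ k * x) ^ (i + m + 1) - ((N : F) ^ k * x) ^ i := by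
      rw [← hz, ← map_pow, ← map_pow, ← map_sub, ← ht]
      simp
    rw [map_mul, map_pow, hz']
    calc _ = (algebraMap (𝓞 F) F t * (d : F)) * ((N : F) ^ l * x⁻¹) ^ i := by ring
      _ = _ := by
        rw [e1]
        have : x ^ i * (x⁻¹) ^ i = 1 := by rw [← mul_pow, mul_inv_cancel₀ hx0, one_pow]
        have e2 : (((N : F) ^ k * x) ^ (i + m + 1) - ((N : F) ^ k * x) ^ i) *
          ((N : F) ^ l * x⁻¹) ^ i = (N : F) ^ ((k + l) * i) *
          ((N : F) ^ (k * (m + 1)) * x ^ (m + 1) - 1) * (x ^ i * (x⁻¹) ^ i) := by ring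
        rw [e2, this, mul_one]
  rw [h3] at h2
  have h4 := add_mem (loc_of_pow_mul _ h2) (one_mem _)
  rw [sub_add_cancel] at h4
  exact loc_of_pow_mul _ h4

lemma loc_mono (N : ℕ) {A B : Subring F} (h : A ≤ B) : loc N A ≤ loc N B := by
  rintro x ⟨k, hk⟩
  exact ⟨k, h hk⟩

/-- The norm-one unit group. -/
noncomputable abbrev UN (N : ℕ) : Submodule ℤ (Additive Fˣ) :=
  unitsIn (loc N (mulRing F w)) ⊓ normOne F

lemma UN_le (N : ℕ) (hn : 0 < n) (hw : ∀ i, w i ≠ 0) :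
    UN F w N ≤ VN F N ⊓ LinearMap.ker (nrmMap F N) := by
  rintro x ⟨⟨h1, h2⟩, h3⟩
  refine ⟨⟨loc_mono F N (mulRing_le F w hn hw) h1, loc_mono F N (mulRing_le F w hn hw) h2⟩, ?_⟩
  rw [SetLike.mem_coe, LinearMap.mem_ker]
  ext p
  rw [nrmMap_apply, mem_normOne.mp h3]
  simp

lemma fg_inf (N : ℕ) (hN : 0 < N) :
    (VN F N ⊓ LinearMap.ker (nrmMap F N) : Submodule ℤ (Additive Fˣ)).FG := by
  have : Module.Finite ℤ (VN F N) := Module.Finite.iff_fg.mpr (fg_VN F N hN)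
  have : IsNoetherian ℤ (VN F N) := inferInstance
  exact isNoetherian_submodule.mp this _ inf_le_left

lemma fg_UN (N : ℕ) (hN : 0 < N) (hn : 0 < n) (hw : ∀ i, w i ≠ 0) : (UN F w N).FG := by
  have : Module.Finite ℤ (VN F N) := Module.Finite.iff_fg.mpr (fg_VN F N hN)
  have : IsNoetherian ℤ (VN F N) := inferInstance
  exact isNoetherian_submodule.mp this _ ((UN_le F w N hn hw).trans inf_le_left)

lemma finrank_UN (N : ℕ) (hN : 0 < N) (hn : 0 < n) (hw : ∀ i, w i ≠ 0)
    (hspan : Submodule.span ℚ (Set.range w) = ⊤) :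
    finrank ℤ (UN F w N) =
      finrank ℤ (VN F N ⊓ LinearMap.ker (nrmMap F N) : Submodule ℤ (Additive Fˣ)) := by
  refine finrank_eq_of_torsion _ _ (fg_inf F N hN) (UN_le F w N hn hw) fun x hx => ?_
  have hsq := norm_sq F N hN x hx
  obtain ⟨⟨h1, h2⟩, -⟩ := hx
  rw [Units.val_inv_eq_inv_val] at h2
  obtain ⟨m, hm, hxm⟩ := exists_pow_mem F w N hspan _ x.toMul.ne_zero h1 h2
  obtain ⟨m', hm', hxm'⟩ := exists_pow_mem F w N hspan _ (inv_ne_zero x.toMul.ne_zero) h2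
    (by rwa [inv_inv])
  refine ⟨2 * (m * m'), by positivity, ⟨?_, ?_⟩, mem_normOne.mpr ?_⟩
  · have := pow_mem hxm (m' * 2)
    rw [← pow_mul] at this
    rw [toMul_nsmul, Units.val_pow_eq_pow_val]
    convert this using 2
    ring
  · have := pow_mem hxm' (m * 2)
    rw [← pow_mul] at this
    rw [toMul_nsmul, Units.val_inv_eq_inv_val, Units.val_pow_eq_pow_val, ← inv_pow]
    convert this using 2
    ring
  · rw [toMul_nsmul, Units.val_pow_eq_pow_val, map_pow, pow_mul, hsq, one_pow]

lemma mem_zInv {N : ℕ} (hN : 0 < N) {q : ℚ} :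
    q ∈ zInv N ↔ ∃ (k : ℕ) (z : ℤ), (N : ℚ) ^ k * q = z := by
  have hN0 : (N : ℚ) ≠ 0 := by exact_mod_cast hN.ne'
  constructor
  · intro h
    unfold zInv at h
    induction h using Subring.closure_induction with
    | mem x hx =>
      rw [Set.mem_singleton_iff] at hx
      exact ⟨1, 1, by simp [hx, hN0]⟩
    | zero => exact ⟨0, 0, by simp⟩
    | one => exact ⟨0, 1, by simp⟩
    | add x y _ _ hx hy =>
      obtain ⟨k, a, ha⟩ := hx
      obtain ⟨l, b, hb⟩ := hy
      refine ⟨k + l, N ^ l * a + N ^ k * b, ?_⟩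
      push_cast
      rw [← ha, ← hb]
      ring
    | neg x _ hx =>
      obtain ⟨k, a, ha⟩ := hx
      exact ⟨k, -a, by push_cast; rw [← ha]; ring⟩
    | mul x y _ _ hx hy =>
      obtain ⟨k, a, ha⟩ := hx
      obtain ⟨l, b, hb⟩ := hy
      refine ⟨k + l, a * b, ?_⟩
      push_cast
      rw [← ha, ← hb]
      ring
  · rintro ⟨k, z, h⟩
    have h1 : (N : ℚ)⁻¹ ∈ zInv N := Subring.subset_closure rfl
    have h2 := mul_mem (intCast_mem (zInv N) z) (pow_mem h1 k)
    convert h2 using 1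
    rw [← h, inv_pow]
    field_simp

lemma image_eq (N : ℕ) (hN : 0 < N) (hn : 0 < n) (hw : ∀ i, w i ≠ 0)
    (Aw : Set (Matrix (Fin n) (Fin n) ℚ))
    (hAw : Aw = {A | (∀ i j, A i j ∈ zInv N) ∧
      ∃ lam : F, ∀ i, (∑ j, algebraMap ℚ F (A i j) * w j) = lam * w i})
    (φ : Matrix (Fin n) (Fin n) ℚ → F)
    (hφ : ∀ A ∈ Aw, ∀ i, (∑ j, algebraMap ℚ F (A i j) * w j) = φ A * w i) (x : F) :
    x ∈ φ '' Aw ↔ x ∈ loc N (mulRing F w) := by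
  have hN0 : (N : ℚ) ≠ 0 := by exact_mod_cast hN.ne'
  have hNF : (N : F) ≠ 0 := by exact_mod_cast hN.ne'
  constructor
  · rintro ⟨A, hA, rfl⟩
    have h1 := hφ A hA
    rw [hAw] at hA
    choose k z hk using fun q : Fin n × Fin n => (mem_zInv hN).mp (hA.1 q.1 q.2)
    refine ⟨∑ q, k q, mem_mulRing_of F w _ fun i => ?_⟩
    rw [mul_assoc, ← h1 i, Finset.mul_sum]
    refine Submodule.sum_mem _ fun j _ => ?_
    obtain ⟨e, he⟩ := Nat.exists_eq_add_of_le
      (Finset.single_le_sum (f := k) (fun _ _ => Nat.zero_le _) (Finset.mem_univ (i, j)))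
    have h2 : w j ∈ Submodule.span ℤ (Set.range w) := Submodule.subset_span ⟨_, rfl⟩
    have h3 := Submodule.smul_mem _ ((N : ℤ) ^ e * z (i, j)) h2
    convert h3 using 1
    have h4 : (N : F) ^ k (i, j) * algebraMap ℚ F (A i j) = z (i, j) := by
      have := congrArg (algebraMap ℚ F) (hk (i, j))
      rwa [map_mul, map_pow, map_natCast, map_intCast] at this
    rw [he, zsmul_eq_mul]
    push_cast
    rw [← h4]
    ring
  · rintro ⟨k, hk⟩
    have h1 : ∀ i, ∃ c : Fin n → ℤ, ∑ j, c j • w j = (N : F) ^ k * x * w i := fun i =>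
      (Submodule.mem_span_range_iff_exists_fun ℤ).mp (hk (w i) (Submodule.subset_span ⟨_, rfl⟩))
    choose c hc using h1
    let A : Matrix (Fin n) (Fin n) ℚ := fun i j => (c i j : ℚ) / (N : ℚ) ^ k
    have hx : ∀ i, (∑ j, algebraMap ℚ F (A i j) * w j) = x * w i := by
      intro i
      have hNk : (N : F) ^ k ≠ 0 := pow_ne_zero _ hNF
      apply mul_left_cancel₀ hNk
      rw [← mul_assoc, ← hc i, Finset.mul_sum]
      refine Finset.sum_congr rfl fun j _ => ?_
      simp only [A, map_div₀, map_pow, map_natCast, map_intCast, zsmul_eq_mul]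
      field_simp
    have hA : A ∈ Aw := by
      rw [hAw]
      refine ⟨fun i j => (mem_zInv hN).mpr ⟨k, c i j, ?_⟩, x, hx⟩
      simp only [A]
      field_simp
    refine ⟨A, hA, ?_⟩
    have := hφ A hA ⟨0, hn⟩
    rw [hx] at this
    exact (mul_right_cancel₀ (hw _) this).symm

lemma exists_prime_mem (P : Ideal (𝓞 F)) (hP : P.IsPrime) (N : ℕ) (hN : 0 < N)
    (h : (N : 𝓞 F) ∈ P) : ∃ p ∈ N.primeFactors, (p : 𝓞 F) ∈ P := by
  induction N using induction_on_primes with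
  | zero => omega
  | one =>
    rw [Nat.cast_one] at h
    exact absurd ((Ideal.eq_top_iff_one _).mpr h) hP.ne_top
  | prime_mul p a hp ih =>
    rw [Nat.cast_mul] at h
    have ha : 0 < a := Nat.pos_of_mul_pos_left hN
    rcases hP.mem_or_mem h with h | h
    · exact ⟨p, Nat.mem_primeFactors.mpr ⟨hp, dvd_mul_right _ _, hN.ne'⟩, h⟩
    · obtain ⟨q, hq, hqP⟩ := ih ha h
      exact ⟨q, Nat.primeFactors_mono (dvd_mul_left _ _) hN.ne' hq, hqP⟩

/-- primes above `p` -/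
abbrev above (p : ℕ) : Set (Ideal (𝓞 F)) := {P | P.IsPrime ∧ (p : 𝓞 F) ∈ P}

/-- The comparison map. -/
def toSN (N : ℕ) (x : Σ p : N.primeFactors, above F p) : SN F N :=
  ⟨⟨x.2.1, x.2.2.1, by
    rintro h
    have h1 := x.2.2.2
    rw [h, Ideal.mem_bot] at h1
    exact (Nat.prime_of_mem_primeFactors x.1.2).ne_zero (by exact_mod_cast h1)⟩, by
    obtain ⟨c, hc⟩ := Nat.dvd_of_mem_primeFactors x.1.2
    have : (N : 𝓞 F) = (x.1 : ℕ) * (c : 𝓞 F) := by exact_mod_cast congrArg (Nat.cast : ℕ → 𝓞 F) hc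
    rw [this]
    exact Ideal.mul_mem_right _ _ x.2.2.2⟩

lemma toSN_bij (N : ℕ) (hN : 0 < N) : Function.Bijective (toSN F N) := by
  constructor
  · rintro ⟨p, P, hP, hp⟩ ⟨q, Q, hQ, hq⟩ h
    have hPQ : P = Q := congrArg (fun s : SN F N => s.1.asIdeal) h
    subst hPQ
    have hpq : p = q := by
      by_contra hne
      have hne' : (p : ℕ) ≠ q := fun h => hne (Subtype.ext h)
      have hcop := (Nat.coprime_primes (Nat.prime_of_mem_primeFactors p.2)
        (Nat.prime_of_mem_primeFactors q.2)).mpr hne'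
      have h1 : IsCoprime ((p : ℕ) : 𝓞 F) ((q : ℕ) : 𝓞 F) := hcop.cast
      obtain ⟨a, b, hab⟩ := h1
      apply hP.ne_top
      rw [Ideal.eq_top_iff_one, ← hab]
      exact add_mem (Ideal.mul_mem_left _ _ hp) (Ideal.mul_mem_left _ _ hq)
    subst hpq
    rfl
  · rintro ⟨v, hv⟩
    obtain ⟨p, hp, hpv⟩ := exists_prime_mem F v.asIdeal v.isPrime N hN hv
    exact ⟨⟨⟨p, hp⟩, v.asIdeal, v.isPrime, hpv⟩, rfl⟩

lemma above_finite (N : ℕ) (hN : 0 < N) (p : N.primeFactors) : Finite (above F p) := by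
  have := finite_SN F N hN
  refine Finite.of_injective (fun P => toSN F N ⟨p, P⟩) fun P Q h => ?_
  have := (toSN_bij F N hN).1 h
  simpa using this

lemma above_pos (p : ℕ) (hp : p.Prime) (hfin : (above F p).Finite) : 1 ≤ (above F p).ncard := by
  rw [Nat.one_le_iff_ne_zero, ← Nat.pos_iff_ne_zero, Set.ncard_pos hfin]
  have h1 : ¬ IsUnit (p : 𝓞 F) := by
    intro h
    have h2 := h.map (Algebra.norm ℤ)
    have h3 := Algebra.norm_algebraMap_of_basis (RingOfIntegers.basis F) (p : ℤ)
    rw [map_natCast] at h3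
    rw [h3, isUnit_pow_iff] at h2
    · exact hp.one_lt.ne' (by simpa using Int.isUnit_iff_natAbs_eq.mp h2)
    · have : Nonempty (Free.ChooseBasisIndex ℤ (𝓞 F)) := inferInstance
      exact Fintype.card_ne_zero
  obtain ⟨P, hP, hpP⟩ := exists_max_ideal_of_mem_nonunits h1
  exact ⟨P, hP.isPrime, hpP⟩

lemma card_SN (N : ℕ) (hN : 0 < N) [Fintype (SN F N)] :
    Fintype.card (SN F N) = ∑ p ∈ N.primeFactors, ((above F p).ncard - 1)
      + N.primeFactors.card := by
  have := above_finite F N hN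
  have h1 : Nat.card (SN F N) = ∑ p : N.primeFactors, (above F p).ncard := by
    rw [← Nat.card_congr (Equiv.ofBijective _ (toSN_bij F N hN)), Nat.card_sigma]
    rfl
  rw [← Nat.card_eq_fintype_card, h1, Finset.sum_coe_sort N.primeFactors (fun p => (above F p).ncard),
    Finset.card_eq_sum_ones, ← Finset.sum_add_distrib]
  refine Finset.sum_congr rfl fun p hp => ?_
  have := above_pos F p (Nat.prime_of_mem_primeFactors hp)
    (Set.finite_coe_iff.mp (above_finite F N hN ⟨p, hp⟩))
  omega

end NF
end Stmt4

/-- **Proposition (order and unit group associated to `w`), part (iv).**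
The norm-one unit group `𝒪_{w,N}^1` is finitely generated of rank
`M = (g_∞ - 1) + ∑_{p ∣ N} (g_p - 1)`: it contains a free abelian subgroup of finite index
isomorphic to `ℤ^M`, where `g_∞` is the number of archimedean places of `F` and `g_p` the
number of prime ideals of the ring of integers of `F` above `p`. -/
theorem stmt_4 (N : ℕ) (hN : 0 < N)
    (F : Type*) [Field F] [NumberField F]
    (n : ℕ) (w : Fin n → F)
    (hw : LinearIndependent ℚ w) (hspan : Submodule.span ℚ (Set.range w) = ⊤)
    (Aw : Set (Matrix (Fin n) (Fin n) ℚ))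
    (hAw : Aw = {A | (∀ i j, A i j ∈ zInv N) ∧
      ∃ lam : F, ∀ i, (∑ j, algebraMap ℚ F (A i j) * w j) = lam * w i})
    (φ : Matrix (Fin n) (Fin n) ℚ → F)
    (hφ : ∀ A ∈ Aw, ∀ i, (∑ j, algebraMap ℚ F (A i j) * w j) = φ A * w i)
    (U : Set F)
    (hU : U = {x ∈ φ '' Aw | (∃ y ∈ φ '' Aw, x * y = 1) ∧ Algebra.norm ℚ x = 1})
    (M : ℕ)
    (hM : M = (Fintype.card (NumberField.InfinitePlace F) - 1) +
      ∑ p ∈ N.primeFactors,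
        ({P : Ideal (NumberField.RingOfIntegers F) |
          P.IsPrime ∧ (p : NumberField.RingOfIntegers F) ∈ P}.ncard - 1)) :
    ∃ f : (Fin M → ℤ) → F,
      (∀ v, f v ∈ U) ∧
      (∀ v v', f (v + v') = f v * f v') ∧
      Function.Injective f ∧
      ∃ (m : ℕ) (reps : Fin m → F), (∀ i, reps i ∈ U) ∧
        ∀ x ∈ U, ∃ (i : Fin m) (v : Fin M → ℤ), x = reps i * f v := by
  have hn : 0 < n := by
    rcases Nat.eq_zero_or_pos n with h | h
    · subst h
      have h1 : (1 : F) ∈ Submodule.span ℚ (Set.range w) := by rw [hspan]; trivial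
      rw [Set.range_eq_empty, Submodule.span_empty, Submodule.mem_bot] at h1
      exact absurd h1 one_ne_zero
    · exact h
  have hw0 : ∀ i, w i ≠ 0 := fun i => hw.ne_zero i
  have himg := Stmt4.image_eq F w N hN hn hw0 Aw hAw φ hφ
  have := Stmt4.finite_SN F N hN
  have := Fintype.ofFinite (Stmt4.SN F N)
  have hrank : Module.finrank ℤ (Stmt4.UN F w N) = M := by
    have h1 := Stmt4.finrank_UN F w N hN hn hw0 hspan
    have h2 := Stmt4.finrank_VN_inf_ker F N hN
    have h3 := Stmt4.card_SN F N hN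
    have h4 : M = (Fintype.card (NumberField.InfinitePlace F) - 1) +
      ∑ p ∈ N.primeFactors, ((Stmt4.above F p).ncard - 1) := hM
    omega
  have hfg : Module.Finite ℤ (Stmt4.UN F w N) :=
    Module.Finite.iff_fg.mpr (Stmt4.fg_UN F w N hN hn hw0)
  have hmem : ∀ x : Stmt4.UN F w N, ((x.1.toMul : Fˣ) : F) ∈ U := by
    rintro ⟨x, ⟨h1, h2⟩, h3⟩
    rw [hU]
    exact ⟨(himg _).mpr h1, ⟨_, (himg _).mpr h2, by simp⟩, Stmt4.mem_normOne.mp h3⟩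
  clear hM
  subst hrank
  obtain ⟨f, hf, m, reps, hreps⟩ := Stmt4.exists_free (A := Stmt4.UN F w N)
  have hinj : ∀ x y : Stmt4.UN F w N, ((x.1.toMul : Fˣ) : F) = ((y.1.toMul : Fˣ) : F) → x = y :=
    fun x y h => Subtype.ext (Additive.toMul.injective (Units.ext h))
  refine ⟨fun v => (((f v).1.toMul : Fˣ) : F), fun v => hmem _, ?_, ?_, m,
    fun i => (((reps i).1.toMul : Fˣ) : F), fun i => hmem _, ?_⟩
  · intro v v'
    exact congrArg (fun z : Stmt4.UN F w N => ((z.1.toMul : Fˣ) : F)) (map_add f v v')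
  · intro v v' h
    exact hf (hinj _ _ h)
  · intro x hx
    rw [hU] at hx
    obtain ⟨h1, ⟨y, hy, hxy⟩, h3⟩ := hx
    let u : Fˣ := ⟨x, y, hxy, by rw [mul_comm, hxy]⟩
    have hu : Additive.ofMul u ∈ Stmt4.UN F w N :=
      ⟨⟨(himg _).mp h1, (himg _).mp hy⟩, Stmt4.mem_normOne.mpr h3⟩
    obtain ⟨i, v, hv⟩ := hreps ⟨_, hu⟩
    refine ⟨i, v, ?_⟩
    exact congrArg (fun z : Stmt4.UN F w N => ((z.1.toMul : Fˣ) : F)) hv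
end

section
/- Let n = n_1 + ... + n_r with each n_i ≥ 1, let W ∈ GL_n(ℝ), let A ∈ M_n(ℝ), and set B = W⁻¹·A·W, written in block form B = (B_{ij})_{1≤i,j≤r} with B_{ij} an n_i × n_j matrix. Let ρ ∈ (ℝ_{>0})^r and fix an index l ∈ {1, ..., r}. Suppose that for every ε > 0 there exists t ∈ (ℝ_{>0})^r with t_k < ε·t_l for all k ≠ l such that I(ρ·t)⁻¹ · B · I(t) belongs to the orthogonal group O(n), where ρ·t = (ρ_1 t_1, ..., ρ_r t_r). Then ρ_l⁻¹·B_{ll} ∈ O(n_l) and B_{jl} = 0 for all j ≠ l; in particular the l-th block of columns of W spans an A-invariant subspace. -/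
open Matrix

/-- **Key linear-algebra step: a period of a Heegner object gives a unit.**
If `B = W⁻¹AW` (in blocks `B_{ij}`), `ρ` is a positive tuple, and for every `ε > 0` there is a
positive tuple `t` with `t_k < ε·t_l` for `k ≠ l` such that `I(ρt)⁻¹ · B · I(t)` is orthogonal,
then `ρ_l⁻¹·B_{ll}` is orthogonal and `B_{jl} = 0` for `j ≠ l`. -/
theorem stmt_5 {r : ℕ} (n : Fin r → ℕ) (hn : ∀ i, 1 ≤ n i)
    (W : Matrix ((i : Fin r) × Fin (n i)) ((i : Fin r) × Fin (n i)) ℝ) (hW : IsUnit W)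
    (A : Matrix ((i : Fin r) × Fin (n i)) ((i : Fin r) × Fin (n i)) ℝ)
    (B : Matrix ((i : Fin r) × Fin (n i)) ((i : Fin r) × Fin (n i)) ℝ)
    (hB : B = W⁻¹ * A * W)
    (ρ : Fin r → ℝ) (hρ : ∀ i, 0 < ρ i) (l : Fin r)
    (hyp : ∀ ε : ℝ, 0 < ε → ∃ t : Fin r → ℝ, (∀ i, 0 < t i) ∧
      (∀ k, k ≠ l → t k < ε * t l) ∧
      (Matrix.diagonal (fun k => (ρ k.1 * t k.1)⁻¹) * B * Matrix.diagonal (fun k => t k.1)) *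
        (Matrix.diagonal (fun k => (ρ k.1 * t k.1)⁻¹) * B *
          Matrix.diagonal (fun k => t k.1))ᵀ = 1) :
    ((Matrix.of fun a b : Fin (n l) => (ρ l)⁻¹ * B ⟨l, a⟩ ⟨l, b⟩) *
      (Matrix.of fun a b : Fin (n l) => (ρ l)⁻¹ * B ⟨l, a⟩ ⟨l, b⟩)ᵀ = 1) ∧
    (∀ j, j ≠ l → ∀ (a : Fin (n j)) (b : Fin (n l)), B ⟨j, a⟩ ⟨l, b⟩ = 0) := by
  have entry : ∀ (t : Fin r → ℝ) (x y : (i : Fin r) × Fin (n i)),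
      (Matrix.diagonal (fun k : (i : Fin r) × Fin (n i) => (ρ k.1 * t k.1)⁻¹) * B *
        Matrix.diagonal (fun k : (i : Fin r) × Fin (n i) => t k.1)) x y = (ρ x.1 * t x.1)⁻¹ * B x y * t y.1 := by
    intro t x y
    rw [Matrix.mul_diagonal, Matrix.diagonal_mul]
  have hz : ∀ j, j ≠ l → ∀ (a : Fin (n j)) (b : Fin (n l)), B ⟨j, a⟩ ⟨l, b⟩ = 0 := by
    intro j hj a b
    by_contra hne
    have hpos : 0 < |B ⟨j, a⟩ ⟨l, b⟩| := abs_pos.mpr hne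
    obtain ⟨t, ht, hlt, hM⟩ := hyp (|B ⟨j, a⟩ ⟨l, b⟩| / ρ j) (div_pos hpos (hρ j))
    have h1 := congrFun (congrFun hM ⟨j, a⟩) ⟨j, a⟩
    rw [Matrix.mul_apply, Matrix.one_apply_eq] at h1
    simp only [Matrix.transpose_apply, entry] at h1
    have h2 := Finset.single_le_sum (s := Finset.univ)
      (f := fun y : (i : Fin r) × Fin (n i) =>
        (ρ j * t j)⁻¹ * B ⟨j, a⟩ y * t y.1 * ((ρ j * t j)⁻¹ * B ⟨j, a⟩ y * t y.1))
      (fun y _ => mul_self_nonneg _) (Finset.mem_univ (⟨l, b⟩ : (i : Fin r) × Fin (n i)))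
    rw [h1] at h2
    have h3 : |(ρ j * t j)⁻¹ * B ⟨j, a⟩ ⟨l, b⟩ * t l| ≤ 1 := by
      refine abs_le_of_sq_le_sq ?_ zero_le_one
      rw [one_pow, sq]
      exact h2
    have hp : 0 < ρ j * t j := mul_pos (hρ j) (ht j)
    rw [abs_mul, abs_mul, abs_of_pos (inv_pos.mpr hp), abs_of_pos (ht l), mul_assoc,
      inv_mul_le_iff₀ hp, mul_one] at h3
    have h4 := hlt j hj
    rw [div_mul_eq_mul_div, lt_div_iff₀ (hρ j)] at h4
    linarith
  refine ⟨?_, hz⟩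
  rw [mul_eq_one_comm]
  obtain ⟨t, ht, -, hM⟩ := hyp 1 one_pos
  rw [mul_eq_one_comm] at hM
  ext b b'
  have h1 := congrFun (congrFun hM ⟨l, b⟩) ⟨l, b'⟩
  rw [Matrix.mul_apply, Fintype.sum_sigma, Finset.sum_eq_single l] at h1
  · simp only [Matrix.transpose_apply, entry] at h1
    rw [Matrix.mul_apply]
    simp only [Matrix.transpose_apply, Matrix.of_apply]
    have h5 : (1 : Matrix (Fin (n l)) (Fin (n l)) ℝ) b b' =
        (1 : Matrix ((i : Fin r) × Fin (n i)) ((i : Fin r) × Fin (n i)) ℝ) ⟨l, b⟩ ⟨l, b'⟩ := by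
      simp [Matrix.one_apply]
    rw [h5, ← h1]
    refine Finset.sum_congr rfl fun a _ => ?_
    have := (ht l).ne'
    have := (hρ l).ne'
    field_simp
  · intro j _ hj
    refine Finset.sum_eq_zero fun a _ => ?_
    simp only [Matrix.transpose_apply, entry]
    rw [hz j hj a b]
    simp
  · simp
end

section
/- Let F be a number field and let 𝒪 ⊆ F be an order, i.e. a subring of F which is finitely generated as a ℤ-module and which spans F as a ℚ-vector space. Let Φ be the (finite) set of infinite places of F, and for v ∈ Φ let n_v = 1 if v is real and n_v = 2 if v is complex. Let T¹ = {t ∈ ∏_{v∈Φ} ℝ_{>0} : ∏_{v∈Φ} t_v^{n_v} = 1}, a topological group under componentwise multiplication with the subspace topology. Let Λ = {(v(ε))_{v∈Φ} : ε ∈ 𝒪ˣ, N_{F/ℚ}(ε) = 1} ⊆ T¹, where v(ε) denotes the (archimedean) absolute value of ε at the place v. Then Λ is a subgroup of T¹ and Λ is cocompact in T¹: there exists a compact subset K ⊆ T¹ with T¹ = K·Λ. -/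
open NumberField NumberField.Units NumberField.Units.dirichletUnitTheorem in
lemma aux_denom (F : Type*) [Field F] [NumberField F] (O : Subring F)
    (h : Submodule.span ℚ (O : Set F) = ⊤) (x : F) : ∃ n : ℕ, 0 < n ∧ (n : F) * x ∈ O := by
  have hx : x ∈ Submodule.span ℚ (O : Set F) := h ▸ Submodule.mem_top
  induction hx using Submodule.span_induction with
  | mem x hx => exact ⟨1, one_pos, by simpa using hx⟩
  | zero => exact ⟨1, one_pos, by simp⟩
  | add x y _ _ hx hy =>
    obtain ⟨n, hn, hx⟩ := hx
    obtain ⟨m, hm, hy⟩ := hy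
    refine ⟨n * m, Nat.mul_pos hn hm, ?_⟩
    have : ((n * m : ℕ) : F) * (x + y) = (m : F) * (n * x) + n * (m * y) := by push_cast; ring
    rw [this]
    exact O.add_mem (O.mul_mem (natCast_mem O m) hx) (O.mul_mem (natCast_mem O n) hy)
  | smul a x _ hx =>
    obtain ⟨n, hn, hx⟩ := hx
    refine ⟨n * a.den, Nat.mul_pos hn a.den_pos, ?_⟩
    have hd : (a.den : F) ≠ 0 := by exact_mod_cast a.den_pos.ne'
    have : ((n * a.den : ℕ) : F) * (a • x) = (a.num : F) * (n * x) := by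
      rw [Algebra.smul_def, eq_ratCast, Rat.cast_def]
      push_cast
      field_simp
    rw [this]
    exact O.mul_mem (intCast_mem O _) hx

open NumberField in
lemma aux_cond (F : Type*) [Field F] [NumberField F] (O : Subring F)
    (h : Submodule.span ℚ (O : Set F) = ⊤) :
    ∃ n : ℕ, 0 < n ∧ ∀ x : 𝓞 F, (n : F) * (x : F) ∈ O := by
  classical
  choose n hn hO using fun i => aux_denom F O h ((RingOfIntegers.basis F i : 𝓞 F) : F)
  refine ⟨∏ i, n i, Finset.prod_pos fun i _ => hn i, fun x => ?_⟩
  have hx : (x : F) = ∑ i, ((RingOfIntegers.basis F).repr x i : F) *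
      ((RingOfIntegers.basis F i : 𝓞 F) : F) := by
    conv_lhs => rw [← (RingOfIntegers.basis F).sum_repr x]
    simp
  rw [hx, Finset.mul_sum]
  refine O.sum_mem fun i _ => ?_
  obtain ⟨c, hc⟩ := Finset.dvd_prod_of_mem n (Finset.mem_univ i)
  rw [hc]
  have : ((n i * c : ℕ) : F) * (((RingOfIntegers.basis F).repr x i : F) *
      ((RingOfIntegers.basis F i : 𝓞 F) : F)) = (c : F) * ((RingOfIntegers.basis F).repr x i : F)
      * (n i * ((RingOfIntegers.basis F i : 𝓞 F) : F)) := by push_cast; ring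
  rw [this]
  exact O.mul_mem (O.mul_mem (natCast_mem O _) (intCast_mem O _)) (hO i)

open NumberField in
lemma aux_pow (F : Type*) [Field F] [NumberField F] (O : Subring F)
    (h : Submodule.span ℚ (O : Set F) = ⊤) :
    ∃ M : ℕ, 0 < M ∧ ∀ u : (𝓞 F)ˣ, (((u ^ M : (𝓞 F)ˣ) : 𝓞 F) : F) ∈ O ∧
      Algebra.norm ℚ (((u ^ M : (𝓞 F)ˣ) : 𝓞 F) : F) = 1 := by
  obtain ⟨N, hN, hO⟩ := aux_cond F O h
  let I : Ideal (𝓞 F) := Ideal.span {(N : 𝓞 F)}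
  have hI : I ≠ ⊥ := by
    simp only [I, ne_eq, Ideal.span_singleton_eq_bot]
    exact_mod_cast hN.ne'
  have : Finite (𝓞 F ⧸ I) := Ideal.finiteQuotientOfFreeOfNeBot I hI
  have hc : 0 < Nat.card (𝓞 F ⧸ I)ˣ := Nat.card_pos
  refine ⟨2 * Nat.card (𝓞 F ⧸ I)ˣ, by positivity, fun u => ⟨?_, ?_⟩⟩
  · set c := Nat.card (𝓞 F ⧸ I)ˣ
    have h1 : (Units.map (Ideal.Quotient.mk I).toMonoidHom (u ^ 2)) ^ c = 1 := pow_card_eq_one'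
    have h2 : Ideal.Quotient.mk I ((u ^ (2 * c) : (𝓞 F)ˣ) : 𝓞 F) = Ideal.Quotient.mk I 1 := by
      have := congrArg Units.val h1
      simpa [pow_mul] using this
    rw [Ideal.Quotient.eq, Ideal.mem_span_singleton] at h2
    obtain ⟨y, hy⟩ := h2
    have h3 : (((u ^ (2 * c) : (𝓞 F)ˣ) : 𝓞 F) : F) = N * (y : F) + 1 := by
      rw [sub_eq_iff_eq_add.mp hy]
      push_cast
      simp
    rw [h3]
    exact O.add_mem (hO y) O.one_mem
  · have h1 := (NumberField.isUnit_iff_norm (K := F) (x := (u : 𝓞 F))).mp u.isUnit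
    have h2 : (Algebra.norm ℚ ((u : 𝓞 F) : F)) ^ 2 = 1 := by
      rw [← sq_abs]
      rw [RingOfIntegers.coe_norm] at h1
      rw [h1, one_pow]
    simp only [Units.val_pow_eq_pow_val, map_pow, pow_mul, h2, one_pow]

open scoped Classical in
open NumberField NumberField.Units NumberField.Units.dirichletUnitTheorem in
lemma aux_lattice (F : Type*) [Field F] [NumberField F] :
    ∃ B : ℝ, ∀ x : logSpace F, ∃ u : (𝓞 F)ˣ, ‖x - logEmbedding F (Additive.ofMul u)‖ ≤ B := by
  let b := (Module.Free.chooseBasis ℤ (unitLattice F)).ofZLatticeBasis ℝ (unitLattice F)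
  refine ⟨∑ i, ‖b i‖, fun x => ?_⟩
  have hmem : ((ZSpan.floor b x : Submodule.span ℤ (Set.range b)) : logSpace F) ∈ unitLattice F := by
    have := (ZSpan.floor b x).2
    exact (Module.Basis.ofZLatticeBasis_span ℝ (unitLattice F) _).le this
  obtain ⟨u, -, hu⟩ := hmem
  refine ⟨u.toMul, ?_⟩
  have h := ZSpan.norm_fract_le (K := ℝ) b x
  rw [ZSpan.fract_apply, ← hu] at h
  exact h

open NumberField NumberField.Units NumberField.Units.dirichletUnitTheorem

/-- **Archimedean generalized geodesic Lagrange theorem (cocompactness).**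
For an order `𝒪` in a number field `F`, the image `Λ` of the norm-one units of `𝒪` under the
"absolute values" map into `T¹ = {t ∈ ∏_{v|∞} ℝ_{>0} | ∏ t_v^{n_v} = 1}` is a subgroup of `T¹`
and is cocompact: there is a compact `K ⊆ T¹` with `T¹ = K·Λ`. -/
theorem stmt_6 (F : Type*) [Field F] [NumberField F]
    (O : Subring F)
    -- 𝒪 is finitely generated as a ℤ-module
    (hfg : ∃ (m : ℕ) (g : Fin m → F), (∀ i, g i ∈ O) ∧
      ∀ x ∈ O, ∃ c : Fin m → ℤ, x = ∑ i, c i • g i)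
    -- 𝒪 spans F over ℚ
    (hOspan : Submodule.span ℚ (O : Set F) = ⊤)
    (T1 : Set (NumberField.InfinitePlace F → ℝ))
    (hT1 : T1 = {t | (∀ v, 0 < t v) ∧ ∏ v, t v ^ v.mult = 1})
    (Λ : Set (NumberField.InfinitePlace F → ℝ))
    (hΛ : Λ = {x | ∃ ε : F, ε ∈ O ∧ (∃ ε' ∈ O, ε * ε' = 1) ∧
      Algebra.norm ℚ ε = 1 ∧ x = fun v => v ε}) :
    -- Λ is a subgroup of T¹
    (Λ ⊆ T1 ∧ (1 : NumberField.InfinitePlace F → ℝ) ∈ Λ ∧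
      (∀ x ∈ Λ, ∀ y ∈ Λ, x * y ∈ Λ) ∧ (∀ x ∈ Λ, x⁻¹ ∈ Λ)) ∧
    -- Λ is cocompact in T¹
    (∃ K : Set (NumberField.InfinitePlace F → ℝ), IsCompact K ∧ K ⊆ T1 ∧
      ∀ t ∈ T1, ∃ k ∈ K, ∃ l ∈ Λ, t = k * l) := by
  classical
  subst hT1 hΛ
  have hsub : ∀ ε : F, Algebra.norm ℚ ε = 1 →
      (∀ v : NumberField.InfinitePlace F, 0 < v ε) ∧
        ∏ v : NumberField.InfinitePlace F, v ε ^ v.mult = 1 := by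
    intro ε hn
    have h0 : ε ≠ 0 := by
      rintro rfl
      simp at hn
    refine ⟨fun v => v.pos_iff.mpr h0, ?_⟩
    rw [NumberField.InfinitePlace.prod_eq_abs_norm, hn]
    simp
  refine ⟨⟨?_, ?_, ?_, ?_⟩, ?_⟩
  · rintro _ ⟨ε, -, -, hn, rfl⟩
    exact hsub ε hn
  · exact ⟨1, O.one_mem, ⟨1, O.one_mem, by simp⟩, by simp, by ext; simp⟩
  · rintro _ ⟨ε, h1, ⟨ε', h2, h3⟩, hn, rfl⟩ _ ⟨δ, k1, ⟨δ', k2, k3⟩, kn, rfl⟩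
    refine ⟨ε * δ, O.mul_mem h1 k1, ⟨ε' * δ', O.mul_mem h2 k2, ?_⟩, by simp [hn, kn],
      by ext; simp⟩
    rw [mul_mul_mul_comm, h3, k3, one_mul]
  · rintro _ ⟨ε, h1, ⟨ε', h2, h3⟩, hn, rfl⟩
    have hε : ε' = ε⁻¹ := eq_inv_of_mul_eq_one_right h3
    refine ⟨ε', h2, ⟨ε, h1, by rw [mul_comm, h3]⟩, ?_, ?_⟩
    · rw [hε, Algebra.norm_inv, hn, inv_one]
    · ext v
      simp [hε]
  obtain ⟨M, hM, hpow⟩ := aux_pow F O hOspan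
  obtain ⟨B, hB⟩ := aux_lattice F
  have hB0 : 0 ≤ B := (norm_nonneg _).trans (hB 0).choose_spec
  set R : ℝ := M * B with hR
  have hR0 : 0 ≤ R := by positivity
  set C : ℝ := (Fintype.card (NumberField.InfinitePlace F) + 1) * R with hC
  have hRC : R ≤ C := by
    rw [hC]
    nlinarith [Nat.cast_nonneg (α := ℝ) (Fintype.card (NumberField.InfinitePlace F))]
  refine ⟨Set.pi Set.univ (fun _ => Set.Icc (Real.exp (-C)) (Real.exp C)) ∩
    {t | ∏ v, t v ^ v.mult = 1}, ?_, ?_, ?_⟩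
  · refine (isCompact_univ_pi fun _ => isCompact_Icc).inter_right ?_
    exact isClosed_eq (by fun_prop) continuous_const
  · rintro t ⟨h1, h2⟩
    exact ⟨fun v => (Real.exp_pos _).trans_le (h1 v trivial).1, h2⟩
  rintro t ⟨ht, htp⟩
  obtain ⟨u, hu⟩ := hB (fun w => (M : ℝ)⁻¹ * (w.1.mult * Real.log (t w.1)))
  obtain ⟨hε, hn⟩ := hpow u
  set ε : F := (((u ^ M : (𝓞 F)ˣ) : 𝓞 F) : F) with hεdef
  obtain ⟨hε', -⟩ := hpow u⁻¹
  obtain ⟨hpos, hprod⟩ := hsub ε hn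
  have hM' : (0 : ℝ) < M := by exact_mod_cast hM
  have hεv : ∀ v : NumberField.InfinitePlace F, v ε = v ((u : 𝓞 F) : F) ^ M := by
    intro v
    simp [hεdef]
  have hkpos : ∀ v : NumberField.InfinitePlace F, 0 < t v / v ε := fun v => div_pos (ht v) (hpos v)
  have hkp : ∏ v : NumberField.InfinitePlace F, (t v / v ε) ^ v.mult = 1 := by
    simp only [div_pow, Finset.prod_div_distrib, htp, hprod, div_one]
  have hb1 : ∀ v : NumberField.InfinitePlace F, v ≠ w₀ →
      |v.mult * Real.log (t v / v ε)| ≤ R := by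
    intro v hv
    have h := (norm_le_pi_norm _ (⟨v, hv⟩ : {w : NumberField.InfinitePlace F // w ≠ w₀})).trans hu
    rw [Pi.sub_apply, logEmbedding_component, Real.norm_eq_abs] at h
    have : v.mult * Real.log (t v / v ε) = M * ((M : ℝ)⁻¹ * (v.mult * Real.log (t v)) -
        v.mult * Real.log (v ((u : 𝓞 F) : F))) := by
      rw [Real.log_div (ht v).ne' (hpos v).ne', hεv, Real.log_pow]
      field_simp
    rw [this, abs_mul, abs_of_pos hM']
    exact mul_le_mul_of_nonneg_left h hM'.le
  have hsum : ∑ v : NumberField.InfinitePlace F, (v.mult : ℝ) * Real.log (t v / v ε) = 0 := by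
    have := congrArg Real.log hkp
    rw [Real.log_prod (fun v _ => (pow_pos (hkpos v) _).ne')] at this
    simpa only [Real.log_pow, Real.log_one] using this
  have hb2 : ∀ v : NumberField.InfinitePlace F, |v.mult * Real.log (t v / v ε)| ≤ C := by
    intro v
    by_cases hv : v = w₀
    · subst hv
      rw [← Finset.add_sum_erase _ _ (Finset.mem_univ w₀)] at hsum
      rw [eq_neg_of_add_eq_zero_left hsum, abs_neg]
      refine (Finset.abs_sum_le_sum_abs _ _).trans ?_
      refine (Finset.sum_le_card_nsmul _ _ R fun v hv => hb1 v (Finset.ne_of_mem_erase hv)).trans ?_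
      rw [nsmul_eq_mul, hC]
      refine mul_le_mul_of_nonneg_right ?_ hR0
      have := Finset.card_le_univ (Finset.univ.erase (w₀ : NumberField.InfinitePlace F))
      have : ((Finset.univ.erase (w₀ : NumberField.InfinitePlace F)).card : ℝ) ≤
        Fintype.card (NumberField.InfinitePlace F) := by exact_mod_cast this
      linarith
    · exact (hb1 v hv).trans hRC
  have hb3 : ∀ v : NumberField.InfinitePlace F, |Real.log (t v / v ε)| ≤ C := by
    intro v
    refine le_trans ?_ (hb2 v)
    rw [abs_mul]
    refine le_mul_of_one_le_left (abs_nonneg _) ?_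
    rw [Nat.abs_cast]
    exact_mod_cast v.mult_pos
  refine ⟨fun v => t v / v ε, ⟨fun v _ => ?_, hkp⟩, fun v => v ε,
    ⟨ε, hε, ⟨_, hε', ?_⟩, hn, rfl⟩, ?_⟩
  · have := abs_le.mp (hb3 v)
    exact ⟨(Real.le_log_iff_exp_le (hkpos v)).mp this.1,
      (Real.log_le_iff_le_exp (hkpos v)).mp this.2⟩
  · have : (((u ^ M : (𝓞 F)ˣ) : 𝓞 F)) * ((u⁻¹ ^ M : (𝓞 F)ˣ) : 𝓞 F) = 1 := by
      rw [← Units.val_mul, ← mul_pow]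
      simp
    rw [hεdef]
    exact_mod_cast congrArg (algebraMap (𝓞 F) F) this
  · ext v
    simp [div_mul_cancel₀ _ (hpos v).ne']
end

section
/- Let g ∈ GL_n(ℝ) and t ∈ (ℝ_{>0})^n, and suppose g·diag(t_1, ..., t_n) = X·Y·R where X is upper triangular with ones on the diagonal and entries x_{ij} (i < j) above the diagonal, Y = diag(r_1, ..., r_n) with all r_i > 0, and R ∈ O(n). Set Q = g·diag(t_1², ..., t_n²)·gᵀ with entries q_{ij}. For i ≤ j let B_{ij} be the determinant of the (n−j+1) × (n−j+1) matrix formed by rows i, j+1, j+2, ..., n and columns j, j+1, ..., n of Q, with the convention B_{n+1,n+1} = 1; for 2 ≤ i ≤ n let C_i be the determinant of the (n−i+1) × (n−i+1) matrix formed by rows i−1, i+1, i+2, ..., n and columns i−1, i+1, i+2, ..., n of Q. Then: (i) r_i² = B_{ii}/B_{i+1,i+1} for 1 ≤ i ≤ n; (ii) x_{ij} = B_{ij}/B_{jj} for i < j; (iii) r_{i−1}² + x_{i−1,i}²·r_i² = C_i/B_{i+1,i+1} for 2 ≤ i ≤ n. -/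
lemma aux_B (x : ℕ → ℕ → ℝ) (d : ℕ → ℝ) (j m i : ℕ) (hm : 0 < m)
    (x1 : ∀ k < j + m, x k k = 1) (x0 : ∀ a b, b < a → x a b = 0) :
    (Matrix.of fun a b : Fin m =>
      ∑ k ∈ Finset.range (j + m), x (if (a : ℕ) = 0 then i else j + a) k * d k * x (j + b) k).det
      = x i j * ∏ k : Fin m, d (j + k) := by
  have key : (Matrix.of fun a b : Fin m =>
      ∑ k ∈ Finset.range (j + m), x (if (a : ℕ) = 0 then i else j + a) k * d k * x (j + b) k)
      = (Matrix.of fun a c : Fin m => x (if (a : ℕ) = 0 then i else j + a) (j + c)) *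
        (Matrix.of fun c b : Fin m => d (j + c) * x (j + b) (j + c)) := by
    ext a b
    rw [Matrix.mul_apply, Matrix.of_apply, Finset.sum_range_add, Finset.sum_eq_zero, zero_add,
      Finset.sum_range]
    · simp [mul_assoc]
    · intro k hk
      rw [x0 (j + b) k (by have := Finset.mem_range.1 hk; omega), mul_zero]
  rw [key, Matrix.det_mul, Matrix.det_of_upperTriangular, Matrix.det_of_lowerTriangular]
  · congr 1
    · obtain ⟨m, rfl⟩ : ∃ m', m = m' + 1 := ⟨m - 1, by omega⟩
      rw [Fin.prod_univ_succ, Finset.prod_eq_one]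
      · simp
      · intro c _
        simp only [Matrix.of_apply, Fin.val_succ, Nat.succ_ne_zero, if_false]
        exact x1 _ (by omega)
    · refine Finset.prod_congr rfl fun c _ => ?_
      simp only [Matrix.of_apply]
      rw [x1 _ (by omega), mul_one]
  · intro a b hab
    have h : (a : ℕ) < b := by simpa using hab
    simp only [Matrix.of_apply]
    rw [x0 _ _ (by omega), mul_zero]
  · intro a b hab
    have h : (b : ℕ) < a := by simpa using hab
    simp only [Matrix.of_apply]
    rw [if_neg (by omega), x0 _ _ (by omega)]

lemma aux_C (x : ℕ → ℕ → ℝ) (d : ℕ → ℝ) (p m : ℕ)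
    (x1 : ∀ k < p + 2 + m, x k k = 1) (x0 : ∀ a b, b < a → x a b = 0) :
    (Matrix.of fun a b : Fin (m + 1) =>
      ∑ k ∈ Finset.range (p + 2 + m), x (if (a : ℕ) = 0 then p else p + 1 + a) k * d k *
        x (if (b : ℕ) = 0 then p else p + 1 + b) k).det
      = (d p + x p (p + 1) ^ 2 * d (p + 1)) * ∏ k : Fin m, d (p + 2 + k) := by
  have key : (Matrix.of fun a b : Fin (m + 1) =>
      ∑ k ∈ Finset.range (p + 2 + m), x (if (a : ℕ) = 0 then p else p + 1 + a) k * d k *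
        x (if (b : ℕ) = 0 then p else p + 1 + b) k)
      = (Matrix.of fun a c : Fin (m + 1) => x (if (a : ℕ) = 0 then p else p + 1 + a)
          (if (c : ℕ) = 0 then p else p + 1 + c)) *
        (Matrix.of fun c b : Fin (m + 1) =>
          (if (c : ℕ) = 0 then d p + x p (p + 1) ^ 2 * d (p + 1) else d (p + 1 + c)) *
          x (if (b : ℕ) = 0 then p else p + 1 + b) (if (c : ℕ) = 0 then p else p + 1 + c)) := by
    ext a b
    rw [Matrix.mul_apply, Matrix.of_apply, Finset.sum_range_add, Finset.sum_range_succ,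
      Finset.sum_range_succ, Finset.sum_eq_zero, zero_add, Finset.sum_range, Fin.sum_univ_succ]
    · congr 1
      · simp only [Matrix.of_apply, Fin.val_zero, if_true]
        by_cases ha : (a : ℕ) = 0
        · by_cases hb : (b : ℕ) = 0
          · rw [if_pos ha, if_pos hb, x1 p (by omega)]; ring
          · rw [if_neg hb, x0 (p + 1 + b) p (by omega), x0 (p + 1 + b) (p + 1) (by omega)]; ring
        · rw [if_neg ha, x0 (p + 1 + a) p (by omega), x0 (p + 1 + a) (p + 1) (by omega)]; ring
      · refine Finset.sum_congr rfl fun c _ => ?_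
        simp only [Matrix.of_apply, Fin.val_succ, Nat.succ_ne_zero, if_false]
        rw [show p + 1 + ((c : ℕ) + 1) = p + 2 + c by ring, mul_assoc]
    · intro k hk
      have := Finset.mem_range.1 hk
      rw [x0 _ k (by split_ifs <;> omega), zero_mul, zero_mul]
  rw [key, Matrix.det_mul, Matrix.det_of_upperTriangular, Matrix.det_of_lowerTriangular,
    Finset.prod_eq_one, one_mul, Fin.prod_univ_succ]
  · congr 1
    · simp [x1 p (by omega)]
    · refine Finset.prod_congr rfl fun c _ => ?_
      simp only [Matrix.of_apply, Fin.val_succ, Nat.succ_ne_zero, if_false]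
      rw [x1 _ (by omega), mul_one, show p + 1 + ((c : ℕ) + 1) = p + 2 + c by ring]
  · intro c _
    simp only [Matrix.of_apply]
    exact x1 _ (by split_ifs <;> omega)
  · intro a b hab
    have h : (a : ℕ) < b := by simpa using hab
    simp only [Matrix.of_apply]
    exact mul_eq_zero_of_right _ (x0 _ _ (by split_ifs <;> omega))
  · intro a b hab
    have h : (b : ℕ) < a := by simpa using hab
    simp only [Matrix.of_apply]
    rw [x0 _ _ (by split_ifs <;> omega)]



open Matrix

/-- Entry of a matrix `Q : Matrix (Fin n) (Fin n) ℝ` read at natural-number indices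
(`0` outside the range). -/
def minorEntry {n : ℕ} (Q : Matrix (Fin n) (Fin n) ℝ) (a b : ℕ) : ℝ :=
  if ha : a < n then (if hb : b < n then Q ⟨a, ha⟩ ⟨b, hb⟩ else 0) else 0

/-- (0-based) The minor `B_{ij}`: the determinant of the `(n-j) × (n-j)` matrix formed by
rows `i, j+1, j+2, …, n-1` and columns `j, j+1, …, n-1` of `Q`.  For `j = n` this is the
determinant of the empty matrix, i.e. `1`. -/
noncomputable def minorB {n : ℕ} (Q : Matrix (Fin n) (Fin n) ℝ) (i j : ℕ) : ℝ :=
  (Matrix.of fun a b : Fin (n - j) =>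
    minorEntry Q (if (a : ℕ) = 0 then i else j + a) (j + b)).det

/-- (0-based) The minor `C_i`: the determinant of the `(n-i) × (n-i)` matrix formed by
rows `i-1, i+1, …, n-1` and columns `i-1, i+1, …, n-1` of `Q`. -/
noncomputable def minorC {n : ℕ} (Q : Matrix (Fin n) (Fin n) ℝ) (i : ℕ) : ℝ :=
  (Matrix.of fun a b : Fin (n - i) =>
    minorEntry Q (if (a : ℕ) = 0 then i - 1 else i + a)
      (if (b : ℕ) = 0 then i - 1 else i + b)).det

/-- **Iwasawa coordinates via minors** (Beukers).  If `g·diag(t) = X·Y·R` is the Iwasawa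
decomposition and `Q = g·diag(t²)·gᵀ`, then (0-based indexing):
(i) `rᵢ² = B_{ii}/B_{i+1,i+1}`; (ii) `x_{ij} = B_{ij}/B_{jj}` for `i < j`;
(iii) `r_{i-1}² + x_{i-1,i}²·rᵢ² = C_i/B_{i+1,i+1}` for `1 ≤ i`. -/
theorem stmt_8 (n : ℕ) (g : Matrix (Fin n) (Fin n) ℝ) (hg : IsUnit g)
    (t : Fin n → ℝ) (ht : ∀ i, 0 < t i)
    (X : Matrix (Fin n) (Fin n) ℝ)
    (hX1 : ∀ i, X i i = 1) (hXtri : ∀ i j : Fin n, (j : ℕ) < (i : ℕ) → X i j = 0)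
    (rr : Fin n → ℝ) (hr : ∀ i, 0 < rr i)
    (R : Matrix (Fin n) (Fin n) ℝ) (hR : R * Rᵀ = 1)
    (hdec : g * Matrix.diagonal t = X * Matrix.diagonal rr * R)
    (Q : Matrix (Fin n) (Fin n) ℝ)
    (hQ : Q = g * Matrix.diagonal (fun i => t i ^ 2) * gᵀ) :
    (∀ (i : ℕ) (hi : i < n),
      rr ⟨i, hi⟩ ^ 2 = minorB Q i i / minorB Q (i + 1) (i + 1)) ∧
    (∀ (i j : ℕ) (hij : i < j) (hj : j < n),
      X ⟨i, lt_trans hij hj⟩ ⟨j, hj⟩ = minorB Q i j / minorB Q j j) ∧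
    (∀ (i : ℕ) (h1 : 1 ≤ i) (hi : i < n),
      rr ⟨i - 1, by omega⟩ ^ 2 + X ⟨i - 1, by omega⟩ ⟨i, hi⟩ ^ 2 * rr ⟨i, hi⟩ ^ 2 =
        minorC Q i / minorB Q (i + 1) (i + 1)) := by

  have hQ2 : Q = X * Matrix.diagonal (fun i => rr i ^ 2) * Xᵀ := by
    have e1 : Q = (g * Matrix.diagonal t) * (g * Matrix.diagonal t)ᵀ := by
      rw [hQ, Matrix.transpose_mul, Matrix.diagonal_transpose, Matrix.mul_assoc, Matrix.mul_assoc,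
        ← Matrix.mul_assoc (Matrix.diagonal t), Matrix.diagonal_mul_diagonal]
      simp only [pow_two]
    rw [e1, hdec]
    calc X * Matrix.diagonal rr * R * (X * Matrix.diagonal rr * R)ᵀ
        = X * Matrix.diagonal rr * (R * Rᵀ) * (Matrix.diagonal rr * Xᵀ) := by
          simp only [Matrix.transpose_mul, Matrix.diagonal_transpose, Matrix.mul_assoc]
      _ = X * (Matrix.diagonal rr * Matrix.diagonal rr) * Xᵀ := by
          rw [hR]; simp only [Matrix.mul_one, Matrix.mul_assoc]
      _ = _ := by rw [Matrix.diagonal_mul_diagonal]; simp only [pow_two]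
  set x : ℕ → ℕ → ℝ := fun a b => minorEntry X a b with hx
  set d : ℕ → ℝ := fun k => if h : k < n then rr ⟨k, h⟩ ^ 2 else 0 with hd
  have hxe : ∀ a b (ha : a < n) (hb : b < n), X ⟨a, ha⟩ ⟨b, hb⟩ = x a b := by
    intro a b ha hb
    simp [hx, minorEntry, ha, hb]
  have hde : ∀ k (hk : k < n), rr ⟨k, hk⟩ ^ 2 = d k := by
    intro k hk
    simp [hd, hk]
  have x1 : ∀ k < n, x k k = 1 := fun k hk => by rw [← hxe k k hk hk, hX1]
  have x0 : ∀ a b, b < a → x a b = 0 := by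
    intro a b hab
    by_cases ha : a < n
    · rw [← hxe a b ha (by omega)]; exact hXtri _ _ hab
    · simp [hx, minorEntry, ha]
  have dpos : ∀ k < n, 0 < d k := fun k hk => by rw [← hde k hk]; exact pow_pos (hr _) 2
  have hQe : ∀ a b, minorEntry Q a b = ∑ k ∈ Finset.range n, x a k * d k * x b k := by
    intro a b
    by_cases ha : a < n
    · by_cases hb : b < n
      · rw [Finset.sum_range]
        simp only [minorEntry, ha, hb, dif_pos]
        rw [hQ2, Matrix.mul_apply]
        refine Finset.sum_congr rfl fun k _ => ?_
        rw [Matrix.mul_diagonal, Matrix.transpose_apply, ← hxe a k ha k.2, ← hxe b k hb k.2,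
          ← hde k k.2]
      · simp [hx, minorEntry, hb]
    · simp [hx, minorEntry, ha]
  have hB : ∀ i j, j < n → minorB Q i j = x i j * ∏ k : Fin (n - j), d (j + k) := by
    intro i j hj
    have := aux_B x d j (n - j) i (by omega) (fun k hk => x1 k (by omega)) x0
    rw [← this]
    unfold minorB
    simp only [hQe]
    rw [show j + (n - j) = n by omega]
  have hP : ∀ j, 0 < ∏ k : Fin (n - j), d (j + k) := fun j =>
    Finset.prod_pos fun k _ => dpos _ (by omega)
  have hBd : ∀ j, j ≤ n → minorB Q j j = ∏ k : Fin (n - j), d (j + k) := by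
    intro j hj
    rcases hj.lt_or_eq with h | rfl
    · rw [hB j j h, x1 j h, one_mul]
    · unfold minorB
      haveI : IsEmpty (Fin (j - j)) := by rw [Nat.sub_self]; infer_instance
      rw [Matrix.det_isEmpty, Finset.prod_of_isEmpty]
  refine ⟨?_, ?_, ?_⟩
  · intro i hi
    rw [hde, hBd i hi.le, hBd (i + 1) hi, eq_div_iff (hP (i + 1)).ne']
    obtain ⟨m, rfl⟩ : ∃ m, n = i + 1 + m := ⟨n - (i + 1), by omega⟩
    rw [← Finset.prod_range (fun k => d (i + k)), ← Finset.prod_range (fun k => d (i + 1 + k)),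
      show i + 1 + m - i = m + 1 by omega, show i + 1 + m - (i + 1) = m by omega,
      Finset.prod_range_succ', mul_comm]
    congr 1
    exact Finset.prod_congr rfl fun k _ => by congr 1; ring
  · intro i j hij hj
    rw [hxe, hBd j hj.le, hB i j hj, mul_div_assoc, div_self (hP j).ne', mul_one]
  · intro i h1 hi
    obtain ⟨p, rfl⟩ : ∃ p, i = p + 1 := ⟨i - 1, by omega⟩
    rw [hde, hde, hxe, hBd (p + 1 + 1) hi, eq_div_iff (hP (p + 1 + 1)).ne']
    have := aux_C x d p (n - (p + 1 + 1)) (fun k hk => x1 k (by omega)) x0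
    rw [Nat.add_sub_cancel]
    refine this.symm.trans ?_
    unfold minorC
    simp only [hQe, Nat.add_sub_cancel]
    rw [show p + 2 + (n - (p + 1 + 1)) = n by omega,
      show n - (p + 1 + 1) + 1 = n - (p + 1) by omega]
end

section
/- Fix ω ∈ [3/4, 1] and n ≥ 1. For any g ∈ GL_n(ℝ), the set {t ∈ ℝ_{>0} : g·diag(1, ..., 1, t) is ω-LLL-reduced modulo ℝ^×O(n)} is order-convex in ℝ_{>0} (an interval): if t_1 < t_2 < t_3 and both t_1 and t_3 belong to the set, then t_2 belongs to the set. -/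
open Matrix

/-- A matrix `h ∈ GL_n(ℝ)` is `ω`-LLL-reduced modulo `ℝ^× O(n)` if `h = c·X·Y·R` with `c ≠ 0`,
`X` unipotent upper triangular with `|x_{ij}| ≤ 1/2`, `Y = diag(r)` with `rᵢ > 0` satisfying
`ω·r_{i+1}² ≤ rᵢ² + x_{i,i+1}²·r_{i+1}²`, and `R` orthogonal. -/
def IsLLLReduced (n : ℕ) (ω : ℝ) (h : Matrix (Fin n) (Fin n) ℝ) : Prop :=
  ∃ (c : ℝ) (X : Matrix (Fin n) (Fin n) ℝ) (r : Fin n → ℝ) (R : Matrix (Fin n) (Fin n) ℝ),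
    c ≠ 0 ∧
    (∀ i, X i i = 1) ∧ (∀ i j : Fin n, (j : ℕ) < (i : ℕ) → X i j = 0) ∧
    (∀ i, 0 < r i) ∧
    R * Rᵀ = 1 ∧
    h = c • (X * Matrix.diagonal r * R) ∧
    (∀ i j : Fin n, (i : ℕ) < (j : ℕ) → |X i j| ≤ 1 / 2) ∧
    (∀ (i : ℕ) (hi : i + 1 < n),
      ω * r ⟨i + 1, hi⟩ ^ 2 ≤
        r ⟨i, by omega⟩ ^ 2 + X ⟨i, by omega⟩ ⟨i + 1, hi⟩ ^ 2 * r ⟨i + 1, hi⟩ ^ 2)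


/-- index selection map: replaces `j` by `i`. -/
def selIdx {n : ℕ} (i j : Fin n) (k : {k : Fin n // j ≤ k}) : Fin n := if k.1 = j then i else k.1

lemma det_affine {m : Type*} [Fintype m] [DecidableEq m] (P : Matrix m m ℝ) (u v : m → ℝ) :
    ∃ a b : ℝ, ∀ s : ℝ, (P + s • Matrix.vecMulVec u v).det = a + s * b := by
  let B : Matrix m Unit ℝ := Matrix.of fun i _ => - u i
  let K : Matrix (m ⊕ Unit) (m ⊕ Unit) ℝ := Matrix.fromBlocks P B 0 1
  let e1 : m ⊕ Unit → ℝ := Sum.elim 0 1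
  let e2 : m ⊕ Unit → ℝ := Sum.elim v 0
  refine ⟨(K.updateRow (Sum.inr ()) e1).det, (K.updateRow (Sum.inr ()) e2).det, fun s => ?_⟩
  rw [← Matrix.det_updateRow_smul, ← Matrix.det_updateRow_add]
  let C : Matrix Unit m ℝ := Matrix.of fun _ i => s * v i
  have h : K.updateRow (Sum.inr ()) (e1 + s • e2) = Matrix.fromBlocks P B C 1 := by
    ext i j
    rcases i with i | i <;> rcases j with j | j <;> simp [K, e1, e2, C, Matrix.updateRow_apply]
  rw [h, Matrix.det_fromBlocks_one₂₂]
  congr 1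
  ext i j
  simp [B, C, Matrix.mul_apply, Matrix.vecMulVec_apply]
  ring

lemma mdm_apply {m : Type*} [Fintype m] [DecidableEq m] (X Y : Matrix m m ℝ) (d : m → ℝ)
    (i j : m) : (X * Matrix.diagonal d * Y) i j = ∑ k, X i k * d k * Y k j := by
  rw [Matrix.mul_apply]
  simp only [Matrix.mul_diagonal]

lemma sum_ge {n : ℕ} (j : Fin n) (F : Fin n → ℝ) :
    ∑ m, (if j ≤ m then F m else 0) = ∑ m : {k : Fin n // j ≤ k}, F m := by
  rw [← Finset.sum_filter]
  exact Finset.sum_subtype _ (by simp) _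

lemma det_M {n : ℕ} (X : Matrix (Fin n) (Fin n) ℝ) (d : Fin n → ℝ)
    (hX1 : ∀ i, X i i = 1) (hX0 : ∀ i j : Fin n, j < i → X i j = 0) (i j : Fin n) :
    ((X * Matrix.diagonal d * Xᵀ).submatrix (selIdx i j) Subtype.val).det =
      X i j * ∏ m : {k : Fin n // j ≤ k}, d m := by
  have h : (X * Matrix.diagonal d * Xᵀ).submatrix (selIdx i j) Subtype.val =
      X.submatrix (selIdx i j) (Subtype.val : {k : Fin n // j ≤ k} → Fin n) *
        Matrix.diagonal (fun m : {k : Fin n // j ≤ k} => d m) *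
        (X.submatrix (Subtype.val : {k : Fin n // j ≤ k} → Fin n) Subtype.val)ᵀ := by
    ext k l
    simp only [Matrix.submatrix_apply, mdm_apply,
      Matrix.transpose_apply]
    rw [← sum_ge j (fun m => X (selIdx i j k) m * d m * X l m)]
    refine Finset.sum_congr rfl fun m _ => ?_
    split_ifs with hm
    · rfl
    · rw [hX0 l m (lt_of_lt_of_le (not_le.mp hm) l.2), mul_zero]
  rw [h, Matrix.det_mul, Matrix.det_mul, Matrix.det_diagonal, Matrix.det_transpose]
  have h1 : (X.submatrix (Subtype.val : {k : Fin n // j ≤ k} → Fin n) Subtype.val).det = 1 := by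
    rw [Matrix.det_of_isUpperTriangular]
    · simp [hX1]
    · intro a b hab
      exact hX0 _ _ hab
  have h2 : (X.submatrix (selIdx i j) (Subtype.val : {k : Fin n // j ≤ k} → Fin n)).det
      = X i j := by
    rw [Matrix.det_of_isUpperTriangular]
    · rw [Finset.prod_eq_single (⟨j, le_rfl⟩ : {k : Fin n // j ≤ k})]
      · simp [selIdx]
      · intro b _ hb
        have : b.1 ≠ j := fun h => hb (Subtype.ext h)
        simp [selIdx, this, hX1]
      · simp
    · intro a b hab
      have hab' : b.1 < a.1 := hab
      have : a.1 ≠ j := (lt_of_le_of_lt b.2 hab').ne'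
      simp only [Matrix.submatrix_apply, selIdx, this, if_false]
      exact hX0 _ _ hab
  rw [h1, h2, mul_one]

lemma det_N {n : ℕ} (X : Matrix (Fin n) (Fin n) ℝ) (d : Fin n → ℝ)
    (hX1 : ∀ i, X i i = 1) (hX0 : ∀ i j : Fin n, j < i → X i j = 0) (i j : Fin n)
    (hij : (i : ℕ) + 1 = j) :
    d j * ((X * Matrix.diagonal d * Xᵀ).submatrix (selIdx i j) (selIdx i j)).det =
      (d i + X i j ^ 2 * d j) * ∏ m : {k : Fin n // j ≤ k}, d m := by
  have hlt : i < j := by rw [Fin.lt_def]; omega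
  let V : Matrix {k : Fin n // j ≤ k} {k : Fin n // j ≤ k} ℝ :=
    Matrix.of fun k l => if k.1 = j ∧ l.1 = j then 1 else X (selIdx i j k) l
  let d' : {k : Fin n // j ≤ k} → ℝ := fun m => if m.1 = j then d i + X i j ^ 2 * d j else d m
  have h : (X * Matrix.diagonal d * Xᵀ).submatrix (selIdx i j) (selIdx i j) =
      V * Matrix.diagonal d' * Vᵀ := by
    ext k l
    simp only [Matrix.submatrix_apply, mdm_apply,
      Matrix.transpose_apply]
    have e1 : ∀ m : Fin n, X (selIdx i j k) m * d m * X (selIdx i j l) m =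
        (if j ≤ m then X (selIdx i j k) m * d m * X (selIdx i j l) m else 0) +
        (if m = i then (if k.1 = j ∧ l.1 = j then d i else 0) else 0) := by
      intro m
      by_cases hm : j ≤ m
      · have : m ≠ i := (lt_of_lt_of_le hlt hm).ne'
        simp [hm, this]
      · by_cases hmi : m = i
        · subst hmi
          have hk := lt_of_lt_of_le hlt k.2
          have hl := lt_of_lt_of_le hlt l.2
          by_cases hkj : k.1 = j <;> by_cases hlj : l.1 = j <;>
            simp [hm, selIdx, hkj, hlj, hX1, hX0 _ _ hk, hX0 _ _ hl]
        · have hmi' : m < i := by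
            rw [not_le] at hm
            rw [Fin.lt_def] at *
            have : (m : ℕ) ≠ i := fun h => hmi (Fin.ext h)
            omega
          have hk : m < selIdx i j k := by
            unfold selIdx
            split_ifs
            · exact hmi'
            · exact lt_of_lt_of_le (hmi'.trans hlt) k.2
          simp [hm, hmi, hX0 _ _ hk]
    rw [Finset.sum_congr rfl fun m _ => e1 m, Finset.sum_add_distrib, sum_ge j
      (fun m => X (selIdx i j k) m * d m * X (selIdx i j l) m)]
    have e2 : ∀ m : {k : Fin n // j ≤ k}, V k m * d' m * V l m =
        X (selIdx i j k) m * d m * X (selIdx i j l) m +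
        (if m = ⟨j, le_rfl⟩ then (if k.1 = j ∧ l.1 = j then d i else 0) else 0) := by
      intro m
      by_cases hm : m = ⟨j, le_rfl⟩
      · subst hm
        have hk : k.1 ≠ j → X k.1 j = 0 := fun h => hX0 _ _ (lt_of_le_of_ne k.2 (Ne.symm h))
        have hl : l.1 ≠ j → X l.1 j = 0 := fun h => hX0 _ _ (lt_of_le_of_ne l.2 (Ne.symm h))
        by_cases hkj : k.1 = j <;> by_cases hlj : l.1 = j <;>
            simp [V, d', selIdx, hkj, hlj, hk, hl]
        ring
      · have : m.1 ≠ j := fun h => hm (Subtype.ext h)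
        simp [V, d', hm, this]
    rw [Finset.sum_congr rfl fun m _ => e2 m, Finset.sum_add_distrib]
    simp
  have hV : V.det = 1 := by
    rw [Matrix.det_of_isUpperTriangular]
    · refine Finset.prod_eq_one fun k _ => ?_
      by_cases hk : k.1 = j <;> simp [V, selIdx, hk, hX1]
    · intro a b hab
      have hab' : b.1 < a.1 := hab
      have : a.1 ≠ j := (lt_of_le_of_lt b.2 hab').ne'
      simp only [V, Matrix.of_apply, selIdx, this, if_false, false_and]
      exact hX0 _ _ hab
  rw [h, Matrix.det_mul, Matrix.det_mul, Matrix.det_transpose, hV, Matrix.det_diagonal, one_mul,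
    mul_one]
  rw [← Finset.mul_prod_erase Finset.univ d' (Finset.mem_univ ⟨j, le_rfl⟩),
    ← Finset.mul_prod_erase Finset.univ (fun m : {k : Fin n // j ≤ k} => d m)
      (Finset.mem_univ ⟨j, le_rfl⟩)]
  have : ∏ x ∈ Finset.univ.erase (⟨j, le_rfl⟩ : {k : Fin n // j ≤ k}), d' x =
      ∏ x ∈ Finset.univ.erase (⟨j, le_rfl⟩ : {k : Fin n // j ≤ k}), d x := by
    refine Finset.prod_congr rfl fun x hx => ?_
    have : x.1 ≠ j := fun h => (Finset.ne_of_mem_erase hx) (Subtype.ext h)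
    simp [d', this]
  rw [this]
  simp [d']
  ring

/-- determinantal form of the reducedness conditions -/
def DetRed (n : ℕ) (ω : ℝ) (A : Matrix (Fin n) (Fin n) ℝ) : Prop :=
  (∀ i j : Fin n, i < j →
    |(A.submatrix (selIdx i j) Subtype.val).det| ≤
      1 / 2 * (A.submatrix (selIdx j j) Subtype.val).det) ∧
  (∀ i j : Fin n, (i : ℕ) + 1 = j →
    ω * (A.submatrix (selIdx j j) Subtype.val).det ≤
      (A.submatrix (selIdx i j) (selIdx i j)).det)

lemma detRed_iff {n : ℕ} {ω : ℝ} (X : Matrix (Fin n) (Fin n) ℝ) (d : Fin n → ℝ)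
    (hX1 : ∀ i, X i i = 1) (hX0 : ∀ i j : Fin n, j < i → X i j = 0) (hd : ∀ i, 0 < d i) :
    DetRed n ω (X * Matrix.diagonal d * Xᵀ) ↔
      (∀ i j : Fin n, i < j → |X i j| ≤ 1 / 2) ∧
      (∀ i j : Fin n, (i : ℕ) + 1 = j → ω * d j ≤ d i + X i j ^ 2 * d j) := by
  have hp : ∀ j : Fin n, 0 < ∏ m : {k : Fin n // j ≤ k}, d m :=
    fun j => Finset.prod_pos fun m _ => hd m
  unfold DetRed
  refine and_congr ?_ ?_
  · refine forall_congr' fun i => forall_congr' fun j => imp_congr_right fun _ => ?_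
    rw [det_M X d hX1 hX0, det_M X d hX1 hX0, hX1, one_mul, abs_mul, abs_of_pos (hp j)]
    exact mul_le_mul_iff_left₀ (hp j)
  · refine forall_congr' fun i => forall_congr' fun j => imp_congr_right fun hij => ?_
    rw [← mul_le_mul_iff_right₀ (hd j), det_N X d hX1 hX0 i j hij, det_M X d hX1 hX0, hX1, one_mul,
      ← mul_assoc, mul_le_mul_iff_left₀ (hp j), mul_comm (d j) ω]

lemma exists_factor : ∀ (n : ℕ) (A : Matrix (Fin n) (Fin n) ℝ), A.PosDef →
    ∃ (X : Matrix (Fin n) (Fin n) ℝ) (d : Fin n → ℝ), (∀ i, X i i = 1) ∧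
      (∀ i j : Fin n, j < i → X i j = 0) ∧ (∀ i, 0 < d i) ∧ A = X * Matrix.diagonal d * Xᵀ := by
  intro n
  induction n with
  | zero => 
    intro A _
    exact ⟨1, 1, fun i => i.elim0, fun i => i.elim0, fun i => i.elim0, by ext i; exact i.elim0⟩
  | succ n ih =>
    intro A hA
    obtain ⟨X, d, hX1, hX0, hd, hE⟩ := ih (A.submatrix Fin.succ Fin.succ)
      (hA.submatrix (Fin.succ_injective n))
    have hXd : X.det = 1 := by
      rw [Matrix.det_of_isUpperTriangular]
      · simp [hX1]
      · intro a b hab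
        exact hX0 _ _ hab
    let b : Fin n → ℝ := fun j => A 0 j.succ
    let w : Fin n → ℝ := X⁻¹ *ᵥ b
    have hw : X *ᵥ w = b := by
      simp only [w, Matrix.mulVec_mulVec]
      rw [Matrix.mul_nonsing_inv _ (by simp [hXd]), Matrix.one_mulVec]
    let y : Fin n → ℝ := fun j => w j / d j
    let Z : Matrix (Fin (n+1)) (Fin (n+1)) ℝ := Matrix.of
      (Fin.cons (Fin.cons 1 y) fun i => Fin.cons 0 (X i))
    let d0 : ℝ := A 0 0 - ∑ j, y j * d j * y j
    let D : Fin (n+1) → ℝ := Fin.cons d0 d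
    have hsym : ∀ i j, A i j = A j i := fun i j => by
      have := hA.isHermitian.apply i j
      simpa using this.symm
    have hb : ∀ i, ∑ j, X i j * d j * y j = b i := by
      intro i
      rw [← hw]
      simp only [Matrix.mulVec, dotProduct, y]
      refine Finset.sum_congr rfl fun j _ => ?_
      have := (hd j).ne'
      field_simp
    have hAE : A = Z * Matrix.diagonal D * Zᵀ := by
      ext i j
      simp only [mdm_apply, Matrix.transpose_apply]
      rw [Fin.sum_univ_succ]
      refine Fin.cases ?_ (fun i => ?_) i <;> refine Fin.cases ?_ (fun j => ?_) j
      · simp [Z, D, d0]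
      · have := hb j
        simp only [Z, D, Matrix.of_apply, Fin.cons_zero, Fin.cons_succ, mul_zero, zero_add]
        change b j = _
        rw [← this]
        exact Finset.sum_congr rfl fun _ _ => by ring
      · have := hb i
        simp only [Z, D, Matrix.of_apply, Fin.cons_zero, Fin.cons_succ, zero_mul, zero_add]
        rw [hsym]
        change b i = _
        rw [← this]
      · have := congrFun (congrFun hE i) j
        simp only [mdm_apply, Matrix.transpose_apply,
          Matrix.submatrix_apply] at this
        simp [Z, D, this]
    have hZ1 : ∀ i, Z i i = 1 := by
      intro i
      refine Fin.cases ?_ (fun i => ?_) i <;> simp [Z, hX1]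
    have hZ0 : ∀ i j : Fin (n+1), j < i → Z i j = 0 := by
      intro i j
      refine Fin.cases ?_ (fun i => ?_) i <;> refine Fin.cases ?_ (fun j => ?_) j
      · simp
      · intro h; exact absurd h (by simp)
      · simp [Z]
      · intro h
        simpa [Z] using hX0 i j (by simpa using h)
    refine ⟨Z, D, hZ1, hZ0, ?_, hAE⟩
    have hZd : Z.det = 1 := by
      rw [Matrix.det_of_isUpperTriangular]
      · simp [hZ1]
      · intro a b hab
        exact hZ0 _ _ hab
    have hdet := hA.det_pos
    rw [hAE, Matrix.det_mul, Matrix.det_mul, Matrix.det_transpose, hZd, Matrix.det_diagonal,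
      Fin.prod_univ_succ] at hdet
    simp only [D, Fin.cons_zero, Fin.cons_succ, one_mul, mul_one] at hdet
    intro i
    refine Fin.cases ?_ (fun i => ?_) i
    · exact (pos_iff_pos_of_mul_pos hdet).mpr (Finset.prod_pos fun i _ => hd i)
    · exact hd i

lemma lll_iff {n : ℕ} {ω : ℝ} (h : Matrix (Fin n) (Fin n) ℝ) (hh : IsUnit h) :
    IsLLLReduced n ω h ↔ DetRed n ω (h * hᵀ) := by
  constructor
  · rintro ⟨c, X, r, R, hc, hX1, hX0, hr, hR, rfl, hx, hl⟩
    have e : c • (X * Matrix.diagonal r * R) * (c • (X * Matrix.diagonal r * R))ᵀ =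
        X * Matrix.diagonal (fun i => c ^ 2 * r i ^ 2) * Xᵀ := by
      have e0 : Matrix.diagonal (fun i => c ^ 2 * r i ^ 2) =
          (c * c) • (Matrix.diagonal r * Matrix.diagonal r) := by
        ext a b
        by_cases hab : a = b
        · subst hab; simp; ring
        · simp [hab]
      rw [e0]
      simp only [Matrix.transpose_smul, Matrix.transpose_mul, Matrix.diagonal_transpose,
        Matrix.smul_mul, Matrix.mul_smul, smul_smul]
      congr 1
      calc X * Matrix.diagonal r * R * (Rᵀ * (Matrix.diagonal r * Xᵀ))
          = X * Matrix.diagonal r * (R * Rᵀ) * (Matrix.diagonal r * Xᵀ) := by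
            simp only [Matrix.mul_assoc]
        _ = _ := by rw [hR]; simp only [Matrix.mul_assoc, Matrix.mul_one, Matrix.one_mul]
    rw [e, detRed_iff X _ hX1 (fun i j h => hX0 i j h)
      (fun i => by have := hr i; positivity)]
    refine ⟨fun i j h => hx i j h, fun i j hij => ?_⟩
    have := hl i (by omega)
    have ej : (⟨i + 1, by omega⟩ : Fin n) = j := Fin.ext hij
    rw [ej] at this
    have := mul_le_mul_of_nonneg_left this (sq_nonneg c)
    simp only [Fin.eta] at this
    linarith
  · intro H
    have hP : (h * hᵀ).PosDef := by
      have := Matrix.PosDef.mul_conjTranspose_self h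
        (Matrix.vecMul_injective_of_isUnit hh)
      simpa [Matrix.conjTranspose_eq_transpose_of_trivial] using this
    obtain ⟨X, d, hX1, hX0, hd, hE⟩ := exists_factor n _ hP
    rw [hE, detRed_iff X d hX1 hX0 hd] at H
    have hXd : X.det = 1 := by
      rw [Matrix.det_of_isUpperTriangular]
      · simp [hX1]
      · intro a b hab
        exact hX0 _ _ hab
    have hsq : ∀ i, Real.sqrt (d i) ^ 2 = d i := fun i => Real.sq_sqrt (hd i).le
    set L := X * Matrix.diagonal (fun i => Real.sqrt (d i)) with hL
    have hLL : L * Lᵀ = h * hᵀ := by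
      rw [hE, hL, Matrix.transpose_mul, Matrix.diagonal_transpose]
      have : Matrix.diagonal d = Matrix.diagonal (fun i => Real.sqrt (d i)) *
          Matrix.diagonal (fun i => Real.sqrt (d i)) := by
        rw [Matrix.diagonal_mul_diagonal]
        congr 1; ext i; rw [← sq, hsq]
      rw [this]; simp only [Matrix.mul_assoc]
    have hLu : IsUnit L.det := by
      rw [hL, Matrix.det_mul, hXd, one_mul, Matrix.det_diagonal]
      exact (Finset.prod_pos fun i _ => Real.sqrt_pos.mpr (hd i)).ne'.isUnit
    refine ⟨1, X, fun i => Real.sqrt (d i), L⁻¹ * h, one_ne_zero, hX1, fun i j h => hX0 i j h,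
      fun i => Real.sqrt_pos.mpr (hd i), ?_, ?_, fun i j h => H.1 i j h, fun i hi => ?_⟩
    · calc L⁻¹ * h * (L⁻¹ * h)ᵀ = L⁻¹ * (h * hᵀ) * (L⁻¹)ᵀ := by
            simp only [Matrix.transpose_mul, Matrix.mul_assoc]
        _ = (L⁻¹ * L) * (L⁻¹ * L)ᵀ := by
            rw [← hLL]; simp only [Matrix.transpose_mul, Matrix.mul_assoc]
        _ = 1 := by rw [Matrix.nonsing_inv_mul _ hLu]; simp
    · rw [one_smul, ← hL, ← Matrix.mul_assoc, Matrix.mul_nonsing_inv _ hLu, Matrix.one_mul]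
    · simp only [hsq]
      exact H.2 ⟨i, by omega⟩ ⟨i + 1, hi⟩ rfl

lemma affine_le {a b a' b' s1 s2 s3 : ℝ} (h12 : s1 < s2) (h23 : s2 < s3)
    (h1 : a + s1 * b ≤ a' + s1 * b') (h3 : a + s3 * b ≤ a' + s3 * b') :
    a + s2 * b ≤ a' + s2 * b' := by
  by_contra hc
  push Not at hc
  nlinarith [mul_le_mul_of_nonneg_left h1 (sub_pos.mpr h23).le,
    mul_le_mul_of_nonneg_left h3 (sub_pos.mpr h12).le,
    mul_lt_mul_of_pos_left hc (sub_pos.mpr (h12.trans h23))]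

lemma detRed_convex {n : ℕ} {ω : ℝ} (P : Matrix (Fin n) (Fin n) ℝ) (v : Fin n → ℝ)
    {s1 s2 s3 : ℝ} (h12 : s1 < s2) (h23 : s2 < s3)
    (h1 : DetRed n ω (P + s1 • Matrix.vecMulVec v v))
    (h3 : DetRed n ω (P + s3 • Matrix.vecMulVec v v)) :
    DetRed n ω (P + s2 • Matrix.vecMulVec v v) := by
  have key : ∀ {j : Fin n} (f g : {k : Fin n // j ≤ k} → Fin n), ∃ a b : ℝ, ∀ s : ℝ,
      ((P + s • Matrix.vecMulVec v v).submatrix f g).det = a + s * b := by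
    intro j f g
    obtain ⟨a, b, hab⟩ := det_affine (P.submatrix f g) (v ∘ f) (v ∘ g)
    refine ⟨a, b, fun s => ?_⟩
    rw [← hab]
    rfl
  refine ⟨fun i j hij => ?_, fun i j hij => ?_⟩
  · have h1 := h1.1 i j hij
    have h3 := h3.1 i j hij
    obtain ⟨a, b, hab⟩ := key (selIdx i j) Subtype.val
    obtain ⟨a', b', hab'⟩ := key (selIdx j j) Subtype.val
    rw [hab, hab', abs_le] at *
    constructor
    · have := affine_le (a := -(1/2*a')) (b := -(1/2*b')) (a' := a) (b' := b) h12 h23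
        (by linarith [h1.1]) (by linarith [h3.1])
      linarith
    · have := affine_le (a' := (1/2*a')) (b' := (1/2*b')) (a := a) (b := b) h12 h23
        (by linarith [h1.2]) (by linarith [h3.2])
      linarith
  · have h1 := h1.2 i j hij
    have h3 := h3.2 i j hij
    obtain ⟨a, b, hab⟩ := key (selIdx i j) (selIdx i j)
    obtain ⟨a', b', hab'⟩ := key (selIdx j j) Subtype.val
    rw [hab, hab'] at *
    have := affine_le (a := ω*a') (b := ω*b') (a' := a) (b' := b) h12 h23
        (by linarith) (by linarith)
    linarith

/-- **The LLL-reduced set is `𝔊_{(n-1,1),(0,1)}`-convex**: for `g ∈ GL_n(ℝ)`, the set of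
`t > 0` such that `g·diag(1,…,1,t)` is `ω`-LLL-reduced modulo `ℝ^× O(n)` is order-convex. -/
theorem stmt_10 (ω : ℝ) (hω : 3 / 4 ≤ ω) (hω1 : ω ≤ 1) (n : ℕ) (hn : 1 ≤ n)
    (g : Matrix (Fin n) (Fin n) ℝ) (hg : IsUnit g)
    (t₁ t₂ t₃ : ℝ) (h1 : 0 < t₁) (h3 : 0 < t₃)
    (h12 : t₁ < t₂) (h23 : t₂ < t₃)
    (hr1 : IsLLLReduced n ω
      (g * Matrix.diagonal fun i : Fin n => if (i : ℕ) = n - 1 then t₁ else 1))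
    (hr3 : IsLLLReduced n ω
      (g * Matrix.diagonal fun i : Fin n => if (i : ℕ) = n - 1 then t₃ else 1)) :
    0 < t₂ ∧ IsLLLReduced n ω
      (g * Matrix.diagonal fun i : Fin n => if (i : ℕ) = n - 1 then t₂ else 1) := by
  have h2 : 0 < t₂ := h1.trans h12
  refine ⟨h2, ?_⟩
  have hu : ∀ t : ℝ, 0 < t →
      IsUnit (g * Matrix.diagonal fun i : Fin n => if (i : ℕ) = n - 1 then t else 1) := by
    intro t ht
    refine hg.mul ?_
    rw [Matrix.isUnit_iff_isUnit_det, Matrix.det_diagonal]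
    refine (Finset.prod_pos fun i _ => ?_).ne'.isUnit
    split_ifs
    · exact ht
    · exact one_pos
  let P : Matrix (Fin n) (Fin n) ℝ :=
    g * Matrix.diagonal (fun i : Fin n => if (i : ℕ) = n - 1 then 0 else 1) * gᵀ
  let v : Fin n → ℝ := fun i => g i ⟨n - 1, by omega⟩
  have hG : ∀ t : ℝ, (g * Matrix.diagonal fun i : Fin n => if (i : ℕ) = n - 1 then t else 1) *
      (g * Matrix.diagonal fun i : Fin n => if (i : ℕ) = n - 1 then t else 1)ᵀ =
      P + (t ^ 2) • Matrix.vecMulVec v v := by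
    intro t
    ext i j
    simp only [P, Matrix.add_apply, Matrix.smul_apply, Matrix.vecMulVec_apply, mdm_apply,
      Matrix.mul_diagonal, Matrix.transpose_apply, smul_eq_mul]
    have : t ^ 2 * (v i * v j) = ∑ m : Fin n, if m = ⟨n - 1, by omega⟩ then
        t ^ 2 * (v i * v j) else 0 := by simp
    rw [this, ← Finset.sum_add_distrib]
    refine Finset.sum_congr rfl fun m _ => ?_
    by_cases hm : (m : ℕ) = n - 1
    · have hm' : m = ⟨n - 1, by omega⟩ := Fin.ext hm
      have hv : ∀ a, v a = g a m := fun a => by rw [hm']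
      rw [hv, hv, if_pos hm']
      simp [hm]; ring
    · have hm' : m ≠ ⟨n - 1, by omega⟩ := fun h => hm (by rw [h])
      simp [hm, hm']
  rw [lll_iff _ (hu _ h1), hG] at hr1
  rw [lll_iff _ (hu _ h3), hG] at hr3
  rw [lll_iff _ (hu _ h2), hG]
  exact detRed_convex P v (by nlinarith) (by nlinarith) hr1 hr3
end

section
/- Fix ω ∈ [3/4, 1] and n ≥ 1. Let n = n_1 + ... + n_r be a partition and d = (d_1, ..., d_r) ∈ ℕ^r. For any g ∈ GL_n(ℝ): (a) the set {t ∈ ℝ_{>0} : g·I_λ(t^{d_1}, ..., t^{d_r}) is ω-LLL-reduced modulo ℝ^×O(n)} is a union of finitely many intervals of ℝ_{>0}; (b) the same holds with 'Siegel-reduced modulo ℝ^×O(n)' in place of 'ω-LLL-reduced modulo ℝ^×O(n)'. Here I_λ(s_1, ..., s_r) denotes the block diagonal matrix diag(s_1·I_{n_1}, ..., s_r·I_{n_r}). -/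
open Matrix

/-- A matrix `h ∈ GL_n(ℝ)` is Siegel-reduced modulo `ℝ^× O(n)` if `h = c·X·Y·R` with `c ≠ 0`,
`X` unipotent upper triangular with `|x_{ij}| ≤ 1/2`, `Y = diag(r)` with `rᵢ > 0` satisfying
`rᵢ/r_{i+1} ≥ √3/2`, and `R` orthogonal. -/
noncomputable def IsSiegelReduced (n : ℕ) (h : Matrix (Fin n) (Fin n) ℝ) : Prop :=
  ∃ (c : ℝ) (X : Matrix (Fin n) (Fin n) ℝ) (r : Fin n → ℝ) (R : Matrix (Fin n) (Fin n) ℝ),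
    c ≠ 0 ∧
    (∀ i, X i i = 1) ∧ (∀ i j : Fin n, (j : ℕ) < (i : ℕ) → X i j = 0) ∧
    (∀ i, 0 < r i) ∧
    R * Rᵀ = 1 ∧
    h = c • (X * Matrix.diagonal r * R) ∧
    (∀ i j : Fin n, (i : ℕ) < (j : ℕ) → |X i j| ≤ 1 / 2) ∧
    (∀ (i : ℕ) (hi : i + 1 < n),
      Real.sqrt 3 / 2 ≤ r ⟨i, by omega⟩ / r ⟨i + 1, hi⟩)

/-- `f` is a rational function, without poles, on the positive reals. -/
def IsRat (f : ℝ → ℝ) : Prop :=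
  ∃ p q : Polynomial ℝ, ∀ t : ℝ, 0 < t → q.eval t ≠ 0 ∧ f t = p.eval t / q.eval t

lemma IsRat.congr {f g : ℝ → ℝ} (hf : IsRat f) (h : ∀ t, 0 < t → g t = f t) : IsRat g := by
  obtain ⟨p, q, hpq⟩ := hf
  exact ⟨p, q, fun t ht => ⟨(hpq t ht).1, (h t ht).trans (hpq t ht).2⟩⟩

lemma IsRat.poly (p : Polynomial ℝ) : IsRat (fun t => p.eval t) :=
  ⟨p, 1, fun t _ => by simp⟩

lemma IsRat.const (c : ℝ) : IsRat (fun _ => c) :=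
  (IsRat.poly (Polynomial.C c)).congr (by simp)

lemma IsRat.add {f g : ℝ → ℝ} (hf : IsRat f) (hg : IsRat g) : IsRat (fun t => f t + g t) := by
  obtain ⟨p, q, h⟩ := hf
  obtain ⟨p', q', h'⟩ := hg
  refine ⟨p * q' + q * p', q * q', fun t ht => ?_⟩
  have h1 := (h t ht).1
  have h2 := (h' t ht).1
  refine ⟨by simp [h1, h2], ?_⟩
  beta_reduce
  rw [(h t ht).2, (h' t ht).2, div_add_div _ _ h1 h2]
  simp

lemma IsRat.mul {f g : ℝ → ℝ} (hf : IsRat f) (hg : IsRat g) : IsRat (fun t => f t * g t) := by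
  obtain ⟨p, q, h⟩ := hf
  obtain ⟨p', q', h'⟩ := hg
  refine ⟨p * p', q * q', fun t ht => ?_⟩
  have h1 := (h t ht).1
  have h2 := (h' t ht).1
  refine ⟨by simp [h1, h2], ?_⟩
  beta_reduce
  rw [(h t ht).2, (h' t ht).2, div_mul_div_comm]
  simp

lemma IsRat.sub {f g : ℝ → ℝ} (hf : IsRat f) (hg : IsRat g) : IsRat (fun t => f t - g t) :=
  (hf.add ((IsRat.const (-1)).mul hg)).congr (fun t _ => by ring)

lemma IsRat.div {f g : ℝ → ℝ} (hf : IsRat f) (hg : IsRat g) (h0 : ∀ t, 0 < t → g t ≠ 0) :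
    IsRat (fun t => f t / g t) := by
  obtain ⟨p, q, h⟩ := hf
  obtain ⟨p', q', h'⟩ := hg
  refine ⟨p * q', q * p', fun t ht => ?_⟩
  have h1 := (h t ht).1
  have h2 := (h' t ht).1
  have h3 := h0 t ht
  rw [(h' t ht).2] at h3
  have h4 : p'.eval t ≠ 0 := fun h => h3 (by simp [h])
  refine ⟨by simp [h1, h4], ?_⟩
  beta_reduce
  rw [(h t ht).2, (h' t ht).2, div_div_div_eq]
  simp

lemma IsRat.sum {κ : Type*} (s : Finset κ) {f : κ → ℝ → ℝ} (hf : ∀ k ∈ s, IsRat (f k)) :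
    IsRat (fun t => ∑ k ∈ s, f k t) := by
  classical
  induction s using Finset.induction_on with
  | empty => simpa using IsRat.const 0
  | insert a s ha ih =>
    simp only [Finset.sum_insert ha]
    exact (hf a (by simp)).add (ih fun k hk => hf k (by simp [hk]))

lemma isRat_inner {n : ℕ} {u v : ℝ → EuclideanSpace ℝ (Fin n)}
    (hu : ∀ k, IsRat (fun t => u t k)) (hv : ∀ k, IsRat (fun t => v t k)) :
    IsRat (fun t => inner ℝ (u t) (v t)) := by
  refine (IsRat.sum Finset.univ (f := fun k t => u t k * v t k)
    (fun k _ => (hu k).mul (hv k))).congr fun t _ => ?_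
  rw [PiLp.inner_apply]
  exact Finset.sum_congr rfl fun k _ => by simp [mul_comm]

lemma isRat_gramSchmidt {ι : Type*} [LinearOrder ι] [LocallyFiniteOrderBot ι] [WellFoundedLT ι]
    {n : ℕ} (f : ℝ → ι → EuclideanSpace ℝ (Fin n))
    (hf : ∀ i k, IsRat (fun t => f t i k)) (hli : ∀ t, 0 < t → LinearIndependent ℝ (f t)) (i : ι) :
    ∀ k, IsRat (fun t => InnerProductSpace.gramSchmidt ℝ (f t) i k) := by
  induction i using WellFoundedLT.induction with
  | ind i ih =>
  intro k
  have key : IsRat (fun t => f t i k - ∑ j ∈ Finset.Iio i,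
      inner ℝ (InnerProductSpace.gramSchmidt ℝ (f t) j) (f t i) /
        inner ℝ (InnerProductSpace.gramSchmidt ℝ (f t) j)
          (InnerProductSpace.gramSchmidt ℝ (f t) j) *
        InnerProductSpace.gramSchmidt ℝ (f t) j k) := by
    refine (hf i k).sub (IsRat.sum _ fun j hj => ?_)
    have hj' := ih j (Finset.mem_Iio.1 hj)
    refine (IsRat.div (isRat_inner hj' (hf i)) (isRat_inner hj' hj') fun t ht => ?_).mul (hj' k)
    rw [inner_self_ne_zero]
    exact InnerProductSpace.gramSchmidt_ne_zero j (hli t ht)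
  refine key.congr fun t ht => ?_
  have := congrArg (fun v : EuclideanSpace ℝ (Fin n) => v k)
    (InnerProductSpace.gramSchmidt_def'' ℝ (f t) i)
  simp only [PiLp.add_apply, WithLp.ofLp_sum, Finset.sum_apply, PiLp.smul_apply, smul_eq_mul] at this
  rw [eq_sub_iff_add_eq, this]
  congr 1
  refine Finset.sum_congr rfl fun j _ => ?_
  rw [real_inner_self_eq_norm_sq]
  rfl

/-- Sets locally constant off a finite set are finite unions of intervals. -/
lemma finUnion (F : Finset ℝ) (S : Set ℝ)
    (hS : ∀ a b, a ≤ b → (∀ x ∈ F, ¬ (a ≤ x ∧ x ≤ b)) → (a ∈ S ↔ b ∈ S)) :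
    ∃ (m : ℕ) (I : Fin m → Set ℝ), (∀ a, (I a).OrdConnected) ∧ S = ⋃ a, I a := by
  classical
  let code : ℝ → Finset ℝ × Finset ℝ := fun t => (F.filter (· < t), F.filter (· ≤ t))
  let T : Finset (Finset ℝ × Finset ℝ) := F.powerset ×ˢ F.powerset
  have hT : ∀ t, code t ∈ T := fun t => by simp [T, code]
  refine ⟨T.card, fun a => {t | code t = (T.equivFin.symm a : _) ∧ t ∈ S}, ?_, ?_⟩
  · intro a
    refine ⟨fun x hx y hy z hz => ?_⟩
    obtain ⟨hx1, hx2⟩ := hx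
    obtain ⟨hy1, hy2⟩ := hy
    obtain ⟨hz1, hz2⟩ := hz
    rcases hz1.eq_or_lt with rfl | hz1
    · exact ⟨hx1, hx2⟩
    have hxy := hx1.trans hy1.symm
    simp only [code, Prod.mk.injEq, Finset.ext_iff, Finset.mem_filter] at hxy
    have hd : ∀ w ∈ F, ¬ (x ≤ w ∧ w ≤ y) := by
      rintro w hw ⟨h1, h2⟩
      have h3 := ((hxy.2 w).2 ⟨hw, h2⟩).2
      have h4 := ((hxy.1 w).2 ⟨hw, by linarith⟩).2
      linarith
    refine ⟨?_, (hS x z hz1.le fun w hw h => hd w hw ⟨h.1, h.2.trans hz2⟩).1 hx2⟩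
    rw [← hx1]
    simp only [code, Prod.mk.injEq]
    constructor
    · refine Finset.filter_congr fun w hw => ⟨fun h => ?_, fun h => h.trans hz1⟩
      by_contra h'
      exact hd w hw ⟨not_lt.1 h', h.le.trans hz2⟩
    · refine Finset.filter_congr fun w hw => ⟨fun h => ?_, fun h => h.trans hz1.le⟩
      by_contra h'
      exact hd w hw ⟨(not_le.1 h').le, h.trans hz2⟩
  · ext t
    simp only [Set.mem_iUnion, Set.mem_ofPred_eq]
    constructor
    · intro ht
      exact ⟨T.equivFin ⟨code t, hT t⟩, by simp, ht⟩
    · rintro ⟨_, _, h⟩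
      exact h

lemma poly_sign (P : Polynomial ℝ) (a b : ℝ) (hab : a ≤ b)
    (h : ∀ x ∈ P.roots.toFinset, ¬ (a ≤ x ∧ x ≤ b)) : 0 ≤ P.eval a ↔ 0 ≤ P.eval b := by
  by_cases hP : P = 0
  · simp [hP]
  have hr : ∀ x, a ≤ x → x ≤ b → P.eval x ≠ 0 := fun x h1 h2 h0 =>
    h x (by simp [hP, h0]) ⟨h1, h2⟩
  have hc : ContinuousOn (fun x => P.eval x) (Set.Icc a b) := P.continuous.continuousOn
  constructor
  · intro h1
    by_contra h2
    obtain ⟨x, hx, hx0⟩ := intermediate_value_Icc' hab hc (show (0:ℝ) ∈ _ from ⟨(not_le.1 h2).le, h1⟩)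
    exact hr x hx.1 hx.2 hx0
  · intro h1
    by_contra h2
    obtain ⟨x, hx, hx0⟩ := intermediate_value_Icc hab hc (show (0:ℝ) ∈ _ from ⟨(not_le.1 h2).le, h1⟩)
    exact hr x hx.1 hx.2 hx0

lemma finUnion_rat {κ : Type*} [Fintype κ] (f : κ → ℝ → ℝ) (hf : ∀ k, IsRat (f k)) :
    ∃ (m : ℕ) (I : Fin m → Set ℝ), (∀ a, (I a).OrdConnected) ∧
      {t : ℝ | 0 < t ∧ ∀ k, 0 ≤ f k t} = ⋃ a, I a := by
  classical
  choose p q hpq using hf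
  apply finUnion (insert 0 (Finset.univ.biUnion fun k => (p k * q k).roots.toFinset))
  intro a b hab h
  have hsgn : ∀ t, 0 < t → ∀ k, (0 ≤ f k t ↔ 0 ≤ (p k * q k).eval t) := by
    intro t ht k
    rw [(hpq k t ht).2, Polynomial.eval_mul]
    have hq := (hpq k t ht).1
    have : 0 < (q k).eval t ^ 2 := by positivity
    have e : (p k).eval t * (q k).eval t = (p k).eval t / (q k).eval t * (q k).eval t ^ 2 := by
      field_simp
    rw [e, mul_nonneg_iff_of_pos_right this]
  have h0 : 0 < a ↔ 0 < b := by
    refine ⟨fun h => h.trans_le hab, fun hb => ?_⟩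
    by_contra ha
    exact h 0 (by simp) ⟨not_lt.1 ha, hb.le⟩
  constructor
  · rintro ⟨h1, h2⟩
    refine ⟨h0.1 h1, fun k => ?_⟩
    rw [hsgn b (h0.1 h1), ← poly_sign _ a b hab fun x hx => h x ?_, ← hsgn a h1]
    · exact h2 k
    · exact Finset.mem_insert_of_mem (Finset.mem_biUnion.2 ⟨k, Finset.mem_univ _, hx⟩)
  · rintro ⟨h1, h2⟩
    refine ⟨h0.2 h1, fun k => ?_⟩
    rw [hsgn a (h0.2 h1), poly_sign _ a b hab fun x hx => h x ?_, ← hsgn b h1]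
    · exact h2 k
    · exact Finset.mem_insert_of_mem (Finset.mem_biUnion.2 ⟨k, Finset.mem_univ _, hx⟩)

lemma det_unitri {n : ℕ} {X : Matrix (Fin n) (Fin n) ℝ} (h1 : ∀ i, X i i = 1)
    (h0 : ∀ i j : Fin n, (j : ℕ) < (i : ℕ) → X i j = 0) : IsUnit X.det := by
  have : X.BlockTriangular id := fun i j h => h0 i j h
  rw [Matrix.det_of_upperTriangular this]
  simp [h1]

lemma udu_unique {n : ℕ} {X X' : Matrix (Fin n) (Fin n) ℝ} {D D' : Fin n → ℝ}
    (h1 : ∀ i, X i i = 1) (h0 : ∀ i j : Fin n, (j : ℕ) < (i : ℕ) → X i j = 0)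
    (h1' : ∀ i, X' i i = 1) (h0' : ∀ i j : Fin n, (j : ℕ) < (i : ℕ) → X' i j = 0)
    (hD : ∀ i, 0 < D i)
    (h : X * diagonal D * Xᵀ = X' * diagonal D' * X'ᵀ) : X = X' ∧ D = D' := by
  have hX := det_unitri h1 h0
  have hX' := det_unitri h1' h0'
  have tX : X.BlockTriangular id := fun i j h => h0 i j h
  have tX' : X'.BlockTriangular id := fun i j h => h0' i j h
  letI := X.invertibleOfIsUnitDet hX
  letI := X'.invertibleOfIsUnitDet hX'
  have tA : (X'⁻¹ * X).BlockTriangular id :=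
    (Matrix.blockTriangular_inv_of_blockTriangular tX').mul tX
  have tB : (X⁻¹ * X').BlockTriangular id :=
    (Matrix.blockTriangular_inv_of_blockTriangular tX).mul tX'
  have e : (X'⁻¹ * X) * diagonal D = diagonal D' * (X⁻¹ * X')ᵀ := by
    have hXt : IsUnit Xᵀ.det := by simpa using hX
    calc (X'⁻¹ * X) * diagonal D = X'⁻¹ * (X * diagonal D * Xᵀ) * Xᵀ⁻¹ := by
          simp only [Matrix.mul_assoc, Matrix.mul_nonsing_inv _ hXt, Matrix.mul_one]
      _ = _ := by
          rw [h, Matrix.transpose_mul, Matrix.transpose_nonsing_inv]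
          simp only [← Matrix.mul_assoc, Matrix.nonsing_inv_mul _ hX', Matrix.one_mul]
  have dA : ∀ i j, i ≠ j → (X'⁻¹ * X) i j = 0 := by
    intro i j hij
    rcases lt_or_gt_of_ne hij with hlt | hgt
    · have := congrFun (congrFun e i) j
      rw [Matrix.mul_diagonal, Matrix.diagonal_mul, Matrix.transpose_apply, tB hlt, mul_zero] at this
      exact (mul_eq_zero.1 this).resolve_right (hD j).ne'
    · exact tA hgt
  have eX : X = X' * (X'⁻¹ * X) := by
    rw [← Matrix.mul_assoc, Matrix.mul_nonsing_inv _ hX', Matrix.one_mul]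
  have hA : (X'⁻¹ * X) = diagonal (fun i => (X'⁻¹ * X) i i) := by
    ext i j
    by_cases hij : i = j
    · subst hij; simp
    · simp [dA i j hij, hij]
  have hA1 : ∀ i, (X'⁻¹ * X) i i = 1 := by
    intro i
    have := congrFun (congrFun eX i) i
    rw [hA, Matrix.mul_diagonal, h1, h1', one_mul] at this
    exact this.symm
  have hXX : X = X' := by
    have hA2 : X'⁻¹ * X = 1 := by rw [hA]; simp [hA1]
    rw [eX, hA2, Matrix.mul_one]
  refine ⟨hXX, ?_⟩
  subst hXX
  rw [Matrix.nonsing_inv_mul _ hX] at e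
  funext i
  have e' := congrFun (congrFun e i) i
  simpa using e'

lemma gram_eq {n : ℕ} (c : ℝ) (X R : Matrix (Fin n) (Fin n) ℝ) (r : Fin n → ℝ) (hR : R * Rᵀ = 1) :
    (c • (X * diagonal r * R)) * (c • (X * diagonal r * R))ᵀ
      = X * diagonal (fun i => c ^ 2 * r i ^ 2) * Xᵀ := by
  have hd : diagonal (fun i => c ^ 2 * r i ^ 2) = (c * c) • (diagonal r * diagonal r) := by
    rw [Matrix.diagonal_mul_diagonal, ← Matrix.diagonal_smul]
    congr 1; ext i; simp; ring
  have : X * diagonal r * R * (X * diagonal r * R)ᵀ = X * (diagonal r * diagonal r) * Xᵀ := by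
    rw [Matrix.transpose_mul, Matrix.transpose_mul, Matrix.diagonal_transpose]
    calc _ = X * diagonal r * (R * Rᵀ) * (diagonal r * Xᵀ) := by simp only [Matrix.mul_assoc]
      _ = _ := by rw [hR]; simp only [Matrix.mul_assoc, Matrix.mul_one]
  rw [hd, Matrix.transpose_smul, Matrix.smul_mul, Matrix.mul_smul, this, smul_smul,
    Matrix.mul_smul, Matrix.smul_mul]

/-- Iwasawa decomposition with rational dependence on `t`. -/
lemma exists_decomp {n : ℕ} (h : ℝ → Matrix (Fin n) (Fin n) ℝ)
    (hr : ∀ i k, IsRat (fun t => h t i k)) (hu : ∀ t, 0 < t → IsUnit (h t)) :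
    ∃ (X : ℝ → Matrix (Fin n) (Fin n) ℝ) (r : ℝ → Fin n → ℝ) (R : ℝ → Matrix (Fin n) (Fin n) ℝ),
      (∀ i j, IsRat (fun t => X t i j)) ∧ (∀ i, IsRat (fun t => r t i ^ 2)) ∧
      ∀ t, 0 < t → (∀ i, X t i i = 1) ∧ (∀ i j : Fin n, (j : ℕ) < (i : ℕ) → X t i j = 0) ∧
        (∀ i, 0 < r t i) ∧ R t * (R t)ᵀ = 1 ∧ h t = X t * diagonal (r t) * R t := by
  let f : ℝ → (Fin n)ᵒᵈ → EuclideanSpace ℝ (Fin n) :=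
    fun t i => WithLp.toLp 2 (fun k => h t (OrderDual.ofDual i) k)
  have hli : ∀ t, 0 < t → LinearIndependent ℝ (f t) := by
    intro t ht
    have h1 : LinearIndependent ℝ (fun i => h t i) :=
      Matrix.linearIndependent_rows_iff_isUnit.2 (hu t ht)
    have h2 := h1.map' (WithLp.linearEquiv 2 ℝ (Fin n → ℝ)).symm.toLinearMap
      (LinearEquiv.ker _)
    exact h2
  have hf : ∀ i k, IsRat (fun t => f t i k) := fun i k => hr _ _
  let u : ℝ → Fin n → EuclideanSpace ℝ (Fin n) :=
    fun t i => InnerProductSpace.gramSchmidt ℝ (f t) (OrderDual.toDual i)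
  have hur : ∀ i k, IsRat (fun t => u t i k) := fun i k => isRat_gramSchmidt f hf hli _ k
  have hu0 : ∀ t, 0 < t → ∀ i, u t i ≠ 0 := fun t ht i =>
    InnerProductSpace.gramSchmidt_ne_zero _ (hli t ht)
  have horth : ∀ t i j, i ≠ j → inner ℝ (u t i) (u t j) = 0 := fun t i j hij =>
    InnerProductSpace.gramSchmidt_orthogonal ℝ (f t) (by simpa using hij)
  refine ⟨fun t => Matrix.of fun i j => if i < j then
      inner ℝ (u t j) (f t (OrderDual.toDual i)) / inner ℝ (u t j) (u t j)
      else if i = j then 1 else 0, fun t i => ‖u t i‖,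
      fun t => Matrix.of fun i k => u t i k / ‖u t i‖, ?_, ?_, ?_⟩
  · intro i j
    by_cases hij : i < j
    · simp only [Matrix.of_apply, hij, if_true]
      exact (isRat_inner (hur j) (hf _)).div (isRat_inner (hur j) (hur j))
        fun t ht => inner_self_ne_zero.2 (hu0 t ht j)
    · simp only [Matrix.of_apply, hij, if_false]
      exact IsRat.const _
  · intro i
    exact (isRat_inner (hur i) (hur i)).congr fun t _ => (real_inner_self_eq_norm_sq _).symm
  · intro t ht
    refine ⟨fun i => by simp, fun i j hij => ?_, fun i => norm_pos_iff.2 (hu0 t ht i), ?_, ?_⟩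
    · have h1 : ¬ i < j := by rw [Fin.lt_def]; omega
      have h2 : i ≠ j := by rintro rfl; omega
      simp [h1, h2]
    · ext i j
      have e : (∑ k, u t i k / ‖u t i‖ * (u t j k / ‖u t j‖))
          = inner ℝ (u t i) (u t j) / (‖u t i‖ * ‖u t j‖) := by
        rw [PiLp.inner_apply, Finset.sum_div]
        refine Finset.sum_congr rfl fun k _ => ?_
        rw [div_mul_div_comm]
        simp [mul_comm]
      rw [Matrix.mul_apply]
      simp only [Matrix.transpose_apply, Matrix.of_apply]
      rw [e]
      by_cases hij : i = j
      · subst hij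
        have := norm_ne_zero_iff.2 (hu0 t ht i)
        rw [real_inner_self_eq_norm_sq, Matrix.one_apply_eq]
        field_simp
      · rw [horth t i j hij, Matrix.one_apply_ne hij, zero_div]
    · ext i k
      have hgs := congrArg (fun v : EuclideanSpace ℝ (Fin n) => v k)
        (InnerProductSpace.gramSchmidt_def'' ℝ (f t) (OrderDual.toDual i))
      simp only [PiLp.add_apply, WithLp.ofLp_sum, Finset.sum_apply, PiLp.smul_apply,
        smul_eq_mul] at hgs
      have hL : (f t (OrderDual.toDual i)) k = h t i k := rfl
      rw [hL] at hgs
      rw [hgs, Matrix.mul_apply]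
      simp only [Matrix.mul_diagonal, Matrix.of_apply]
      have e : ∀ j, (if i < j then
          inner ℝ (u t j) (f t (OrderDual.toDual i)) / inner ℝ (u t j) (u t j)
          else if i = j then 1 else 0) * ‖u t j‖ * (u t j k / ‖u t j‖)
          = (if i = j then u t j k else 0) + (if i < j then
          inner ℝ (u t j) (f t (OrderDual.toDual i)) / ‖u t j‖ ^ 2 * u t j k else 0) := by
        intro j
        have hne := norm_ne_zero_iff.2 (hu0 t ht j)
        rw [real_inner_self_eq_norm_sq]
        rcases lt_trichotomy i j with hij | hij | hij
        · simp only [hij, hij.ne, if_true, if_false]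
          field_simp
          simp
        · subst hij
          simp only [lt_irrefl, if_true, if_false]
          field_simp
          simp
        · simp [hij.not_gt, hij.ne']
      rw [Finset.sum_congr rfl fun j _ => e j, Finset.sum_add_distrib, Finset.sum_ite_eq,
        ← Finset.sum_filter]
      simp only [Finset.mem_univ, if_true]
      congr 1
      refine Finset.sum_bij (fun j _ => OrderDual.ofDual j) ?_ ?_ ?_ ?_
      · intro j hj
        rw [Finset.mem_Iio] at hj
        exact Finset.mem_filter.2 ⟨Finset.mem_univ _, hj⟩
      · intro a _ b _ hab
        exact hab
      · intro b hb
        refine ⟨OrderDual.toDual b, ?_, rfl⟩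
        rw [Finset.mem_Iio]
        exact OrderDual.toDual_lt_toDual.2 (by simpa using hb)
      · intro j _
        rfl

/-- **The LLL-reduced set and the Siegel set are weakly `𝔊_{λ,d}`-convex**: for a partition
`n = n₁ + ⋯ + n_ρ` (encoded by the monotone block-assignment map `blk : Fin n → Fin ρ` with
fibers of cardinalities `nn i`), exponents `d : Fin ρ → ℕ`, and `g ∈ GL_n(ℝ)`, the set of
`t > 0` with `g·I_λ(t^{d₁},…,t^{d_ρ})` reduced is a union of finitely many intervals. -/
theorem stmt_11 (ω : ℝ) (hω : 3 / 4 ≤ ω) (hω1 : ω ≤ 1) (n : ℕ) (hn : 1 ≤ n)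
    (ρ : ℕ) (nn : Fin ρ → ℕ) (hnn : ∀ i, 1 ≤ nn i) (hsum : ∑ i, nn i = n)
    (d : Fin ρ → ℕ)
    (blk : Fin n → Fin ρ) (hmono : Monotone blk)
    (hcard : ∀ i, (Finset.univ.filter fun k => blk k = i).card = nn i)
    (g : Matrix (Fin n) (Fin n) ℝ) (hg : IsUnit g) :
    (∃ (m : ℕ) (I : Fin m → Set ℝ), (∀ a, (I a).OrdConnected) ∧
      {t : ℝ | 0 < t ∧ IsLLLReduced n ω
        (g * Matrix.diagonal fun k : Fin n => t ^ d (blk k))} = ⋃ a, I a) ∧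
    (∃ (m : ℕ) (I : Fin m → Set ℝ), (∀ a, (I a).OrdConnected) ∧
      {t : ℝ | 0 < t ∧ IsSiegelReduced n
        (g * Matrix.diagonal fun k : Fin n => t ^ d (blk k))} = ⋃ a, I a) := by
  let h : ℝ → Matrix (Fin n) (Fin n) ℝ :=
    fun t => g * Matrix.diagonal fun k : Fin n => t ^ d (blk k)
  have hr : ∀ i k, IsRat (fun t => h t i k) := by
    intro i k
    refine (IsRat.poly (Polynomial.C (g i k) * Polynomial.X ^ d (blk k))).congr fun t _ => ?_
    simp [h, Matrix.mul_diagonal]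
  have hu : ∀ t, 0 < t → IsUnit (h t) := by
    intro t ht
    refine hg.mul ?_
    rw [Matrix.isUnit_iff_isUnit_det, Matrix.det_diagonal, isUnit_iff_ne_zero]
    exact Finset.prod_ne_zero_iff.2 fun k _ => (pow_pos ht _).ne'
  obtain ⟨X, r, R, hX, hrr, hall⟩ := exists_decomp h hr hu
  have huniq : ∀ t, 0 < t → ∀ (c : ℝ) (X' : Matrix (Fin n) (Fin n) ℝ) (r' : Fin n → ℝ)
      (R' : Matrix (Fin n) (Fin n) ℝ), c ≠ 0 → (∀ i, X' i i = 1) →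
      (∀ i j : Fin n, (j : ℕ) < (i : ℕ) → X' i j = 0) → (∀ i, 0 < r' i) → R' * R'ᵀ = 1 →
      h t = c • (X' * Matrix.diagonal r' * R') →
      X' = X t ∧ ∀ i, r t i ^ 2 = c ^ 2 * r' i ^ 2 := by
    intro t ht c X' r' R' hc h1 h0 hp hR e
    obtain ⟨g1, g0, gp, gR, ge⟩ := hall t ht
    have e1 := gram_eq c X' R' r' hR
    have e2 := gram_eq 1 (X t) (R t) (r t) gR
    rw [one_smul, ← ge] at e2
    rw [← e, e2] at e1
    obtain ⟨a, b⟩ := udu_unique g1 g0 h1 h0 (fun i => by have := gp i; positivity) e1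
    refine ⟨a.symm, fun i => ?_⟩
    have := congrFun b i
    simpa using this
  let f1 : Fin n × Fin n → ℝ → ℝ := fun ij t =>
    if (ij.1 : ℕ) < ij.2 then 1 / 4 - X t ij.1 ij.2 * X t ij.1 ij.2 else 0
  have hf1 : ∀ k, IsRat (f1 k) := by
    rintro ⟨i, j⟩
    by_cases hij : (i : ℕ) < j
    · simp only [f1, hij, if_true]
      exact (IsRat.const _).sub ((hX i j).mul (hX i j))
    · simp only [f1, hij, if_false]
      exact IsRat.const _
  have hf1' : ∀ t, (∀ k, 0 ≤ f1 k t) ↔ ∀ i j : Fin n, (i : ℕ) < (j : ℕ) → |X t i j| ≤ 1 / 2 := by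
    intro t
    rw [Prod.forall]
    refine forall_congr' fun i => forall_congr' fun j => ?_
    by_cases hij : (i : ℕ) < j
    · simp only [f1, hij, if_true, true_imp_iff]
      rw [sub_nonneg, abs_le]
      constructor
      · intro h
        constructor <;> nlinarith
      · rintro ⟨h1, h2⟩
        nlinarith
    · simp only [f1, hij, if_false, false_imp_iff, le_refl]
  constructor
  · let f2 : {i : Fin n // (i : ℕ) + 1 < n} → ℝ → ℝ := fun i t =>
      r t i.1 ^ 2 + X t i.1 ⟨i.1 + 1, i.2⟩ * X t i.1 ⟨i.1 + 1, i.2⟩ * r t ⟨i.1 + 1, i.2⟩ ^ 2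
        - ω * r t ⟨i.1 + 1, i.2⟩ ^ 2
    have hf2 : ∀ k, IsRat (f2 k) := fun k =>
      ((hrr _).add (((hX _ _).mul (hX _ _)).mul (hrr _))).sub ((IsRat.const ω).mul (hrr _))
    obtain ⟨m, I, hI, hE⟩ := finUnion_rat (Sum.elim f1 f2) (by rintro (k | k); exacts [hf1 k, hf2 k])
    refine ⟨m, I, hI, ?_⟩
    rw [← hE]
    ext t
    simp only [Set.mem_ofPred_eq, Sum.forall, Sum.elim_inl, Sum.elim_inr, hf1']
    refine and_congr_right fun ht => ⟨?_, ?_⟩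
    · rintro ⟨c, X', r', R', hc, h1, h0, hp, hR, e, ha, hb⟩
      obtain ⟨rfl, e2⟩ := huniq t ht c X' r' R' hc h1 h0 hp hR e
      refine ⟨ha, ?_⟩
      rintro ⟨i, hi⟩
      have hb' := mul_le_mul_of_nonneg_left (hb i hi) (sq_nonneg c)
      simp only [f2, e2]
      change _ ≤ c ^ 2 * (r' i ^ 2 + X t i ⟨i + 1, hi⟩ ^ 2 * r' ⟨i + 1, hi⟩ ^ 2) at hb'
      linarith
    · rintro ⟨ha, hb⟩
      obtain ⟨g1, g0, gp, gR, ge⟩ := hall t ht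
      refine ⟨1, X t, r t, R t, one_ne_zero, g1, g0, gp, gR, ?_, ha, ?_⟩
      · rw [one_smul]; exact ge
      · intro i hi
        have := hb ⟨⟨i, by omega⟩, hi⟩
        simp only [f2] at this
        linarith
  · let f2 : {i : Fin n // (i : ℕ) + 1 < n} → ℝ → ℝ := fun i t =>
      r t i.1 ^ 2 - 3 / 4 * r t ⟨i.1 + 1, i.2⟩ ^ 2
    have hf2 : ∀ k, IsRat (f2 k) := fun k => (hrr _).sub ((IsRat.const _).mul (hrr _))
    have hs : ∀ a b : ℝ, 0 < a → 0 < b → (Real.sqrt 3 / 2 ≤ a / b ↔ 0 ≤ a ^ 2 - 3 / 4 * b ^ 2) := by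
      intro a b ha hb
      rw [le_div_iff₀ hb, ← sq_le_sq₀ (by positivity) ha.le, mul_pow, div_pow,
        Real.sq_sqrt (by norm_num), sub_nonneg]
      norm_num
    obtain ⟨m, I, hI, hE⟩ := finUnion_rat (Sum.elim f1 f2) (by rintro (k | k); exacts [hf1 k, hf2 k])
    refine ⟨m, I, hI, ?_⟩
    rw [← hE]
    ext t
    simp only [Set.mem_ofPred_eq, Sum.forall, Sum.elim_inl, Sum.elim_inr, hf1']
    refine and_congr_right fun ht => ⟨?_, ?_⟩
    · rintro ⟨c, X', r', R', hc, h1, h0, hp, hR, e, ha, hb⟩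
      obtain ⟨rfl, e2⟩ := huniq t ht c X' r' R' hc h1 h0 hp hR e
      refine ⟨ha, ?_⟩
      rintro ⟨i, hi⟩
      have hb' := mul_nonneg (sq_nonneg c) ((hs _ _ (hp _) (hp _)).1 (hb i hi))
      simp only [f2, e2]
      change 0 ≤ c ^ 2 * (r' i ^ 2 - 3 / 4 * r' ⟨i + 1, hi⟩ ^ 2) at hb'
      linarith
    · rintro ⟨ha, hb⟩
      obtain ⟨g1, g0, gp, gR, ge⟩ := hall t ht
      refine ⟨1, X t, r t, R t, one_ne_zero, g1, g0, gp, gR, ?_, ha, ?_⟩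
      · rw [one_smul]; exact ge
      · intro i hi
        exact (hs _ _ (gp _) (gp _)).2 (hb ⟨⟨i, by omega⟩, hi⟩)
end

section
/- Let p be a prime, ν ∈ ℤ, e ∈ ℕ, and let ũ ∈ ℤ_p^× and ũ' ∈ ℤ_p satisfy ũ·ũ' ≡ 1 (mod p^e·ℤ_p). Then [[0, −1], [1, 0]] · [[p^{e+ν}, p^ν·ũ], [0, 1]] ≡ [[p^{−ν}, 0], [0, 1]] · [[p^e, −ũ'], [0, 1]] (mod ℚ_p^×·GL_2(ℤ_p)). -/
open Matrix

/-- `M ≡ M' (mod ℚ_p^× · GL_2(ℤ_p))`: there are `c ∈ ℚ_p^×` and `R ∈ GL_2(ℤ_p)` with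
`M = c · M' · R`. -/
def padicUnitEquiv (p : ℕ) [Fact p.Prime] (M M' : Matrix (Fin 2) (Fin 2) ℚ_[p]) : Prop :=
  ∃ (c : ℚ_[p]) (R : Matrix (Fin 2) (Fin 2) ℤ_[p]),
    c ≠ 0 ∧ IsUnit R.det ∧ M = c • (M' * R.map ((↑) : ℤ_[p] → ℚ_[p]))

/-- **Lemma on the `p`-adic Iwasawa decomposition (inversion step).**
For `ũ ∈ ℤ_p^×` and `ũ'` with `ũ·ũ' ≡ 1 (mod p^e)`,
`[[0,-1],[1,0]]·[[p^{e+ν}, p^ν ũ],[0,1]] ≡ [[p^{-ν},0],[0,1]]·[[p^e, -ũ'],[0,1]]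
(mod ℚ_p^×·GL_2(ℤ_p))`. -/
theorem stmt_14 (p : ℕ) [Fact p.Prime] (ν : ℤ) (e : ℕ)
    (u u' : ℤ_[p]) (hu : IsUnit u) (huu' : (p : ℤ_[p]) ^ e ∣ u * u' - 1) :
    padicUnitEquiv p
      (!![0, -1; 1, 0] *
        !![(p : ℚ_[p]) ^ ((e : ℤ) + ν), (p : ℚ_[p]) ^ ν * (u : ℚ_[p]); 0, 1])
      (!![(p : ℚ_[p]) ^ (-ν), 0; 0, 1] *
        !![(p : ℚ_[p]) ^ (e : ℤ), -(u' : ℚ_[p]); 0, 1]) := by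
  obtain ⟨k, hk⟩ := huu'
  have hp : (p : ℚ_[p]) ≠ 0 := by
    exact_mod_cast (Fact.out : p.Prime).ne_zero
  have hν : (p : ℚ_[p]) ^ ν ≠ 0 := zpow_ne_zero _ hp
  have hk' : (u : ℚ_[p]) * u' - 1 = (p : ℚ_[p]) ^ e * k := by
    exact_mod_cast congrArg ((↑) : ℤ_[p] → ℚ_[p]) hk
  refine ⟨(p : ℚ_[p]) ^ ν, !![u', k; (p : ℤ_[p]) ^ e, u], hν, ?_, ?_⟩
  · have : (!![u', k; (p : ℤ_[p]) ^ e, u]).det = 1 := by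
      rw [Matrix.det_fin_two_of]
      linear_combination hk
    rw [this]
    exact isUnit_one
  · rw [zpow_add₀ hp, _root_.zpow_neg, zpow_natCast]
    have hR : (!![u', k; (p : ℤ_[p]) ^ e, u]).map ((↑) : ℤ_[p] → ℚ_[p]) =
        !![(u' : ℚ_[p]), (k : ℚ_[p]); (p : ℚ_[p]) ^ e, (u : ℚ_[p])] := by
      ext i j
      fin_cases i <;> fin_cases j
      · rfl
      · rfl
      · change (((p : ℤ_[p]) ^ e : ℤ_[p]) : ℚ_[p]) = (p : ℚ_[p]) ^ e
        push_cast
        rfl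
      · rfl
    rw [hR, Matrix.mul_fin_two, Matrix.mul_fin_two, Matrix.mul_fin_two]
    ext i j
    fin_cases i <;> fin_cases j
    · simp
      right; ring
    · simp
      field_simp
      linear_combination hk'
    · simp
      ring
    · simp
end

section
/- Let p be a prime, z ∈ ℤ_p, ν ∈ ℕ, and let a, b, c, d ∈ ℤ with a·d − b·c = 1 be such that c·z + d ≠ 0 and w := (a·z + b)/(c·z + d) ∈ ℤ_p. Then [[a, b], [c, d]] · [[p^ν, z], [0, 1]] ≡ [[p^ν, w], [0, 1]] (mod ℚ_p^×·GL_2(ℤ_p)). -/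
open Matrix

/-- **Lemma.** For `z ∈ ℤ_p` and `[[a,b],[c,d]] ∈ SL_2(ℤ)` with `w = (az+b)/(cz+d) ∈ ℤ_p`,
`[[a,b],[c,d]]·[[p^ν, z],[0,1]] ≡ [[p^ν, w],[0,1]] (mod ℚ_p^×·GL_2(ℤ_p))`. -/
theorem stmt_15 (p : ℕ) [Fact p.Prime] (z : ℤ_[p]) (ν : ℕ)
    (a b c d : ℤ) (hdet : a * d - b * c = 1)
    (hcd : (c : ℚ_[p]) * (z : ℚ_[p]) + (d : ℚ_[p]) ≠ 0)
    (w : ℚ_[p]) (hw : w = ((a : ℚ_[p]) * (z : ℚ_[p]) + (b : ℚ_[p])) /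
      ((c : ℚ_[p]) * (z : ℚ_[p]) + (d : ℚ_[p])))
    (hwint : ‖w‖ ≤ 1) :
    padicUnitEquiv p
      (!![(a : ℚ_[p]), (b : ℚ_[p]); (c : ℚ_[p]), (d : ℚ_[p])] *
        !![(p : ℚ_[p]) ^ ν, (z : ℚ_[p]); 0, 1])
      (!![(p : ℚ_[p]) ^ ν, w; 0, 1]) := by
  have hwu : w * ((c : ℚ_[p]) * (z : ℚ_[p]) + d) = a * z + b := by
    rw [hw]; exact div_mul_cancel₀ _ hcd
  have hdet' : (a : ℚ_[p]) * d - b * c = 1 := by exact_mod_cast hdet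
  obtain ⟨W, hW⟩ : ∃ W : ℤ_[p], (W : ℚ_[p]) = w := ⟨⟨w, hwint⟩, rfl⟩
  clear hw
  subst hW
  have key : ((a : ℤ_[p]) - W * c) * (c * z + d) = 1 := by
    apply Subtype.ext
    push_cast
    linear_combination hdet' - (c : ℚ_[p]) * hwu
  refine ⟨1, !![(a : ℤ_[p]) - W * c, 0; c * (p : ℤ_[p]) ^ ν, c * z + d], one_ne_zero, ?_, ?_⟩
  · rw [Matrix.det_fin_two_of, key]
    simp
  · have hmap : (!![(a : ℤ_[p]) - W * c, 0; c * (p : ℤ_[p]) ^ ν, c * z + d]).map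
        ((↑) : ℤ_[p] → ℚ_[p]) =
        !![(a : ℚ_[p]) - W * c, 0; c * (p : ℚ_[p]) ^ ν, c * z + d] := by
      ext i j
      fin_cases i <;> fin_cases j
      · change (((a : ℤ_[p]) - W * c : ℤ_[p]) : ℚ_[p]) = (a : ℚ_[p]) - W * c
        push_cast; rfl
      · rfl
      · change ((c * (p : ℤ_[p]) ^ ν : ℤ_[p]) : ℚ_[p]) = c * (p : ℚ_[p]) ^ ν
        push_cast; rfl
      · change ((c * z + d : ℤ_[p]) : ℚ_[p]) = c * z + d
        push_cast; rfl
    rw [one_smul]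
    refine Eq.trans ?_ (congrArg (fun X => !![(p : ℚ_[p]) ^ ν, (W : ℚ_[p]); 0, 1] * X) hmap.symm)
    ext i j
    fin_cases i <;> fin_cases j <;> simp
    · ring
    · linear_combination -hwu
end

section
/- Let p be a prime and let w_1, w_2, w_1', w_2' ∈ ℚ_p with w_2 ≠ 0, w_2' ≠ 0 and w_1·w_2' − w_1'·w_2 ≠ 0. Let α = v_p(w_2) and β = v_p(w_2'), and let ν ∈ ℤ. Then: (i) [[w_1, p^ν·w_1'], [w_2, p^ν·w_2']] ≡ [[w_1/w_2, p^{ν−α+β}·(w_1'/w_2')], [1, p^{ν−α+β}]] (mod ℚ_p^×·GL_2(ℤ_p)); (ii) if moreover ν − α + β ≥ 0, then [[w_1, p^ν·w_1'], [w_2, p^ν·w_2']] ≡ [[p^{ν−α+β+γ}, w_1/w_2], [0, 1]] (mod ℚ_p^×·GL_2(ℤ_p)), where γ = v_p(w_1/w_2 − w_1'/w_2') (note w_1/w_2 − w_1'/w_2' ≠ 0 by the determinant hypothesis). -/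
open Matrix

theorem padicUnitEquiv_of_entries (p : ℕ) [Fact p.Prime] (a b c d a' b' c' d' k : ℚ_[p])
    (x y z w : ℤ_[p]) (hk : k ≠ 0) (hu : IsUnit (x * w - y * z))
    (h1 : a = k * (a' * (x : ℚ_[p]) + b' * (z : ℚ_[p])))
    (h2 : b = k * (a' * (y : ℚ_[p]) + b' * (w : ℚ_[p])))
    (h3 : c = k * (c' * (x : ℚ_[p]) + d' * (z : ℚ_[p])))
    (h4 : d = k * (c' * (y : ℚ_[p]) + d' * (w : ℚ_[p]))) :
    padicUnitEquiv p !![a, b; c, d] !![a', b'; c', d'] := by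
  refine ⟨k, !![x, y; z, w], hk, ?_, ?_⟩
  · rwa [Matrix.det_fin_two_of]
  · ext i j
    rw [Matrix.smul_apply, Matrix.mul_apply, Fin.sum_univ_two]
    fin_cases i <;> fin_cases j
    · exact h1
    · exact h2
    · exact h3
    · exact h4

theorem exists_unit_decomp (p : ℕ) [Fact p.Prime] (x : ℚ_[p]) (hx : x ≠ 0) :
    ∃ u : ℤ_[p]ˣ, x = (p : ℚ_[p]) ^ x.valuation * ((u : ℤ_[p]) : ℚ_[p]) := by
  have hp : (p : ℚ_[p]) ≠ 0 := by exact_mod_cast (Fact.out : p.Prime).ne_zero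
  have hpr : (p : ℝ) ≠ 0 := by exact_mod_cast (Fact.out : p.Prime).ne_zero
  have hn : ‖(p : ℚ_[p]) ^ (-x.valuation) * x‖ = 1 := by
    rw [norm_mul, Padic.norm_p_zpow, Padic.norm_eq_zpow_neg_valuation hx, ← zpow_add₀ hpr]
    simp
  refine ⟨PadicInt.mkUnits hn, ?_⟩
  rw [PadicInt.mkUnits_eq, ← mul_assoc, ← zpow_add₀ hp]
  simp

/-- **Lemma (reduction of a `p`-adic frame).**
With `α = v_p(w₂)`, `β = v_p(w₂')`:
(i) `[[w₁, p^ν w₁'],[w₂, p^ν w₂']] ≡ [[w₁/w₂, p^{ν-α+β}(w₁'/w₂')],[1, p^{ν-α+β}]]`;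
(ii) if `ν - α + β ≥ 0`, then it is also `≡ [[p^{ν-α+β+γ}, w₁/w₂],[0,1]]`, where
`γ = v_p(w₁/w₂ - w₁'/w₂')`. -/
theorem stmt_16 (p : ℕ) [Fact p.Prime] (w₁ w₂ w₁' w₂' : ℚ_[p])
    (h2 : w₂ ≠ 0) (h2' : w₂' ≠ 0) (hdet : w₁ * w₂' - w₁' * w₂ ≠ 0)
    (α β : ℤ) (hα : α = w₂.valuation) (hβ : β = w₂'.valuation) (ν : ℤ) :
    padicUnitEquiv p
      (!![w₁, (p : ℚ_[p]) ^ ν * w₁'; w₂, (p : ℚ_[p]) ^ ν * w₂'])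
      (!![w₁ / w₂, (p : ℚ_[p]) ^ (ν - α + β) * (w₁' / w₂');
          1, (p : ℚ_[p]) ^ (ν - α + β)]) ∧
    (0 ≤ ν - α + β →
      padicUnitEquiv p
        (!![w₁, (p : ℚ_[p]) ^ ν * w₁'; w₂, (p : ℚ_[p]) ^ ν * w₂'])
        (!![(p : ℚ_[p]) ^ (ν - α + β + (w₁ / w₂ - w₁' / w₂').valuation), w₁ / w₂;
            0, 1])) := by
  have hp : (p : ℚ_[p]) ≠ 0 := by exact_mod_cast (Fact.out : p.Prime).ne_zero
  have hd : w₁ / w₂ - w₁' / w₂' ≠ 0 := by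
    rw [div_sub_div _ _ h2 h2']
    refine div_ne_zero ?_ (mul_ne_zero h2 h2')
    rwa [mul_comm w₂ w₁']
  obtain ⟨u, hu⟩ := exists_unit_decomp p w₂ h2
  obtain ⟨u', hu'⟩ := exists_unit_decomp p w₂' h2'
  obtain ⟨e, he⟩ := exists_unit_decomp p _ hd
  rw [← hα] at hu
  rw [← hβ] at hu'
  obtain ⟨r, hr⟩ : ∃ r : ℤ_[p]ˣ, r * u = u' := ⟨u' * u⁻¹, by simp⟩
  have hr' : ((r : ℤ_[p]) : ℚ_[p]) * ((u : ℤ_[p]) : ℚ_[p]) = ((u' : ℤ_[p]) : ℚ_[p]) := by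
    rw [← hr]; push_cast; rfl
  -- the key relation between the second-row entries
  have key : (p : ℚ_[p]) ^ ν * w₂' = w₂ * ((p : ℚ_[p]) ^ (ν - α + β) * ((r : ℤ_[p]) : ℚ_[p])) := by
    have h : (p : ℚ_[p]) ^ (ν - α + β) * (p : ℚ_[p]) ^ α = (p : ℚ_[p]) ^ ν * (p : ℚ_[p]) ^ β := by
      rw [← zpow_add₀ hp, ← zpow_add₀ hp]; congr 1; ring
    rw [hu, hu', ← hr']
    linear_combination (-((r : ℤ_[p]) : ℚ_[p]) * ((u : ℤ_[p]) : ℚ_[p])) * h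
  have key' : (p : ℚ_[p]) ^ ν * w₁' =
      w₂ * ((p : ℚ_[p]) ^ (ν - α + β) * ((r : ℤ_[p]) : ℚ_[p])) * (w₁' / w₂') := by
    rw [← key]; field_simp
  constructor
  · refine padicUnitEquiv_of_entries p _ _ _ _ _ _ _ _ w₂ 1 0 0 r h2 (by simp) ?_ ?_ ?_ ?_
    · push_cast; field_simp; ring
    · rw [key']; push_cast; ring
    · push_cast; ring
    · rw [key]; push_cast; ring
  · intro hn
    obtain ⟨n, hn'⟩ := Int.eq_ofNat_of_zero_le hn
    rw [zpow_add₀ hp]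
    rw [hn', zpow_natCast] at key key' ⊢
    refine padicUnitEquiv_of_entries p _ _ _ _ _ _ _ _ w₂ 0 (-((r : ℤ_[p]) * (e : ℤ_[p]))) 1
      ((p : ℤ_[p]) ^ n * (r : ℤ_[p])) h2 (by simp) ?_ ?_ ?_ ?_
    · push_cast
      rw [mul_zero, zero_add, mul_one, mul_div_cancel₀ _ h2]
    · rw [key']
      push_cast
      linear_combination (-w₂ * (p : ℚ_[p]) ^ n * ((r : ℤ_[p]) : ℚ_[p])) * he
    · push_cast; ring
    · rw [key]; push_cast; ring
end

section
/- Let d be a positive squarefree integer, F = ℚ(√−d) the corresponding imaginary quadratic field with ring of integers O_F, and let p be a prime that splits completely in F/ℚ, with (p) = 𝔭·𝔭̄ for distinct prime ideals 𝔭, 𝔭̄ of O_F. Let N be a positive integer and u ∈ O_F with u·O_F = 𝔭^{2N} (as ideals), and suppose that ε = u/p^N generates the group {x ∈ O_F[1/p]^× : N_{F/ℚ}(x) = 1} modulo its torsion subgroup (i.e. the image of ε generates the quotient of this group by its torsion subgroup, a rank-one free abelian group). Then: if there exists x ∈ O_F such that u/x² is a root of unity in F, the order of the ideal class [𝔭]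 in the ideal class group of O_F equals N; otherwise, the order of [𝔭] equals 2N. -/
open NumberField in
lemma aux_unit_torsion (d : ℕ) (hd : 0 < d) (F : Type*) [Field F] [NumberField F]
    (hdeg : Module.finrank ℚ F = 2) (α : F) (hα : α ^ 2 = -(d : F)) (v : (𝓞 F)ˣ) :
    ∃ m : ℕ+, ((v : 𝓞 F) : F) ^ (m : ℕ) = 1 := by
  have hc : IsTotallyComplex F := by
    refine ⟨fun w => ?_⟩
    rw [← InfinitePlace.not_isReal_iff_isComplex]
    intro hw
    have h := congrArg (InfinitePlace.embedding_of_isReal hw) hα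
    simp only [map_pow, map_neg, map_natCast] at h
    have h1 : (0 : ℝ) < d := by exact_mod_cast hd
    nlinarith [sq_nonneg (InfinitePlace.embedding_of_isReal hw α)]
  have hr : Units.rank F = 0 := by
    have h1 := IsTotallyComplex.finrank F
    have h2 := InfinitePlace.card_eq_nrRealPlaces_add_nrComplexPlaces F
    have h3 := IsTotallyComplex.nrRealPlaces_eq_zero F
    unfold Units.rank
    omega
  obtain ⟨⟨ζ, e⟩, hx, -⟩ := Units.exist_unique_eq_mul_prod F v
  have : IsEmpty (Fin (Units.rank F)) := by rw [hr]; infer_instance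
  simp only [Finset.univ_eq_empty, Finset.prod_empty, mul_one] at hx
  have ht : v ∈ Units.torsion F := hx ▸ ζ.2
  obtain ⟨n, hn, h⟩ := isOfFinOrder_iff_pow_eq_one.1 (CommGroup.mem_torsion _ |>.1 ht)
  refine ⟨⟨n, hn⟩, ?_⟩
  have := congrArg (fun z : (𝓞 F)ˣ => ((z : 𝓞 F) : F)) h
  simpa using this

lemma aux_pow_eq {R : Type*} [CommRing R] [IsDedekindDomain R] (P P' : Ideal R)
    (hP0 : P ≠ ⊥) (hP0' : P' ≠ ⊥)
    (hP : P.IsPrime) (hP' : P'.IsPrime) (hPP' : P ≠ P') (a b c e : ℕ)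
    (h : P ^ a * P' ^ b = P ^ c * P' ^ e) : b = e := by
  have key : ∀ a b c e : ℕ, P ^ a * P' ^ b = P ^ c * P' ^ e → ¬ b < e := by
    intro a b c e h hlt
    obtain ⟨t, rfl⟩ := Nat.exists_eq_add_of_lt hlt
    have h1 : P' ^ b * P ^ a = P' ^ b * (P ^ c * P' ^ (t + 1)) := by
      rw [mul_comm, h]; ring
    have h2 := mul_left_cancel₀ (pow_ne_zero b hP0') h1
    have h3 : P' ∣ P ^ a := by
      rw [h2]; exact Dvd.dvd.mul_left (dvd_pow_self _ (by omega)) _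
    have h4 := Ideal.IsPrime.le_of_pow_le (I := P) (hP := hP') (Ideal.le_of_dvd h3)
    exact hPP' ((hP.isMaximal hP0).eq_of_le hP'.ne_top h4)
  have h1 := key a b c e h
  have h2 := key c e a b h.symm
  omega

lemma aux_sq_eq {R : Type*} [CommRing R] [IsDedekindDomain R] (I P : Ideal R)
    (hP0 : P ≠ ⊥) (hP : P.IsPrime) (N : ℕ)
    (h : I ^ 2 = P ^ (2 * N)) : I = P ^ N := by
  have hpr : Prime P := Ideal.prime_of_isPrime hP0 hP
  have h1 : I ∣ P ^ (2 * N) := h ▸ dvd_pow_self I two_ne_zero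
  obtain ⟨i, -, hi⟩ := (dvd_prime_pow hpr _).1 h1
  rw [associated_iff_eq] at hi
  subst hi
  rw [← pow_mul] at h
  have := (Ideal.pow_right_strictAnti P hP0 hP.ne_top).injective h
  have : i = N := by omega
  rw [this]


/-- **Theorem (order of the ideal class `[𝔭]`).**
Let `F = ℚ(√-d)` be imaginary quadratic, `p` a prime splitting completely in `F`, with
`(p) = 𝔭·𝔭̄`.  If `u·O_F = 𝔭^{2N}` and `ε = u/p^N` is a fundamental norm-one `p`-unit of `F`
(a generator modulo torsion of the norm-one `p`-unit group), then the order of the ideal class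
`[𝔭]` is `N` if `u/x²` is a root of unity for some `x ∈ O_F`, and `2N` otherwise.
(Here "the order of `[𝔭]` equals `M`" is expressed as: `𝔭^k` is principal iff `M ∣ k`.) -/
theorem stmt_17 (d : ℕ) (hd : 0 < d) (hdsf : Squarefree d)
    (F : Type*) [Field F] [NumberField F]
    (hdeg : Module.finrank ℚ F = 2)
    (α : F) (hα : α ^ 2 = -(d : F))
    (p : ℕ) (hp : p.Prime)
    (P P' : Ideal (NumberField.RingOfIntegers F))
    (hP : P.IsPrime) (hP' : P'.IsPrime) (hPP' : P ≠ P')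
    (hfac : Ideal.span {(p : NumberField.RingOfIntegers F)} = P * P')
    (N : ℕ) (hN : 0 < N)
    (u : NumberField.RingOfIntegers F)
    (hu : Ideal.span {u} = P ^ (2 * N))
    -- O_F[1/p] as a subset of F
    (Rset : Set F)
    (hRset : Rset = {x | ∃ (y : NumberField.RingOfIntegers F) (k : ℕ),
      x = (y : F) / (p : F) ^ k})
    -- the norm-one p-unit group
    (G : Set F)
    (hG : G = {x ∈ Rset | (∃ y ∈ Rset, x * y = 1) ∧ Algebra.norm ℚ x = 1})
    (ε : F) (hε : ε = (u : F) / (p : F) ^ N)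
    (hεG : ε ∈ G)
    -- ε generates G modulo torsion
    (hgen : ∀ x ∈ G, ∃ (ζ : F) (k : ℤ), (∃ m : ℕ+, ζ ^ (m : ℕ) = 1) ∧ x = ζ * ε ^ k) :
    ((∃ (x : NumberField.RingOfIntegers F) (ζ : F),
        (∃ m : ℕ+, ζ ^ (m : ℕ) = 1) ∧ (u : F) = ζ * (x : F) ^ 2) →
      ∀ k : ℕ, (P ^ k).IsPrincipal ↔ N ∣ k) ∧
    (¬(∃ (x : NumberField.RingOfIntegers F) (ζ : F),
        (∃ m : ℕ+, ζ ^ (m : ℕ) = 1) ∧ (u : F) = ζ * (x : F) ^ 2) →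
      ∀ k : ℕ, (P ^ k).IsPrincipal ↔ 2 * N ∣ k) := by
  have hp0 : (p : F) ≠ 0 := by exact_mod_cast hp.ne_zero
  have hpO : (p : NumberField.RingOfIntegers F) ≠ 0 := by exact_mod_cast hp.ne_zero
  have hPP0 : P * P' ≠ ⊥ := by
    rw [← hfac]; simpa [Ideal.span_singleton_eq_bot] using hp.ne_zero
  have hP0 : P ≠ ⊥ := by rintro rfl; simp at hPP0
  have hP0' : P' ≠ ⊥ := by rintro rfl; simp at hPP0
  -- the absolute norm of `P` is `p`
  have hnormP : Ideal.absNorm P = p := by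
    have h1 : Algebra.norm ℚ ε = 1 := by
      rw [hG] at hεG; exact hεG.2.2
    have h2 : Algebra.norm ℚ (u : F) = (p : ℚ) ^ (2 * N) := by
      have h3 : (u : F) = ε * algebraMap ℚ F ((p : ℚ) ^ N) := by
        rw [hε]; simp; field_simp
      rw [h3, map_mul, h1, Algebra.norm_algebraMap, hdeg, one_mul, ← pow_mul, mul_comm]
    have h3 : Algebra.norm ℤ u = (p : ℤ) ^ (2 * N) := by
      have := Algebra.coe_norm_int u
      rw [h2] at this
      exact_mod_cast this
    have h4 := congrArg Ideal.absNorm hu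
    rw [Ideal.absNorm_span_singleton, h3, map_pow, Int.natAbs_pow, Int.natAbs_natCast] at h4
    exact (Nat.pow_left_injective (n := 2 * N) (by omega) h4).symm
  have hpow : ∀ k : ℕ, Ideal.span {(p : NumberField.RingOfIntegers F) ^ k} = P ^ k * P' ^ k := by
    intro k
    rw [← Ideal.span_singleton_pow, hfac, mul_pow]
  -- roots of unity are units
  have hroot : ∀ ζ : F, (∃ m : ℕ+, ζ ^ (m : ℕ) = 1) →
      ∃ v : (NumberField.RingOfIntegers F)ˣ, ((v : NumberField.RingOfIntegers F) : F) = ζ := by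
    rintro ζ ⟨m, hm⟩
    have hint : IsIntegral ℤ ζ := IsIntegral.of_pow m.pos (by rw [hm]; exact isIntegral_one)
    let z : NumberField.RingOfIntegers F := ⟨ζ, hint⟩
    have hz : z ^ (m : ℕ) = 1 := by
      apply NumberField.RingOfIntegers.ext
      exact hm
    exact ⟨(IsUnit.of_pow_eq_one hz m.ne_zero).unit, rfl⟩
  -- the main divisibility
  have hdvd : ∀ k : ℕ, (P ^ k).IsPrincipal → N ∣ k := by
    rintro k ⟨a, ha⟩
    rw [Ideal.submodule_span_eq] at ha
    have hpk : a ∣ (p : NumberField.RingOfIntegers F) ^ k := by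
      rw [← Ideal.span_singleton_le_span_singleton, hpow, ← ha]
      exact Ideal.mul_le_left
    obtain ⟨b, hb⟩ := hpk
    have hbF : (p : F) ^ k = (a : F) * (b : F) := by
      have := congrArg (fun z : NumberField.RingOfIntegers F => (z : F)) hb
      simpa using this
    have ha0 : (a : F) ≠ 0 := by
      intro h; rw [h, zero_mul] at hbF; exact pow_ne_zero k hp0 hbF
    have hxG : (a : F) ^ 2 / (p : F) ^ k ∈ G := by
      rw [hG, hRset]
      refine ⟨⟨a ^ 2, k, by simp⟩, ⟨(b : F) ^ 2 / (p : F) ^ k, ⟨b ^ 2, k, by simp⟩, ?_⟩, ?_⟩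
      · have h0 := pow_ne_zero k hp0
        field_simp
        rw [hbF]; ring
      · have h1 := congrArg Ideal.absNorm ha
        rw [Ideal.absNorm_span_singleton, map_pow, hnormP] at h1
        have h2 : (Algebra.norm ℤ a) ^ 2 = ((p : ℤ) ^ k) ^ 2 := by
          rw [← Int.natAbs_sq, ← h1]; push_cast; ring
        have h3 : (Algebra.norm ℚ (a : F)) ^ 2 = ((p : ℚ) ^ k) ^ 2 := by
          rw [← Algebra.coe_norm_int]; exact_mod_cast h2
        have h4 : (p : F) ^ k = algebraMap ℚ F ((p : ℚ) ^ k) := by simp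
        have h5 : ((p : ℚ) ^ k) ^ 2 ≠ 0 := by
          have : (p : ℚ) ≠ 0 := by exact_mod_cast hp.ne_zero
          positivity
        have h6 : (a : F) ^ 2 / (p : F) ^ k * algebraMap ℚ F ((p : ℚ) ^ k) = (a : F) ^ 2 := by
          rw [← h4]; exact div_mul_cancel₀ _ (pow_ne_zero k hp0)
        have h7 := congrArg (Algebra.norm ℚ) h6
        rw [map_mul, Algebra.norm_algebraMap, hdeg, map_pow (Algebra.norm ℚ) (a : F), h3] at h7
        exact mul_right_cancel₀ h5 (h7.trans (one_mul _).symm)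
    obtain ⟨ζ, j, hζ, hj⟩ := hgen _ hxG
    obtain ⟨v, hv⟩ := hroot ζ hζ
    have hvspan : Ideal.span {(v : NumberField.RingOfIntegers F)} = 1 := by
      rw [Ideal.one_eq_top]; exact Ideal.span_singleton_eq_top.2 v.isUnit
    have hu0 : (u : F) ≠ 0 := by
      intro h
      have h' : u = 0 := by exact_mod_cast h
      rw [h', Ideal.span_singleton_eq_bot.2 rfl] at hu
      exact pow_ne_zero _ hP0 hu.symm
    obtain ⟨m, rfl | rfl⟩ := j.eq_nat_or_neg
    · have e1 : a ^ 2 * (p : NumberField.RingOfIntegers F) ^ (N * m)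
          = v * u ^ m * (p : NumberField.RingOfIntegers F) ^ k := by
        apply NumberField.RingOfIntegers.ext
        rw [← hv, hε, zpow_natCast, div_pow, ← pow_mul] at hj
        simp only [map_mul, map_pow, map_natCast]
        have h0 := pow_ne_zero k hp0
        have h0' := pow_ne_zero (N * m) hp0
        field_simp at hj
        linear_combination hj
      have e2 := congrArg (fun z => Ideal.span {z}) e1
      simp only [← Ideal.span_singleton_mul_span_singleton, hpow, hvspan, one_mul] at e2
      simp only [← Ideal.span_singleton_pow, hu, ← ha] at e2
      have e3 : P ^ (k * 2 + N * m) * P' ^ (N * m) = P ^ (2 * N * m + k) * P' ^ k := by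
        rw [pow_add, pow_add, pow_mul, pow_mul P (2 * N) m, mul_assoc, mul_assoc]; exact e2
      exact ⟨m, (aux_pow_eq P P' hP0 hP0' hP hP' hPP' _ _ _ _ e3).symm⟩
    · have e1 : a ^ 2 * u ^ m
          = v * (p : NumberField.RingOfIntegers F) ^ (N * m + k) := by
        apply NumberField.RingOfIntegers.ext
        rw [← hv, hε, zpow_neg, zpow_natCast, div_pow, ← pow_mul, inv_div] at hj
        simp only [map_mul, map_pow, map_natCast]
        have h0 := pow_ne_zero k hp0
        have h0' := pow_ne_zero (N * m) hp0
        have h1 := pow_ne_zero m hu0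
        field_simp at hj
        rw [pow_add]
        linear_combination hj
      have e2 := congrArg (fun z => Ideal.span {z}) e1
      simp only [← Ideal.span_singleton_mul_span_singleton, hpow, hvspan, one_mul] at e2
      simp only [← Ideal.span_singleton_pow, hu, ← ha] at e2
      have e3 : P ^ (k * 2 + 2 * N * m) * P' ^ 0 = P ^ (N * m + k) * P' ^ (N * m + k) := by
        rw [pow_zero, mul_one, pow_add, pow_mul, pow_mul P (2 * N) m]; exact e2
      have := aux_pow_eq P P' hP0 hP0' hP hP' hPP' _ _ _ _ e3
      have : k = 0 := by omega
      rw [this]; exact dvd_zero N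
  constructor
  · rintro ⟨x, ζ, hζ, hx⟩ k
    refine ⟨hdvd k, ?_⟩
    rintro ⟨t, rfl⟩
    obtain ⟨v, hv⟩ := hroot ζ hζ
    have e1 : u = v * x ^ 2 := by
      apply NumberField.RingOfIntegers.ext
      rw [hx, ← hv]; simp
    have e2 : Ideal.span {x} ^ 2 = P ^ (2 * N) := by
      rw [← hu, e1, Ideal.span_singleton_pow, Ideal.span_singleton_mul_left_unit v.isUnit]
    have e3 := aux_sq_eq _ P hP0 hP N e2
    refine ⟨x ^ t, ?_⟩
    rw [Ideal.submodule_span_eq, ← Ideal.span_singleton_pow, e3, pow_mul]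
  · intro hno k
    constructor
    · intro hk
      obtain ⟨m, rfl⟩ := hdvd k hk
      obtain ⟨t, rfl | rfl⟩ := m.even_or_odd'
      · exact ⟨t, by ring⟩
      · exfalso
        obtain ⟨a, ha⟩ := hk
        rw [Ideal.submodule_span_eq] at ha
        have e0 : P ^ (N * (2 * t + 1)) = Ideal.span {u ^ t} * P ^ N := by
          rw [← Ideal.span_singleton_pow, hu]; ring
        have h1 : u ^ t ∣ a := by
          rw [← Ideal.span_singleton_le_span_singleton, ← ha, e0]
          exact Ideal.mul_le_left
        obtain ⟨b, rfl⟩ := h1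
        rw [e0, ← Ideal.span_singleton_mul_span_singleton] at ha
        have hut : Ideal.span {u ^ t} ≠ ⊥ := by
          rw [← Ideal.span_singleton_pow, hu]; exact pow_ne_zero _ (pow_ne_zero _ hP0)
        have hb := mul_left_cancel₀ hut ha
        have h2 : Ideal.span {b ^ 2} = Ideal.span {u} := by
          rw [← Ideal.span_singleton_pow, ← hb, hu]; ring
        obtain ⟨v, hv⟩ := Ideal.span_singleton_eq_span_singleton.1 h2
        refine hno ⟨b, ((v : NumberField.RingOfIntegers F) : F),
          aux_unit_torsion d hd F hdeg α hα v, ?_⟩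
        rw [← hv]; simp [mul_comm]
    · rintro ⟨t, rfl⟩
      refine ⟨u ^ t, ?_⟩
      rw [Ideal.submodule_span_eq, ← Ideal.span_singleton_pow, hu, pow_mul]
end

section
/- Let d be a positive squarefree integer with −d ≢ 1 (mod 4), let F = ℚ(√−d) with ring of integers O_F = ℤ[√−d], and let p be a prime that splits completely in F/ℚ. Let N be a positive integer and s, t relatively prime integers with t² + d·s² = p^{2N}, and suppose that ε = (t + s·√−d)/p^N generates the group {x ∈ O_F[1/p]^× : N_{F/ℚ}(x) = 1} modulo its torsion subgroup. Then for relatively prime integers x, y and ν ∈ ℕ, the equation x² + d·y² = p^{2ν} holds if and only if there exist a root of unity ζ ∈ F, an integer r ≥ 0, and a choice of sign ± such that ν = r·N and x + y·√−d = ζ·(t ± s·√−d)^r. -/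
theorem normAux (d : ℕ) (hd : 0 < d) (F : Type*) [Field F] [NumberField F]
    (hdeg : Module.finrank ℚ F = 2) (α : F) (hα : α ^ 2 = -(d : F)) (a b : ℚ) :
    Algebra.norm ℚ ((a : F) + (b : F) * α) = a ^ 2 + d * b ^ 2 := by
  have hli : LinearIndependent ℚ ![(1 : F), α] := by
    rw [LinearIndependent.pair_iff]
    intro u v h
    simp only [Algebra.smul_def, eq_ratCast, mul_one] at h
    have h2 : ((u ^ 2 + d * v ^ 2 : ℚ) : F) = 0 := by
      push_cast
      linear_combination (u - v * α : F) * h + (v : F) ^ 2 * hα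
    have h3 : u ^ 2 + d * v ^ 2 = 0 := by exact_mod_cast h2
    have hd' : (0 : ℚ) < d := by exact_mod_cast hd
    have hv : v = 0 := by
      by_contra hv
      have : 0 < v ^ 2 := by positivity
      nlinarith [sq_nonneg u, mul_pos hd' this]
    subst hv
    refine ⟨?_, rfl⟩
    simpa using h3
  let B := basisOfLinearIndependentOfCardEqFinrank hli (by simp [hdeg])
  have hB0 : B 0 = 1 := by simp [B]
  have hB1 : B 1 = α := by simp [B]
  have key : ∀ u v : ℚ, B.repr ((u : F) + (v : F) * α) = Finsupp.single 0 u + Finsupp.single 1 v := by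
    intro u v
    have : ((u : F) + (v : F) * α) = u • B 0 + v • B 1 := by
      rw [hB0, hB1]; simp [Algebra.smul_def]
    rw [this]; simp
  rw [Algebra.norm_eq_matrix_det B, Matrix.det_fin_two]
  simp only [Algebra.leftMulMatrix_eq_repr_mul, hB0, hB1]
  have e1 : ((a : F) + (b : F) * α) * α = ((-(d * b) : ℚ) : F) + (a : F) * α := by
    push_cast
    linear_combination (b : F) * hα
  rw [e1, mul_one, key, key]
  simp
  ring

theorem coreAux (d : ℕ) (hdsf : Squarefree d) (hmod : ¬((4 : ℤ) ∣ (-(d : ℤ) - 1)))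
    (p : ℕ) (hp : p.Prime) (n : ℕ) (hn : 0 < n) (x y : ℤ) (hxy : IsCoprime x y)
    (h : x ^ 2 + (d : ℤ) * y ^ 2 = (p : ℤ) ^ (2 * n)) (m : ℕ) :
    ¬ (((p : ℤ) : ℤ√(-(d : ℤ))) ∣ (⟨x, y⟩ : ℤ√(-(d : ℤ))) ^ m) := by
  have hpi : Prime (p : ℤ) := Nat.prime_iff_prime_int.mp hp
  have hp2 : (p : ℤ) ^ 2 ∣ x ^ 2 + (d : ℤ) * y ^ 2 := by
    rw [h]; exact pow_dvd_pow _ (by omega)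
  have hpne : p ≠ 2 := by
    rintro rfl
    have h4 : ¬ (4 : ℤ) ∣ d := by
      intro h4
      have h4' : 2 * 2 ∣ d := by
        have : (4 : ℕ) ∣ d := by exact_mod_cast h4
        simpa using this
      have := hdsf 2 h4'
      simp at this
    have hp4 : (4 : ℤ) ∣ x ^ 2 + (d : ℤ) * y ^ 2 := by simpa using hp2
    have hne : ¬ (2 ∣ x ∧ 2 ∣ y) := by
      rintro ⟨h1, h2⟩
      have := hxy.isUnit_of_dvd' h1 h2
      rw [Int.isUnit_iff] at this
      omega
    have sq : ∀ z : ℤ, (2 ∣ z ∧ ∃ q, z ^ 2 = 4 * q) ∨ (¬ 2 ∣ z ∧ ∃ q, z ^ 2 = 4 * q + 1) := by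
      intro z
      rcases Int.even_or_odd' z with ⟨q, hq | hq⟩
      · left; exact ⟨⟨q, hq⟩, q ^ 2, by rw [hq]; ring⟩
      · right; exact ⟨by omega, q ^ 2 + q, by rw [hq]; ring⟩
    rcases sq x with ⟨hx, u, hu⟩ | ⟨hx, u, hu⟩ <;> rcases sq y with ⟨hy, v, hv⟩ | ⟨hy, v, hv⟩ <;>
      rw [hu, hv] at hp4 <;> ring_nf at hp4
    · exact hne ⟨hx, hy⟩
    · generalize (d : ℤ) * v = w at hp4
      omega
    · generalize (d : ℤ) * v = w at hp4
      omega
    · generalize (d : ℤ) * v = w at hp4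
      omega
  have hpx : ¬ (p : ℤ) ∣ x := by
    intro hx
    have hy : ¬ (p : ℤ) ∣ y := fun hy => hpi.not_isUnit (hxy.isUnit_of_dvd' hx hy)
    have h1 : (p : ℤ) ^ 2 ∣ (d : ℤ) * y ^ 2 :=
      (dvd_add_right (pow_dvd_pow_of_dvd hx 2)).mp hp2
    have hc : IsCoprime ((p : ℤ) ^ 2) (y ^ 2) :=
      ((hpi.coprime_iff_not_dvd).mpr hy).pow
    have h2 : (p : ℤ) ^ 2 ∣ d := hc.dvd_of_dvd_mul_right h1
    have h3 : p * p ∣ d := by rw [← pow_two]; exact_mod_cast h2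
    exact hp.not_isUnit (hdsf p h3)
  have hp2x : ¬ (p : ℤ) ∣ 2 * x := by
    intro h'
    rcases hpi.dvd_or_dvd h' with h' | h'
    · have : p ∣ 2 := by exact_mod_cast h'
      exact hpne ((Nat.prime_dvd_prime_iff_eq hp Nat.prime_two).mp this)
    · exact hpx h'
  have hz : ∀ m : ℕ, ((p : ℤ) : ℤ√(-(d : ℤ))) ∣
      (⟨x, y⟩ : ℤ√(-(d : ℤ))) ^ (m + 1) - (((2 * x) ^ m : ℤ) : ℤ√(-(d : ℤ))) * ⟨x, y⟩ := by
    intro m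
    induction m with
    | zero => simp
    | succ m ih =>
      obtain ⟨c, hc⟩ := ih
      obtain ⟨e, he⟩ : (p : ℤ) ∣ x ^ 2 + (d : ℤ) * y ^ 2 := (dvd_pow_self _ two_ne_zero).trans hp2
      have hsq : (⟨x, y⟩ : ℤ√(-(d : ℤ))) * ⟨x, y⟩ =
          ((2 * x : ℤ) : ℤ√(-(d : ℤ))) * ⟨x, y⟩ - ((p : ℤ) : ℤ√(-(d : ℤ))) * ((e : ℤ) : ℤ√(-(d : ℤ))) := by
        rw [← Int.cast_mul, ← he]
        generalize hW : x ^ 2 + (d : ℤ) * y ^ 2 = W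
        generalize hV : 2 * x = V
        ext
        · simp only [Zsqrtd.re_mul, Zsqrtd.re_sub, Zsqrtd.re_intCast, Zsqrtd.im_intCast]
          rw [← hW, ← hV]; ring
        · simp only [Zsqrtd.im_mul, Zsqrtd.im_sub, Zsqrtd.re_intCast, Zsqrtd.im_intCast]
          rw [← hV]; ring
      refine ⟨c * ⟨x, y⟩ - (((2 * x) ^ m : ℤ) : ℤ√(-(d : ℤ))) * ((e : ℤ) : ℤ√(-(d : ℤ))), ?_⟩
      rw [pow_succ _ (m + 1), pow_succ (2 * x) m, Int.cast_mul ((2 * x) ^ m)]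
      linear_combination (⟨x, y⟩ : ℤ√(-(d : ℤ))) * hc + (((2 * x) ^ m : ℤ) : ℤ√(-(d : ℤ))) * hsq
  intro hdvd
  have hdvd' : ((p : ℤ) : ℤ√(-(d : ℤ))) ∣ (⟨x, y⟩ : ℤ√(-(d : ℤ))) ^ (m + 1) := by
    rw [pow_succ]; exact hdvd.mul_right _
  have h5 := (dvd_sub_right hdvd').mp (hz m)
  rw [Zsqrtd.intCast_dvd] at h5
  have h6 : (p : ℤ) ∣ (2 * x) ^ m * x := by
    have h51 := h5.1
    rw [Zsqrtd.re_mul, Zsqrtd.re_intCast, Zsqrtd.im_intCast] at h51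
    simpa using h51
  rcases hpi.dvd_or_dvd h6 with h7 | h7
  · exact hp2x (hpi.dvd_of_dvd_pow h7)
  · exact hpx h7


/-- **Corollary (solutions of the Pell-like equation `x² + d·y² = p^{2ν}`).**
Let `d > 0` be squarefree with `-d ≢ 1 (mod 4)`, `F = ℚ(√-d)` with `O_F = ℤ[√-d]`, and let
`p` split completely in `F`.  If `t² + d·s² = p^{2N}` with `s, t` coprime and
`ε = (t + s√-d)/p^N` is a fundamental norm-one `p`-unit, then the coprime solutions of
`x² + d·y² = p^{2ν}` are exactly `x + y√-d = ζ·(t ± s√-d)^r`, `ν = r·N`, for roots of unity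
`ζ ∈ F` and `r ∈ ℕ`. -/
theorem stmt_18 (d : ℕ) (hd : 0 < d) (hdsf : Squarefree d)
    (hmod : ¬((4 : ℤ) ∣ (-(d : ℤ) - 1)))
    (F : Type*) [Field F] [NumberField F]
    (hdeg : Module.finrank ℚ F = 2)
    (α : F) (hα : α ^ 2 = -(d : F))
    (p : ℕ) (hp : p.Prime)
    -- p splits completely in F/ℚ
    (P P' : Ideal (NumberField.RingOfIntegers F))
    (hP : P.IsPrime) (hP' : P'.IsPrime) (hPP' : P ≠ P')
    (hfac : Ideal.span {(p : NumberField.RingOfIntegers F)} = P * P')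
    (N : ℕ) (hN : 0 < N)
    (s t : ℤ) (hst : IsCoprime s t)
    (hpell : t ^ 2 + (d : ℤ) * s ^ 2 = (p : ℤ) ^ (2 * N))
    -- O_F[1/p] = ℤ[√-d][1/p] as a subset of F
    (Rset : Set F)
    (hRset : Rset = {x | ∃ (a b : ℤ) (k : ℕ), x = ((a : F) + (b : F) * α) / (p : F) ^ k})
    -- the norm-one p-unit group
    (G : Set F)
    (hG : G = {x ∈ Rset | (∃ y ∈ Rset, x * y = 1) ∧ Algebra.norm ℚ x = 1})
    (ε : F) (hε : ε = ((t : F) + (s : F) * α) / (p : F) ^ N)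
    (hεG : ε ∈ G)
    -- ε generates G modulo torsion
    (hgen : ∀ x ∈ G, ∃ (ζ : F) (k : ℤ), (∃ m : ℕ+, ζ ^ (m : ℕ) = 1) ∧ x = ζ * ε ^ k) :
    ∀ x y : ℤ, IsCoprime x y → ∀ ν : ℕ,
      (x ^ 2 + (d : ℤ) * y ^ 2 = (p : ℤ) ^ (2 * ν) ↔
        ∃ (ζ : F) (r : ℕ) (sg : ℤ), (sg = 1 ∨ sg = -1) ∧
          (∃ m : ℕ+, ζ ^ (m : ℕ) = 1) ∧ ν = r * N ∧
          (x : F) + (y : F) * α = ζ * ((t : F) + (sg : F) * (s : F) * α) ^ r) := by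
  have hp0 : (p : F) ≠ 0 := by exact_mod_cast hp.ne_zero
  have hnorm := normAux d hd F hdeg α hα
  have hnormZ : ∀ a b : ℤ, Algebra.norm ℚ ((a : F) + (b : F) * α) = (a : ℚ) ^ 2 + d * (b : ℚ) ^ 2 := by
    intro a b
    have := hnorm a b
    simpa using this
  intro x y hxy ν
  constructor
  · intro h
    have hF : (x : F) ^ 2 + d * (y : F) ^ 2 = (p : F) ^ (2 * ν) := by exact_mod_cast congrArg (Int.cast : ℤ → F) h
    have hQ : (x : ℚ) ^ 2 + d * (y : ℚ) ^ 2 = (p : ℚ) ^ (2 * ν) := by exact_mod_cast congrArg (Int.cast : ℤ → ℚ) h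
    have hpF : (t : F) ^ 2 + d * (s : F) ^ 2 = (p : F) ^ (2 * N) := by
      exact_mod_cast congrArg (Int.cast : ℤ → F) hpell
    have hη : ((x : F) + (y : F) * α) / (p : F) ^ ν ∈ G := by
      rw [hG, hRset]
      refine ⟨⟨x, y, ν, rfl⟩, ⟨_, ⟨x, -y, ν, rfl⟩, ?_⟩, ?_⟩
      · field_simp
        push_cast
        rw [pow_mul' (p : F) 2 ν] at hF
        linear_combination hF - (y : F) ^ 2 * hα
      · have hpq : (p : ℚ) ≠ 0 := by exact_mod_cast hp.ne_zero
        have e : ((x : F) + (y : F) * α) / (p : F) ^ ν =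
            (((x : ℚ) / (p : ℚ) ^ ν : ℚ) : F) + (((y : ℚ) / (p : ℚ) ^ ν : ℚ) : F) * α := by
          push_cast; ring
        rw [e, hnorm]
        field_simp
        rw [pow_mul' (p : ℚ) 2 ν] at hQ
        linear_combination hQ
    obtain ⟨ζ, k, ⟨m, hm⟩, hk⟩ := hgen _ hη
    have hsg : ∃ (r : ℕ) (sg : ℤ), (sg = 1 ∨ sg = -1) ∧
        ε ^ k = (((t : F) + (sg : F) * (s : F) * α) / (p : F) ^ N) ^ r := by
      rcases Int.eq_nat_or_neg k with ⟨r, rfl | rfl⟩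
      · exact ⟨r, 1, Or.inl rfl, by rw [hε]; simp⟩
      · refine ⟨r, -1, Or.inr rfl, ?_⟩
        rw [zpow_neg, zpow_natCast, ← inv_pow]
        congr 1
        apply inv_eq_of_mul_eq_one_right
        rw [hε]
        field_simp
        push_cast
        rw [pow_mul' (p : F) 2 N] at hpF
        linear_combination hpF - (s : F) ^ 2 * hα
    obtain ⟨r, sg, hsg1, hεk⟩ := hsg
    rw [hεk] at hk
    have hsgsq : sg ^ 2 = 1 := by rcases hsg1 with rfl | rfl <;> norm_num
    have hmain : ((x : F) + (y : F) * α) * (p : F) ^ (r * N) =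
        ζ * ((t : F) + (sg : F) * (s : F) * α) ^ r * (p : F) ^ ν := by
      rw [div_pow, ← pow_mul, mul_comm N r] at hk
      field_simp at hk
      linear_combination hk
    let φ : ℤ√(-(d : ℤ)) →+* F := Zsqrtd.lift ⟨α, by rw [← pow_two, hα]; push_cast; rfl⟩
    have hφ : Function.Injective φ := by
      apply Zsqrtd.lift_injective
      intro n hn
      have : (0 : ℤ) < d := by exact_mod_cast hd
      nlinarith [mul_self_nonneg n]
    have hφv : ∀ a b : ℤ, φ ⟨a, b⟩ = (a : F) + (b : F) * α := by
      intro a b; simp [φ]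
    have hpow : (⟨x, y⟩ : ℤ√(-(d : ℤ))) ^ (m : ℕ) * ((p : ℤ) : ℤ√(-(d : ℤ))) ^ (r * N * m) =
        (⟨t, sg * s⟩ : ℤ√(-(d : ℤ))) ^ (r * m) * ((p : ℤ) : ℤ√(-(d : ℤ))) ^ (ν * m) := by
      apply hφ
      simp only [map_mul, map_pow, map_intCast]
      rw [hφv, hφv]
      have := congrArg (fun z : F => z ^ (m : ℕ)) hmain
      simp only [mul_pow, hm, one_mul, ← pow_mul] at this
      push_cast
      simpa using this
    have hP0 : ((p : ℤ) : ℤ√(-(d : ℤ))) ≠ 0 := by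
      intro h0
      have := congrArg φ h0
      simp at this
      exact hp.ne_zero this
    have hinj : ∀ (A B : ℤ√(-(d : ℤ))) (i j : ℕ), i < j →
        A * ((p : ℤ) : ℤ√(-(d : ℤ))) ^ i = B * ((p : ℤ) : ℤ√(-(d : ℤ))) ^ j →
        ((p : ℤ) : ℤ√(-(d : ℤ))) ∣ A := by
      intro A B i j hij hAB
      obtain ⟨l, rfl⟩ := Nat.exists_eq_add_of_lt hij
      refine ⟨B * ((p : ℤ) : ℤ√(-(d : ℤ))) ^ l, ?_⟩
      apply hφ
      have h1 := congrArg φ hAB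
      have h2 : φ ((p : ℤ) : ℤ√(-(d : ℤ))) ≠ 0 := by simpa using hp0
      simp only [map_mul, map_pow] at h1 ⊢
      apply mul_right_cancel₀ (pow_ne_zero i h2)
      rw [h1]; ring
    have hcop : IsCoprime t (sg * s) := by
      rcases hsg1 with rfl | rfl
      · simpa using hst.symm
      · simpa using hst.symm.neg_right
    have hν : ν = r * N := by
      rcases lt_trichotomy ν (r * N) with hlt | heq | hgt
      · exfalso
        refine coreAux d hdsf hmod p hp N hN t (sg * s) hcop ?_ (r * m)
          (hinj _ _ _ _ (Nat.mul_lt_mul_of_pos_right hlt m.pos) hpow.symm)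
        rw [← hpell, mul_pow, hsgsq, one_mul]
      · exact heq
      · exfalso
        exact coreAux d hdsf hmod p hp ν (by omega) x y hxy h m
          (hinj _ _ _ _ (Nat.mul_lt_mul_of_pos_right hgt m.pos) hpow)
    refine ⟨ζ, r, sg, hsg1, ⟨m, hm⟩, hν, ?_⟩
    rw [← hν] at hmain
    exact mul_right_cancel₀ (pow_ne_zero ν hp0) hmain
  · rintro ⟨ζ, r, sg, hsg, ⟨m, hm⟩, rfl, h⟩
    have hsgsq : sg ^ 2 = 1 := by rcases hsg with rfl | rfl <;> norm_num
    have h1 := congrArg (Algebra.norm ℚ) h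
    have h2 := hnormZ t (sg * s)
    have hpQ : (t : ℚ) ^ 2 + d * ((sg * s : ℤ) : ℚ) ^ 2 = (p : ℚ) ^ (2 * N) := by
      have : t ^ 2 + d * (sg * s) ^ 2 = (p : ℤ) ^ (2 * N) := by
        rw [← hpell, mul_pow, hsgsq, one_mul]
      exact_mod_cast congrArg (Int.cast : ℤ → ℚ) this
    rw [hpQ] at h2
    push_cast at h2
    rw [map_mul, map_pow, h2, hnormZ, ← pow_mul] at h1
    have h3 : (Algebra.norm ℚ ζ) ^ (m : ℕ) = 1 := by rw [← map_pow, hm, map_one]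
    have hpp : (0 : ℚ) < (p : ℚ) ^ (2 * N * r) := by
      have : (0 : ℚ) < p := by exact_mod_cast hp.pos
      positivity
    have h4 : 0 ≤ Algebra.norm ℚ ζ := by
      by_contra hneg
      push Not at hneg
      have : 0 ≤ (x : ℚ) ^ 2 + d * (y : ℚ) ^ 2 := by positivity
      nlinarith [mul_neg_of_neg_of_pos hneg hpp]
    have h5 : Algebra.norm ℚ ζ = 1 := (pow_eq_one_iff_of_nonneg h4 m.ne_zero).mp h3
    rw [h5, one_mul] at h1
    have h6 : x ^ 2 + (d : ℤ) * y ^ 2 = (p : ℤ) ^ (2 * N * r) := by exact_mod_cast h1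
    rw [h6]; congr 1; ring
end
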